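/- Let d ≥ 4 and 1 < p < 2(d−1)/(d+1). Then for every λ > 0, every choice of finite sets E_j ⊂ (I_j ∩ ℕ) × ℤ^d (j ≥ 1) and every choice of normalized functions b_{n,z} with |b_{n,z}| ≤ χ_{q_z}, the Lebesgue measure of the set { x ∈ ℝ^d : | Σ_{j≥1} 2^{j(d−1)/2} Σ_{(n,z)∈E_j} (K_n ∗ b_{n,z})(x) | > λ } is at most C λ^{−p} Σ_{j≥1} 2^{j(d−1)} #E_j, with C independent of λ, the sets E_j and the functions b_{n,z}. -/

import Mathlib

open MeasureTheory Real Set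
open scoped Classical FourierTransform RealInnerProductSpace NNReal ENNReal

noncomputable section

/-- Euclidean space `ℝ^d`. -/
abbrev Rd (d : ℕ) := EuclideanSpace ℝ (Fin d)

/-- `a` is a "distance function": smooth away from the origin, positive away from the
origin, and homogeneous of degree one. -/
structure IsDistFn {d : ℕ} (a : Rd d → ℝ) : Prop where
  smooth : ContDiffOn ℝ (⊤ : ℕ∞) a {ξ : Rd d | ξ ≠ 0}
  pos : ∀ ξ : Rd d, ξ ≠ 0 → 0 < a ξ
  homog : ∀ t : ℝ, 0 < t → ∀ ξ : Rd d, a (t • ξ) = t * a ξ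

/-- Nonvanishing Gaussian curvature of the cosphere `Σ = {a = 1}`: at every point `ξ` of `Σ`
the second fundamental form, i.e. the Hessian of `a` restricted to the tangent space
`ker (da(ξ))`, is nondegenerate. -/
def CurvNondeg {d : ℕ} (a : Rd d → ℝ) : Prop :=
  ∀ ξ : Rd d, a ξ = 1 → ∀ v : Rd d, fderiv ℝ a ξ v = 0 → v ≠ 0 →
    ∃ w : Rd d, fderiv ℝ a ξ w = 0 ∧ iteratedFDeriv ℝ 2 a ξ ![v, w] ≠ 0

/-- The bump function `η`: smooth, supported in `[1/8,8]`, equal to `1` on `[1/4,4]`. -/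
structure IsBump (η : ℝ → ℝ) : Prop where
  smooth : ContDiff ℝ (⊤ : ℕ∞) η
  supp : ∀ x : ℝ, x ∉ Icc (1/8 : ℝ) 8 → η x = 0
  one : ∀ x ∈ Icc (1/4 : ℝ) 4, η x = 1

/-- The kernel `K_r`, given by the inverse Fourier transform of `ξ ↦ η(a(ξ)) e^{i r a(ξ)}`. -/
def Kker {d : ℕ} (a : Rd d → ℝ) (η : ℝ → ℝ) (r : ℝ) (x : Rd d) : ℂ :=
  ∫ ξ : Rd d, (η (a ξ) : ℂ) * Complex.exp (Complex.I * r * a ξ) *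
    Complex.exp (2 * π * Complex.I * (inner ℝ x ξ : ℝ))

/-- Convolution `K ∗ b`. -/
def conv {d : ℕ} (K b : Rd d → ℂ) (x : Rd d) : ℂ := ∫ y, K (x - y) * b y

/-- The measure `ν_d` on `ℝ`, `dν_d(r) = (1+|r|)^{d-1} dr`. -/
def nuMeas (d : ℕ) : Measure ℝ :=
  volume.withDensity fun r => ENNReal.ofReal ((1 + |r|) ^ (d - 1))

/-- The Lorentz quasinorm `‖f‖_{L^{p,q}(μ)}`. -/
def lorentzNorm {α : Type*} {E : Type*} [MeasurableSpace α] [NormedAddCommGroup E]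
    (μ : Measure α) (p : ℝ) (q : ℝ≥0∞) (f : α → E) : ℝ≥0∞ :=
  if q = ∞ then ⨆ t : ℝ, ENNReal.ofReal t * μ {x | t < ‖f x‖} ^ (1 / p)
  else (∫⁻ t in Ioi (0 : ℝ),
      (ENNReal.ofReal t * μ {x | t < ‖f x‖} ^ (1 / p)) ^ q.toReal / ENNReal.ofReal t) ^
      (1 / q.toReal)

/-- The unit cube `q_z = ∏ [z_i, z_i + 1)`. -/
def qcube (d : ℕ) (z : Fin d → ℤ) : Set (Rd d) :=
  {y : Rd d | ∀ i, (z i : ℝ) ≤ y i ∧ y i < z i + 1}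

/-- A normalized function `b_{n,z}`: measurable, bounded by the characteristic
function of `q_z`. -/
def IsNormalized {d : ℕ} (z : Fin d → ℤ) (b : Rd d → ℂ) : Prop :=
  Measurable b ∧ (∀ y, ‖b y‖ ≤ 1) ∧ ∀ y ∉ qcube d z, b y = 0

/-- A dyadic cube of side length `2^k`, `1 ≤ k ≤ j`, in the tiling of
`[2^j, 2^{j+1}) × ℝ^d`. -/
structure DyCube (d j : ℕ) where
  k : ℕ
  m : ℤ
  zv : Fin d → ℤ
  hk : 1 ≤ k ∧ k ≤ j
  hm : (2:ℤ) ^ (j - k) ≤ m ∧ m < 2 ^ (j + 1 - k)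

/-- side length of a dyadic cube -/
def DyCube.len {d j : ℕ} (Q : DyCube d j) : ℝ := 2 ^ Q.k

/-- a dyadic cube as a subset of `ℝ^{1+d}` -/
def DyCube.toSet {d j : ℕ} (Q : DyCube d j) : Set (ℝ × (Fin d → ℝ)) :=
  {p | ((Q.m : ℝ) * 2 ^ Q.k ≤ p.1 ∧ p.1 < (Q.m + 1) * 2 ^ Q.k) ∧
    ∀ i, (Q.zv i : ℝ) * 2 ^ Q.k ≤ p.2 i ∧ p.2 i < (Q.zv i + 1) * 2 ^ Q.k}

/-- center of a dyadic cube: the `r`-coordinate -/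
def DyCube.centerT {d j : ℕ} (Q : DyCube d j) : ℝ := ((Q.m : ℝ) + 1/2) * 2 ^ Q.k

/-- center of a dyadic cube: the `y`-coordinate -/
def DyCube.centerX {d j : ℕ} (Q : DyCube d j) : Rd d :=
  WithLp.toLp 2 fun i => ((Q.zv i : ℝ) + 1/2) * 2 ^ Q.k

/-- a point `(n,z) ∈ ℕ × ℤ^d` viewed as a point of `ℝ^{1+d}` -/
def embedPt (d : ℕ) (e : ℕ × (Fin d → ℤ)) : ℝ × (Fin d → ℝ) :=
  ((e.1 : ℝ), fun i => (e.2 i : ℝ))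

/-- the number of points of `E` lying in the cube `Q` -/
def cubeCount {d j : ℕ} (E : Finset (ℝ × (Fin d → ℝ))) (Q : DyCube d j) : ℕ :=
  (E.filter (· ∈ Q.toSet)).card

/-- `Q` is `λ`-dense: `#(E ∩ Q) > λ^p l(Q)` -/
def IsDense {d j : ℕ} (E : Finset (ℝ × (Fin d → ℝ))) (lam p : ℝ) (Q : DyCube d j) : Prop :=
  lam ^ p * Q.len < (cubeCount E Q : ℝ)

/-- `Q` is a maximal `λ`-dense dyadic cube -/
def IsMaxDense {d j : ℕ} (E : Finset (ℝ × (Fin d → ℝ))) (lam p : ℝ) (Q : DyCube d j) : Prop :=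
  IsDense E lam p Q ∧
    ∀ Q' : DyCube d j, IsDense E lam p Q' → Q.toSet ⊆ Q'.toSet → Q'.toSet = Q.toSet

/-- a lattice vector viewed as an element of `ℝ^d` -/
def latticeVec (d : ℕ) (z : Fin d → ℤ) : Rd d := WithLp.toLp 2 fun i => (z i : ℝ)

/-- The structural properties of the phase function `ψ = -ψ₋`: Lipschitz with constant `L`,
comparable to the norm, and homogeneous of degree one. -/
structure IsPsi {d : ℕ} (ψ : Rd d → ℝ) (L c₁ c₂ : ℝ) : Prop where
  lip : LipschitzWith (Real.toNNReal L) ψ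
  lower : ∀ x : Rd d, c₁ * ‖x‖ ≤ ψ x
  upper : ∀ x : Rd d, ψ x ≤ c₂ * ‖x‖
  homog : ∀ t : ℝ, 0 < t → ∀ x : Rd d, ψ (t • x) = t * ψ x

/-- The stationary phase kernel estimate for `K_r`, `r ≥ 2`:
`|K_r(x)| ≤ C_N (1+|x|+|r|)^{-(d-1)/2} (1+|ψ(x)-r|)^{-N}`. -/
def KernelEst {d : ℕ} (a : Rd d → ℝ) (η : ℝ → ℝ) (ψ : Rd d → ℝ) : Prop :=
  ∀ N : ℕ, ∃ C : ℝ, 0 < C ∧ ∀ r : ℝ, 2 ≤ r → ∀ x : Rd d,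
    ‖Kker a η r x‖ ≤ C * (1 + ‖x‖ + |r|) ^ (-(((d:ℝ) - 1) / 2)) * (1 + |ψ x - r|) ^ (-(N : ℝ))

/-- The two-sided stationary phase kernel estimate for `K_r`, `|r| ≥ 2`, with the
two phase functions `ψ₊`, `ψ₋`:
`|K_r(x)| ≤ C_N (1+|x|+|r|)^{-(d-1)/2} ∑_± (1+|ψ_±(x)+r|)^{-N}`. -/
def KernelEstPM {d : ℕ} (a : Rd d → ℝ) (η : ℝ → ℝ) (ψp ψm : Rd d → ℝ) : Prop :=
  ∀ N : ℕ, ∃ C : ℝ, 0 < C ∧ ∀ r : ℝ, 2 ≤ |r| → ∀ x : Rd d,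
    ‖Kker a η r x‖ ≤ C * (1 + ‖x‖ + |r|) ^ (-(((d:ℝ) - 1) / 2)) *
      ((1 + |ψp x + r|) ^ (-(N : ℝ)) + (1 + |ψm x + r|) ^ (-(N : ℝ)))

theorem contDiff_parametric_intervalIntegral_nat {P : Type} [NormedAddCommGroup P]
    [NormedSpace ℝ P] [FiniteDimensional ℝ P] (n : ℕ) :
    ∀ {F : Type} [NormedAddCommGroup F] [NormedSpace ℝ F] [FiniteDimensional ℝ F]
      (f : P → ℝ → F), ContDiff ℝ (⊤ : ℕ∞) (Function.uncurry f) →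
      ContDiff ℝ n (fun x => ∫ t in (0:ℝ)..1, f x t) := by
  induction n with
  | zero =>
    intro F _ _ _ f hf
    rw [Nat.cast_zero, contDiff_zero]
    exact intervalIntegral.continuous_parametric_intervalIntegral_of_continuous' hf.continuous 0 1
  | succ n ih =>
    intro F _ _ _ f hf
    have : ProperSpace P := FiniteDimensional.proper ℝ P
    set f' : P → ℝ → (P →L[ℝ] F) := fun x t =>
      (fderiv ℝ (Function.uncurry f) (x, t)).comp (ContinuousLinearMap.inl ℝ P ℝ) with hf'
    have hfd : ContDiff ℝ (⊤ : ℕ∞) (Function.uncurry f') := by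
      have h1 : ContDiff ℝ (⊤ : ℕ∞) (fderiv ℝ (Function.uncurry f)) :=
        hf.fderiv_right (by simp)
      have h2 : Function.uncurry f' = fun z =>
        (fderiv ℝ (Function.uncurry f) z).comp (ContinuousLinearMap.inl ℝ P ℝ) := by
        ext z; rfl
      rw [h2]
      exact h1.clm_comp contDiff_const
    have hder : ∀ x t, HasFDerivAt (fun x => f x t) (f' x t) x := by
      intro x t
      have h1 : HasFDerivAt (Function.uncurry f) (fderiv ℝ (Function.uncurry f) (x, t)) (x, t) :=
        (hf.differentiable (by simp)).differentiableAt.hasFDerivAt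
      have h2 : HasFDerivAt (fun x : P => (x, t)) (ContinuousLinearMap.inl ℝ P ℝ) x :=
        hasFDerivAt_prodMk_left x t
      exact h1.comp x h2
    have key : ∀ x₀, HasFDerivAt (fun x => ∫ t in (0:ℝ)..1, f x t)
        (∫ t in (0:ℝ)..1, f' x₀ t) x₀ := by
      intro x₀
      have hcpt : IsCompact ((Metric.closedBall x₀ 1) ×ˢ (Icc (0:ℝ) 1)) :=
        (isCompact_closedBall x₀ 1).prod isCompact_Icc
      obtain ⟨C, hC⟩ := hcpt.exists_bound_of_continuousOn hfd.continuous.continuousOn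
      have hfc : ∀ x, Continuous (f x) := fun x =>
        hf.continuous.comp (Continuous.prodMk_right x)
      have hfc' : ∀ x, Continuous (f' x) := fun x =>
        hfd.continuous.comp (Continuous.prodMk_right x)
      refine intervalIntegral.hasFDerivAt_integral_of_dominated_of_fderiv_le
        (𝕜 := ℝ) (F := f) (F' := f') (bound := fun _ => C)
        (Metric.ball_mem_nhds x₀ one_pos) ?_ ?_ ?_ ?_ ?_ ?_
      · exact Filter.Eventually.of_forall fun x => (hfc x).aestronglyMeasurable
      · exact (hfc x₀).intervalIntegrable _ _
      · exact (hfc' x₀).aestronglyMeasurable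
      · refine Filter.Eventually.of_forall fun t ht x hx => ?_
        rw [uIoc_of_le zero_le_one] at ht
        exact hC (x, t) ⟨Metric.ball_subset_closedBall hx, Ioc_subset_Icc_self ht⟩
      · simp
      · exact Filter.Eventually.of_forall fun t ht x hx => hder x t
    have hcast : ((n + 1 : ℕ) : WithTop ℕ∞) = (n : WithTop ℕ∞) + 1 := by push_cast; rfl
    rw [hcast, contDiff_succ_iff_fderiv]
    refine ⟨fun x => (key x).differentiableAt, by simp, ?_⟩
    have : fderiv ℝ (fun x => ∫ t in (0:ℝ)..1, f x t) = fun x => ∫ t in (0:ℝ)..1, f' x t :=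
      funext fun x => (key x).fderiv
    rw [this]
    exact ih f' hfd

theorem contDiff_parametric_intervalIntegral {P F : Type} [NormedAddCommGroup P]
    [NormedSpace ℝ P] [FiniteDimensional ℝ P] [NormedAddCommGroup F] [NormedSpace ℝ F]
    [FiniteDimensional ℝ F] (f : P → ℝ → F) (hf : ContDiff ℝ (⊤ : ℕ∞) (Function.uncurry f)) :
    ContDiff ℝ (⊤ : ℕ∞) (fun x => ∫ t in (0:ℝ)..1, f x t) :=
  contDiff_infty.2 fun n => contDiff_parametric_intervalIntegral_nat n f hf

theorem taylor_two_integral {V : Type} [NormedAddCommGroup V] [NormedSpace ℝ V]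
    (f : V → ℝ) (hf : ContDiff ℝ (⊤ : ℕ∞) f) (x v : V) :
    f (x + v) - f x - fderiv ℝ f x v =
      ∫ s in (0:ℝ)..1, (1 - s) * fderiv ℝ (fderiv ℝ f) (x + s • v) v v := by
  have h1 : ContDiff ℝ (⊤ : ℕ∞) (fderiv ℝ f) := hf.fderiv_right (by simp)
  have h2 : ContDiff ℝ (⊤ : ℕ∞) (fderiv ℝ (fderiv ℝ f)) := h1.fderiv_right (by simp)
  have hl : ∀ s : ℝ, HasDerivAt (fun s : ℝ => x + s • v) v s := fun s => by
    simpa using ((hasDerivAt_id s).smul_const v).const_add x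
  have hd0 : ∀ s : ℝ, HasDerivAt (fun s : ℝ => f (x + s • v)) (fderiv ℝ f (x + s • v) v) s :=
    fun s => ((hf.differentiable (by simp)).differentiableAt.hasFDerivAt).comp_hasDerivAt s (hl s)
  have hd1 : ∀ s : ℝ, HasDerivAt (fun s : ℝ => fderiv ℝ f (x + s • v) v)
      (fderiv ℝ (fderiv ℝ f) (x + s • v) v v) s := fun s => by
    have := ((h1.differentiable (by simp)).differentiableAt.hasFDerivAt).comp_hasDerivAt s (hl s)
    exact this.clm_apply (hasDerivAt_const s v) |>.congr_deriv (by simp)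
  have hd : ∀ s : ℝ, HasDerivAt
      (fun s : ℝ => (1 - s) * fderiv ℝ f (x + s • v) v + f (x + s • v))
      ((1 - s) * fderiv ℝ (fderiv ℝ f) (x + s • v) v v) s := fun s => by
    have h := (((hasDerivAt_id s).const_sub 1).mul (hd1 s)).add (hd0 s)
    refine h.congr_deriv ?_
    simp
  have hc : Continuous fun s : ℝ => (1 - s) * fderiv ℝ (fderiv ℝ f) (x + s • v) v v := by
    have := h2.continuous
    fun_prop
  rw [intervalIntegral.integral_eq_sub_of_hasDerivAt (fun s _ => hd s)
    (hc.intervalIntegrable _ _)]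
  simp; ring

theorem norm_iteratedFDeriv_slice_le {V P F : Type} [NormedAddCommGroup V] [NormedSpace ℝ V]
    [NormedAddCommGroup P] [NormedSpace ℝ P] [NormedAddCommGroup F] [NormedSpace ℝ F]
    (G : V × P → F) (hG : ContDiff ℝ (⊤ : ℕ∞) G) (n : ℕ) (y : V) (p : P) :
    ‖iteratedFDeriv ℝ n (fun y => G (y, p)) y‖ ≤ ‖iteratedFDeriv ℝ n G (y, p)‖ := by
  have e : (fun y => G (y, p)) = (fun z => G (z + (0, p))) ∘ (ContinuousLinearMap.inl ℝ V P) := by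
    ext y; simp
  have hG' : ContDiff ℝ (⊤ : ℕ∞) (fun z => G (z + (0, p))) :=
    hG.comp (contDiff_id.add contDiff_const)
  rw [e, ContinuousLinearMap.iteratedFDeriv_comp_right _ hG' _ (by exact_mod_cast le_top),
    iteratedFDeriv_comp_add_right]
  refine (ContinuousMultilinearMap.norm_compContinuousLinearMap_le _ _).trans ?_
  have : ‖ContinuousLinearMap.inl ℝ V P‖ ≤ 1 := by
    refine ContinuousLinearMap.opNorm_le_bound _ zero_le_one fun v => ?_
    simp
  have h1 : ∏ _i : Fin n, ‖ContinuousLinearMap.inl ℝ V P‖ ≤ 1 :=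
    Finset.prod_le_one (fun _ _ => norm_nonneg _) fun _ _ => this
  have h2 : (ContinuousLinearMap.inl ℝ V P) y + (0, p) = (y, p) := by simp
  rw [h2]
  exact mul_le_of_le_one_right (norm_nonneg _) h1

theorem fourier_decay_uniform {d : ℕ} {P : Type} [NormedAddCommGroup P] [NormedSpace ℝ P]
    (G : Rd d × P → ℂ) (hG : ContDiff ℝ (⊤ : ℕ∞) G)
    (K : Set P) (hK : IsCompact K) (R : ℝ) (hR : ∀ y, ∀ p ∈ K, R < ‖y‖ → G (y, p) = 0) (N : ℕ) :
    ∃ C : ℝ, 0 < C ∧ ∀ p ∈ K, ∀ v : Rd d,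
      (1 + ‖v‖) ^ N * ‖𝓕 (fun y => G (y, p)) v‖ ≤ C := by
  have hcpt : IsCompact (Metric.closedBall (0 : Rd d) (R + 1) ×ˢ K) :=
    (isCompact_closedBall _ _).prod hK
  have hbd : ∀ n : ℕ, ∃ B : ℝ, 0 ≤ B ∧ ∀ p ∈ K, ∀ y : Rd d,
      ‖iteratedFDeriv ℝ n (fun y => G (y, p)) y‖ ≤
        (Metric.closedBall (0 : Rd d) (R + 1)).indicator (fun _ => B) y := by
    intro n
    obtain ⟨B, hB⟩ := hcpt.exists_bound_of_continuousOn
      (hG.continuous_iteratedFDeriv (m := n) (by exact_mod_cast le_top)).continuousOn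
    refine ⟨max B 0, le_max_right _ _, fun p hp y => ?_⟩
    by_cases hy : y ∈ Metric.closedBall (0 : Rd d) (R + 1)
    · rw [indicator_of_mem hy]
      exact (norm_iteratedFDeriv_slice_le G hG n y p).trans
        ((hB (y, p) ⟨hy, hp⟩).trans (le_max_left _ _))
    · rw [indicator_of_notMem hy]
      have hy' : R + 1 < ‖y‖ := by simpa using hy
      have : (fun y => G (y, p)) =ᶠ[nhds y] fun _ => 0 := by
        have ho : IsOpen {y : Rd d | R < ‖y‖} := isOpen_lt continuous_const continuous_norm
        filter_upwards [ho.mem_nhds (show R < ‖y‖ by linarith)] with z hz using hR z p hp hz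
      have h2 := (this.iteratedFDeriv ℝ n).eq_of_nhds
      rw [h2]
      simp
  choose B hB0 hB using hbd
  have hfin : volume (Metric.closedBall (0 : Rd d) (R + 1)) ≠ ∞ :=
    (isCompact_closedBall _ _).measure_lt_top.ne
  have hind : ∀ b : ℝ, Integrable ((Metric.closedBall (0 : Rd d) (R + 1)).indicator
      (fun _ => b)) := fun b =>
    (integrable_indicator_iff Metric.isClosed_closedBall.measurableSet).2
      (integrableOn_const hfin)
  have h_int : ∀ n : ℕ, ∀ p ∈ K, Integrable (fun y => iteratedFDeriv ℝ n (fun y => G (y, p)) y) := by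
    intro n p hp
    refine (hind (B n)).mono' ?_ (Filter.Eventually.of_forall fun y => hB n p hp y)
    have : ContDiff ℝ (⊤ : ℕ∞) (fun y => G (y, p)) := hG.comp (contDiff_prodMk_left p)
    exact (this.continuous_iteratedFDeriv (m := n) (by exact_mod_cast le_top)).aestronglyMeasurable
  set I : ℕ → ℝ := fun n => ∫ y, (Metric.closedBall (0 : Rd d) (R + 1)).indicator
      (fun _ => B n) y with hI
  have hI0 : ∀ n, 0 ≤ I n := fun n => integral_nonneg fun y =>
    indicator_nonneg (fun _ _ => hB0 n) y
  have main : ∀ n : ℕ, ∃ C : ℝ, 0 ≤ C ∧ ∀ p ∈ K, ∀ v : Rd d,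
      ‖v‖ ^ n * ‖𝓕 (fun y => G (y, p)) v‖ ≤ C := by
    intro n
    refine ⟨(2 * ((0:ℕ):ℝ) + 2) ^ n * ∑ q ∈ Finset.range (0 + 1) ×ˢ Finset.range (n + 1), I q.2,
      mul_nonneg (by positivity) (Finset.sum_nonneg fun q _ => hI0 _), fun p hp v => ?_⟩
    have hsm : ContDiff ℝ ((n:ℕ∞) : WithTop ℕ∞) (fun y => G (y, p)) :=
      (hG.comp (contDiff_prodMk_left p)).of_le (by exact_mod_cast le_top)
    have h := Real.pow_mul_norm_iteratedFDeriv_fourier_le (K := 0) (N := n) hsm ?_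
      (k := 0) (n := n) le_rfl le_rfl v
    · rw [norm_iteratedFDeriv_zero, pow_zero, one_mul] at h
      refine h.trans ?_
      gcongr with q hq
      have hq1 : q.1 = 0 := by simpa using (Finset.mem_product.1 hq).1
      rw [hq1]
      refine integral_mono_of_nonneg (Filter.Eventually.of_forall fun y => by positivity)
        (hind _) (Filter.Eventually.of_forall fun y => ?_)
      simpa using hB q.2 p hp y
    · intro k m hk hm
      have : k = 0 := by simpa using hk
      subst this
      simpa using (h_int m p hp).norm
  obtain ⟨C0, hC0, h0⟩ := main 0
  obtain ⟨C1, hC1, h1⟩ := main N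
  refine ⟨2 ^ N * (C0 + C1) + 1, by positivity, fun p hp v => ?_⟩
  have hb : (1 + ‖v‖) ^ N ≤ 2 ^ N * (1 + ‖v‖ ^ N) := by
    rcases le_total ‖v‖ 1 with h | h
    · calc (1 + ‖v‖) ^ N ≤ 2 ^ N := by gcongr; linarith
        _ ≤ 2 ^ N * (1 + ‖v‖ ^ N) := le_mul_of_one_le_right (by positivity)
            (by linarith [pow_nonneg (norm_nonneg v) N])
    · calc (1 + ‖v‖) ^ N ≤ (2 * ‖v‖) ^ N := by gcongr; linarith
        _ = 2 ^ N * ‖v‖ ^ N := mul_pow _ _ _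
        _ ≤ 2 ^ N * (1 + ‖v‖ ^ N) := by gcongr; linarith
  have h0' := h0 p hp v
  have h1' := h1 p hp v
  rw [pow_zero, one_mul] at h0'
  calc (1 + ‖v‖) ^ N * ‖𝓕 (fun y => G (y, p)) v‖
      ≤ 2 ^ N * (1 + ‖v‖ ^ N) * ‖𝓕 (fun y => G (y, p)) v‖ := by gcongr
    _ = 2 ^ N * (‖𝓕 (fun y => G (y, p)) v‖ + ‖v‖ ^ N * ‖𝓕 (fun y => G (y, p)) v‖) := by ring
    _ ≤ 2 ^ N * (C0 + C1) := by gcongr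
    _ ≤ _ := by linarith

namespace IsDistFn

variable {d : ℕ} {a : Rd d → ℝ}

theorem map_zero (ha : IsDistFn a) : a 0 = 0 := by
  have := ha.homog 2 (by norm_num) 0
  rw [smul_zero] at this; linarith

theorem nonneg (ha : IsDistFn a) (ξ : Rd d) : 0 ≤ a ξ := by
  rcases eq_or_ne ξ 0 with rfl | h
  · exact ha.map_zero.ge
  · exact (ha.pos ξ h).le

theorem contDiffAt (ha : IsDistFn a) {ξ : Rd d} (h : ξ ≠ 0) : ContDiffAt ℝ (⊤ : ℕ∞) a ξ :=
  ha.smooth.contDiffAt (isOpen_ne.mem_nhds h)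

theorem differentiableAt (ha : IsDistFn a) {ξ : Rd d} (h : ξ ≠ 0) : DifferentiableAt ℝ a ξ :=
  (ha.contDiffAt h).differentiableAt (by simp)

theorem fderiv_self (ha : IsDistFn a) {ξ : Rd d} (h : ξ ≠ 0) : fderiv ℝ a ξ ξ = a ξ := by
  have hl : HasDerivAt (fun t : ℝ => t • ξ) ξ 1 := by
    simpa using (hasDerivAt_id (1:ℝ)).smul_const ξ
  have h1 : HasFDerivAt a (fderiv ℝ a ξ) ((1:ℝ) • ξ) := by
    rw [one_smul]; exact (ha.differentiableAt h).hasFDerivAt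
  have h2 := h1.comp_hasDerivAt (1:ℝ) hl
  have h3 : HasDerivAt (fun t : ℝ => t * a ξ) (a ξ) 1 := by
    simpa using (hasDerivAt_id (1:ℝ)).mul_const (a ξ)
  refine h2.unique (h3.congr_of_eventuallyEq ?_)
  filter_upwards [lt_mem_nhds (zero_lt_one (α := ℝ))] with t ht using ha.homog t ht ξ

theorem fderiv_smul (ha : IsDistFn a) {t : ℝ} (ht : 0 < t) {ξ : Rd d} (h : ξ ≠ 0) :
    fderiv ℝ a (t • ξ) = fderiv ℝ a ξ := by
  have hne : t • ξ ≠ 0 := smul_ne_zero ht.ne' h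
  have h1 : HasFDerivAt a (fderiv ℝ a (t • ξ)) (t • ξ) := (ha.differentiableAt hne).hasFDerivAt
  have hl : HasFDerivAt (fun η : Rd d => t • η) (t • ContinuousLinearMap.id ℝ (Rd d)) ξ :=
    (hasFDerivAt_id ξ).const_smul t
  have h2 := h1.comp ξ hl
  have h3 : HasFDerivAt (fun η : Rd d => t * a η) (t • fderiv ℝ a ξ) ξ :=
    (ha.differentiableAt h).hasFDerivAt.const_mul t
  have h4 : (a ∘ fun η : Rd d => t • η) = fun η : Rd d => t * a η :=
    funext fun η => ha.homog t ht η
  rw [h4] at h2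
  have h5 := h2.unique h3
  ext v
  have h6 := congrArg (fun L : Rd d →L[ℝ] ℝ => L v) h5
  simp at h6
  rcases h6 with h6 | h6
  · exact h6
  · exact absurd h6 ht.ne'

theorem exists_bounds (ha : IsDistFn a) :
    ∃ c C : ℝ, 0 < c ∧ 0 < C ∧ ∀ ξ : Rd d, c * ‖ξ‖ ≤ a ξ ∧ a ξ ≤ C * ‖ξ‖ := by
  have hcpt : IsCompact (Metric.sphere (0 : Rd d) 1) := isCompact_sphere _ _
  have hcont : ContinuousOn a (Metric.sphere (0 : Rd d) 1) := fun ξ hξ =>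
    (ha.differentiableAt (by rintro rfl; simp at hξ)).continuousAt.continuousWithinAt
  have key : ∀ ξ : Rd d, ξ ≠ 0 → ∃ θ ∈ Metric.sphere (0 : Rd d) 1, a ξ = ‖ξ‖ * a θ := by
    intro ξ hξ
    refine ⟨‖ξ‖⁻¹ • ξ, by simp [norm_smul, hξ], ?_⟩
    rw [ha.homog _ (by positivity), ← mul_assoc, mul_inv_cancel₀ (by positivity), one_mul]
  obtain ⟨C, hC⟩ := hcpt.exists_bound_of_continuousOn hcont
  have hlow : ∃ c : ℝ, 0 < c ∧ ∀ θ ∈ Metric.sphere (0 : Rd d) 1, c ≤ a θ := by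
    rcases (Metric.sphere (0 : Rd d) 1).eq_empty_or_nonempty with he | hne
    · exact ⟨1, one_pos, fun θ hθ => by simp [he] at hθ⟩
    · obtain ⟨θ, hθ, hmin⟩ := hcpt.exists_isMinOn hne hcont
      exact ⟨a θ, ha.pos θ (by rintro rfl; simp at hθ), fun θ' hθ' => hmin hθ'⟩
  obtain ⟨c, hc, hcl⟩ := hlow
  refine ⟨c, max C 1, hc, by positivity, fun ξ => ?_⟩
  rcases eq_or_ne ξ 0 with rfl | hξ
  · simp [ha.map_zero]
  · obtain ⟨θ, hθ, he⟩ := key ξ hξ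
    rw [he, mul_comm ‖ξ‖]
    have h1 := hC θ hθ
    rw [Real.norm_eq_abs] at h1
    exact ⟨by gcongr; exact hcl θ hθ,
      by gcongr; exact (le_abs_self _).trans (h1.trans (le_max_left _ _))⟩

theorem continuous (ha : IsDistFn a) : Continuous a := by
  rw [continuous_iff_continuousAt]
  intro ξ
  rcases eq_or_ne ξ 0 with rfl | h
  · obtain ⟨c, C, -, hC, hb⟩ := ha.exists_bounds
    rw [ContinuousAt, ha.map_zero]
    refine squeeze_zero (g := fun ξ => C * ‖ξ‖) (fun ξ => ha.nonneg ξ) (fun ξ => (hb ξ).2) ?_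
    have : Continuous fun ξ : Rd d => C * ‖ξ‖ := by fun_prop
    simpa using this.tendsto 0
  · exact (ha.differentiableAt h).continuousAt

/-- A globally smooth function agreeing with `a` away from a neighbourhood of the origin. -/
theorem exists_smooth_extension (ha : IsDistFn a) : ∃ ã : Rd d → ℝ, ContDiff ℝ (⊤ : ℕ∞) ã ∧
    ∀ ξ : Rd d, 1 / 4 < ‖ξ‖ → ã =ᶠ[nhds ξ] a := by
  let β : ContDiffBump (0 : Rd d) := ⟨1/8, 1/4, by norm_num, by norm_num⟩
  refine ⟨fun ξ => (1 - β ξ) * a ξ, ?_, ?_⟩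
  · rw [contDiff_iff_contDiffAt]
    intro ξ
    rcases eq_or_ne ξ 0 with rfl | h
    · refine (contDiffAt_const (c := (0:ℝ))).congr_of_eventuallyEq ?_
      filter_upwards [β.eventuallyEq_one] with η hη
      simp [hη]
    · exact (contDiffAt_const.sub β.contDiff.contDiffAt).mul (ha.contDiffAt h)
  · intro ξ hξ
    have ho : IsOpen {y : Rd d | 1 / 4 < ‖y‖} := isOpen_lt continuous_const continuous_norm
    filter_upwards [ho.mem_nhds hξ] with η hη
    have : β η = 0 := β.zero_of_le_dist (by
      rw [dist_zero_right]; exact (show (1/4:ℝ) ≤ _ from le_of_lt hη))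
    simp [this]

end IsDistFn

/-- Angular cutoff profile. -/
def cutφ (s : ℝ) : ℝ := 1 - Real.smoothTransition ((16 * s - 1) / 3)

theorem cutφ_contDiff : ContDiff ℝ (⊤ : ℕ∞) cutφ := by
  unfold cutφ
  exact contDiff_const.sub (Real.smoothTransition.contDiff.comp (by fun_prop))

theorem cutφ_zero {s : ℝ} (h : 1 / 4 ≤ s) : cutφ s = 0 := by
  unfold cutφ
  rw [Real.smoothTransition.one_of_one_le (by linarith)]; ring

theorem cutφ_one {s : ℝ} (h : s ≤ 1 / 16) : cutφ s = 1 := by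
  unfold cutφ
  rw [Real.smoothTransition.zero_of_nonpos (by linarith)]; ring

theorem cutφ_nonneg (s : ℝ) : 0 ≤ cutφ s := sub_nonneg.2 (Real.smoothTransition.le_one _)

theorem cutφ_le_one (s : ℝ) : cutφ s ≤ 1 := by
  unfold cutφ; linarith [Real.smoothTransition.nonneg ((16 * s - 1) / 3)]

/-- Anisotropic dilation: identity along `θ`, multiplication by `ε` orthogonally to `θ`. -/
def Tmap {d : ℕ} (θ : Rd d) (ε : ℝ) (y : Rd d) : Rd d := ⟪y, θ⟫ • θ + ε • (y - ⟪y, θ⟫ • θ)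

/-- Cutoff to a cone of aperture about `ε` around the direction of `ζ`. -/
def coneCut {d : ℕ} (ε : ℝ) (ξ ζ : Rd d) : ℝ :=
  if 0 < ⟪ξ, ζ⟫ then cutφ ((‖ξ‖ ^ 2 * ‖ζ‖ ^ 2 / ⟪ξ, ζ⟫ ^ 2 - 1) / ε ^ 2) else 0

section Tmap
variable {d : ℕ} {θ : Rd d}

theorem inner_perp (hθ : ‖θ‖ = 1) (y : Rd d) : ⟪y - ⟪y, θ⟫ • θ, θ⟫ = 0 := by
  rw [inner_sub_left, real_inner_smul_left, real_inner_self_eq_norm_sq, hθ]; ring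

theorem inner_Tmap (hθ : ‖θ‖ = 1) (ε : ℝ) (y : Rd d) : ⟪Tmap θ ε y, θ⟫ = ⟪y, θ⟫ := by
  unfold Tmap
  rw [inner_add_left, real_inner_smul_left (y - _), inner_perp hθ, real_inner_smul_left,
    real_inner_self_eq_norm_sq, hθ]; ring

theorem norm_sq_Tmap (hθ : ‖θ‖ = 1) (ε : ℝ) (y : Rd d) :
    ‖Tmap θ ε y‖ ^ 2 = ⟪y, θ⟫ ^ 2 + ε ^ 2 * ‖y - ⟪y, θ⟫ • θ‖ ^ 2 := by
  have h0 : ⟪⟪y, θ⟫ • θ, ε • (y - ⟪y, θ⟫ • θ)⟫ = 0 := by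
    rw [real_inner_smul_left, real_inner_smul_right, real_inner_comm _ θ, inner_perp hθ]; ring
  unfold Tmap
  rw [norm_add_sq_real, h0, norm_smul, norm_smul, hθ, mul_pow, mul_pow]
  simp

theorem norm_sq_decomp (hθ : ‖θ‖ = 1) (y : Rd d) :
    ‖y‖ ^ 2 = ⟪y, θ⟫ ^ 2 + ‖y - ⟪y, θ⟫ • θ‖ ^ 2 := by
  have := norm_sq_Tmap hθ 1 y
  simpa [Tmap] using this

theorem Tmap_ne_zero_inv (hθ : ‖θ‖ = 1) (y : Rd d) {ε : ℝ} (hε : ε ≠ 0) :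
    Tmap θ ε (Tmap θ ε⁻¹ y) = y := by
  have h := inner_Tmap hθ ε⁻¹ y
  unfold Tmap at h ⊢
  rw [h]
  rw [add_sub_cancel_left, smul_smul, mul_inv_cancel₀ hε, one_smul, add_sub_cancel]

theorem Tmap_det (hθ : ‖θ‖ = 1) {ε : ℝ} (hε : ε ≠ 0) : LinearMap.det
    ((ε • (1 : Rd d →ₗ[ℝ] Rd d)) + (1 - ε) • (innerₗ (Rd d) θ).smulRight θ) = ε ^ (d - 1) := by
  have hd : 1 ≤ d := by
    rcases Nat.eq_zero_or_pos d with rfl | h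
    · have : θ = 0 := Subsingleton.elim _ _
      simp [this] at hθ
    · exact h
  have : (ε • (1 : Rd d →ₗ[ℝ] Rd d)) + (1 - ε) • (innerₗ (Rd d) θ).smulRight θ
      = ε • LinearMap.transvection ((ε⁻¹ - 1) • (innerₗ (Rd d) θ)) θ := by
    refine LinearMap.ext fun v => ?_
    simp only [LinearMap.add_apply, LinearMap.smul_apply, Module.End.one_apply,
      LinearMap.smulRight_apply, LinearMap.transvection.apply, smul_add, smul_smul, smul_eq_mul]
    congr 2
    field_simp
  rw [this, LinearMap.det_smul, LinearMap.transvection.det]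
  have h1 : ((ε⁻¹ - 1) • (innerₗ (Rd d) θ)) θ = ε⁻¹ - 1 := by
    simp [real_inner_self_eq_norm_sq, hθ]
  rw [h1, finrank_euclideanSpace_fin]
  obtain ⟨k, rfl⟩ := Nat.exists_eq_add_of_le' hd
  rw [Nat.add_sub_cancel, pow_succ]
  field_simp
  ring

end Tmap

/-- `Tmap` as a linear map. -/
def TmapL {d : ℕ} (θ : Rd d) (ε : ℝ) : Rd d →ₗ[ℝ] Rd d :=
  (ε • (1 : Rd d →ₗ[ℝ] Rd d)) + (1 - ε) • (innerₗ (Rd d) θ).smulRight θ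

theorem TmapL_apply {d : ℕ} (θ : Rd d) (ε : ℝ) (y : Rd d) : TmapL θ ε y = Tmap θ ε y := by
  simp only [TmapL, Tmap, LinearMap.add_apply, LinearMap.smul_apply, Module.End.one_apply,
    LinearMap.smulRight_apply, innerₗ_apply_apply, real_inner_comm y θ]
  module

theorem Tmap_continuous {d : ℕ} (θ : Rd d) (ε : ℝ) : Continuous (Tmap θ ε) := by
  unfold Tmap; fun_prop

/-- `Tmap` as a measurable equivalence. -/
def TmapE {d : ℕ} {θ : Rd d} (hθ : ‖θ‖ = 1) {ε : ℝ} (hε : ε ≠ 0) : Rd d ≃ᵐ Rd d where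
  toFun := Tmap θ ε
  invFun := Tmap θ ε⁻¹
  left_inv y := by
    have := Tmap_ne_zero_inv hθ y (inv_ne_zero hε)
    rwa [inv_inv] at this
  right_inv y := Tmap_ne_zero_inv hθ y hε
  measurable_toFun := (Tmap_continuous θ ε).measurable
  measurable_invFun := (Tmap_continuous θ ε⁻¹).measurable

theorem integral_comp_Tmap {d : ℕ} {θ : Rd d} (hθ : ‖θ‖ = 1) {ε : ℝ} (hε : 0 < ε)
    (g : Rd d → ℂ) : ∫ ξ, g ξ = ((ε ^ (d - 1) : ℝ) : ℂ) * ∫ y, g (Tmap θ ε y) := by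
  have hdet : LinearMap.det (TmapL θ ε) = ε ^ (d - 1) := Tmap_det hθ hε.ne'
  have h0 : LinearMap.det (TmapL θ ε) ≠ 0 := by rw [hdet]; positivity
  have h1 := Measure.map_linearMap_addHaar_eq_smul_addHaar (volume : Measure (Rd d)) h0
  have h2 : (TmapL θ ε : Rd d → Rd d) = TmapE hθ hε.ne' := funext fun y => TmapL_apply θ ε y
  rw [h2, hdet] at h1
  have h3 : ∫ y, g (Tmap θ ε y) = ∫ ξ, g ξ ∂(Measure.map (TmapE hθ hε.ne') volume) :=
    ((TmapE hθ hε.ne').measurableEmbedding.integral_map g).symm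
  rw [h3, h1, integral_smul_measure, ENNReal.toReal_ofReal (abs_nonneg _),
    abs_of_pos (by positivity), Complex.real_smul, ← mul_assoc, ← Complex.ofReal_mul,
    mul_inv_cancel₀ (by positivity), Complex.ofReal_one, one_mul]

theorem Tmap_inner_symm {d : ℕ} (θ : Rd d) (ε : ℝ) (x y : Rd d) :
    ⟪x, Tmap θ ε y⟫ = ⟪Tmap θ ε x, y⟫ := by
  simp only [Tmap, inner_add_right, inner_add_left, inner_smul_left, inner_smul_right,
    inner_sub_left, inner_sub_right, real_inner_comm y θ]
  simp
  ring

theorem volume_image_Tmap {d : ℕ} {θ : Rd d} (hθ : ‖θ‖ = 1) {ε : ℝ} (hε : 0 < ε)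
    (s : Set (Rd d)) : volume (Tmap θ ε '' s) = ENNReal.ofReal (ε ^ (d - 1)) * volume s := by
  have h2 : Tmap θ ε = TmapL θ ε := funext fun y => (TmapL_apply θ ε y).symm
  rw [h2, Measure.addHaar_image_linearMap]
  rw [show LinearMap.det (TmapL θ ε) = ε ^ (d - 1) from Tmap_det hθ hε.ne',
    abs_of_pos (by positivity)]

/-- A smooth function equal to `1/t` for `t ≥ c` and vanishing for `t ≤ c/2`. -/
def cutInv (c t : ℝ) : ℝ := Real.smoothTransition (2 * t / c - 1) / t

theorem cutInv_eq {c t : ℝ} (hc : 0 < c) (h : c ≤ t) : cutInv c t = t⁻¹ := by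
  unfold cutInv
  rw [Real.smoothTransition.one_of_one_le, one_div]
  have : 1 ≤ t / c := by rwa [one_le_div hc]
  rw [mul_div_assoc]; linarith

theorem cutInv_contDiff {c : ℝ} (hc : 0 < c) : ContDiff ℝ (⊤ : ℕ∞) (cutInv c) := by
  rw [contDiff_iff_contDiffAt]
  intro t
  rcases lt_or_ge t (c / 2) with h | h
  · refine (contDiffAt_const (c := (0:ℝ))).congr_of_eventuallyEq ?_
    filter_upwards [gt_mem_nhds h] with s hs
    unfold cutInv
    rw [Real.smoothTransition.zero_of_nonpos, zero_div]
    have : s / c < 1 / 2 := by rw [div_lt_iff₀ hc]; linarith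
    rw [mul_div_assoc]; linarith
  · have ht : t ≠ 0 := by intro h0; subst h0; linarith
    unfold cutInv
    exact (Real.smoothTransition.contDiff.comp (by fun_prop)).contDiffAt.div contDiffAt_id ht

/-- second-order Taylor remainder `∫₀¹ (1-s) D²f(θ+sεw)(w,w) ds` -/
def taylorRem {d : ℕ} (f : Rd d → ℝ) (q : Rd d × ℝ × Rd d) : ℝ :=
  ∫ s in (0:ℝ)..1, (1 - s) * fderiv ℝ (fderiv ℝ f) (q.1 + s • q.2.1 • q.2.2) q.2.2 q.2.2

theorem taylorRem_contDiff {d : ℕ} {f : Rd d → ℝ} (hf : ContDiff ℝ (⊤ : ℕ∞) f) :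
    ContDiff ℝ (⊤ : ℕ∞) (taylorRem f) := by
  have h1 : ContDiff ℝ (⊤ : ℕ∞) (fderiv ℝ f) := hf.fderiv_right (by simp)
  have h2 : ContDiff ℝ (⊤ : ℕ∞) (fderiv ℝ (fderiv ℝ f)) := h1.fderiv_right (by simp)
  unfold taylorRem
  apply contDiff_parametric_intervalIntegral
    (fun (q : Rd d × ℝ × Rd d) s =>
      (1 - s) * fderiv ℝ (fderiv ℝ f) (q.1 + s • q.2.1 • q.2.2) q.2.2 q.2.2)
  unfold Function.uncurry
  refine ContDiff.mul (by fun_prop) ?_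
  refine ContDiff.clm_apply (ContDiff.clm_apply (h2.comp ?_) (by fun_prop)) (by fun_prop)
  fun_prop

theorem taylorRem_eq {d : ℕ} {f : Rd d → ℝ} (hf : ContDiff ℝ (⊤ : ℕ∞) f) (θ w : Rd d) (ε : ℝ) :
    ε ^ 2 * taylorRem f (θ, ε, w) = f (θ + ε • w) - f θ - fderiv ℝ f θ (ε • w) := by
  rw [taylor_two_integral f hf, taylorRem, ← intervalIntegral.integral_const_mul]
  congr 1
  ext s
  simp
  ring

/-- smooth amplitude of a wave packet in rescaled coordinates -/
def packetAmp {d : ℕ} (f : Rd d → ℝ) (χ : ℝ → ℝ) (c : ℝ) (q : Rd d × (Rd d × ℝ × ℝ)) : ℂ :=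
  let t := ⟪q.1, q.2.1⟫
  let u := q.1 - t • q.2.1
  ((Real.smoothTransition (t / c - 1) * cutφ (‖u‖ ^ 2 * cutInv c t ^ 2) *
    χ (t * f (q.2.1 + q.2.2.1 • cutInv c t • u)) : ℝ) : ℂ) *
    Complex.exp (((t * q.2.2.2 * taylorRem f (q.2.1, q.2.2.1, cutInv c t • u) : ℝ) : ℂ) *
      Complex.I)

theorem packetAmp_contDiff {d : ℕ} {f : Rd d → ℝ} {χ : ℝ → ℝ} {c : ℝ} (hc : 0 < c)
    (hf : ContDiff ℝ (⊤ : ℕ∞) f) (hχ : ContDiff ℝ (⊤ : ℕ∞) χ) :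
    ContDiff ℝ (⊤ : ℕ∞) (packetAmp (d := d) f χ c) := by
  have ht : ContDiff ℝ (⊤ : ℕ∞) fun q : Rd d × (Rd d × ℝ × ℝ) => ⟪q.1, q.2.1⟫ :=
    contDiff_fst.inner ℝ (contDiff_fst.comp contDiff_snd)
  have hθ : ContDiff ℝ (⊤ : ℕ∞) fun q : Rd d × (Rd d × ℝ × ℝ) => q.2.1 := by fun_prop
  have hu : ContDiff ℝ (⊤ : ℕ∞) fun q : Rd d × (Rd d × ℝ × ℝ) => q.1 - ⟪q.1, q.2.1⟫ • q.2.1 :=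
    contDiff_fst.sub (ht.smul hθ)
  have hi := (cutInv_contDiff hc).comp ht
  have hiu := hi.smul hu
  have he : ContDiff ℝ (⊤ : ℕ∞) fun q : Rd d × (Rd d × ℝ × ℝ) => q.2.2.1 := by fun_prop
  have hτ : ContDiff ℝ (⊤ : ℕ∞) fun q : Rd d × (Rd d × ℝ × ℝ) => q.2.2.2 := by fun_prop
  have h1 := Real.smoothTransition.contDiff (n := (⊤ : ℕ∞)) |>.comp ((ht.div_const c).sub (contDiff_const (c := (1:ℝ))))
  have h2 := cutφ_contDiff.comp ((hu.norm_sq ℝ).mul (hi.pow 2))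
  have h3 := hχ.comp (ht.mul (hf.comp (hθ.add (he.smul hiu))))
  have h4 := (ht.mul hτ).mul ((taylorRem_contDiff hf).comp (hθ.prodMk (he.prodMk hiu)))
  have h5 : ContDiff ℝ (⊤ : ℕ∞) (fun x : ℝ => (x : ℂ)) := Complex.ofRealCLM.contDiff
  unfold packetAmp
  exact (h5.comp ((h1.mul h2).mul h3)).mul (((h5.comp h4).mul contDiff_const).cexp)

theorem norm_le_norm_add_of_inner_eq_zero {d : ℕ} {θ w : Rd d} (h : ⟪w, θ⟫ = 0) :
    ‖θ‖ ≤ ‖θ + w‖ := by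
  have h1 := norm_add_sq_real θ w
  rw [real_inner_comm, h] at h1
  exact le_of_sq_le_sq (by nlinarith [sq_nonneg ‖w‖]) (norm_nonneg _)
where
  le_of_sq_le_sq {x y : ℝ} (h : x ^ 2 ≤ y ^ 2) (hy : 0 ≤ y) : x ≤ y := by
    nlinarith [abs_le_of_sq_le_sq' h hy]

theorem coneCut_Tmap {d : ℕ} {θ : Rd d} (hθ : ‖θ‖ = 1) {ε : ℝ} (hε : 0 < ε) (y : Rd d) :
    coneCut ε (Tmap θ ε y) θ =
      if 0 < ⟪y, θ⟫ then cutφ (‖y - ⟪y, θ⟫ • θ‖ ^ 2 / ⟪y, θ⟫ ^ 2) else 0 := by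
  unfold coneCut
  rw [inner_Tmap hθ, norm_sq_Tmap hθ, hθ]
  split_ifs with h
  · congr 1
    field_simp
    ring
  · rfl

section packet
variable {d : ℕ} {a : Rd d → ℝ} {f : Rd d → ℝ} {χ : ℝ → ℝ}

theorem packetAmp_support (hfa : ∀ ξ : Rd d, 1 / 4 < ‖ξ‖ → f ξ = a ξ)
    (hχ : ∀ x, x ∉ Icc (1/8 : ℝ) 8 → χ x = 0) {c0 : ℝ} (hc0 : 0 < c0)
    (hlow : ∀ ξ, c0 * ‖ξ‖ ≤ a ξ) {c : ℝ} (hc : 0 < c) {θ : Rd d} (hθ : ‖θ‖ = 1) (ε τ : ℝ)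
    (y : Rd d) (hy : 16 / c0 < ‖y‖) : packetAmp f χ c (y, θ, ε, τ) = 0 := by
  by_contra hne
  unfold packetAmp at hne
  have h1 := left_ne_zero_of_mul hne
  simp only [ne_eq, Complex.ofReal_eq_zero, mul_eq_zero, not_or] at h1
  obtain ⟨⟨h1, h2⟩, h3⟩ := h1
  set t := ⟪y, θ⟫ with ht
  set u := y - t • θ with hu
  have htc : c < t := by
    by_contra hcon
    apply h1
    apply Real.smoothTransition.zero_of_nonpos
    have : t / c ≤ 1 := by rw [div_le_one hc]; linarith
    linarith
  have ht0 : 0 < t := hc.trans htc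
  rw [cutInv_eq hc htc.le] at h2 h3
  have hw : ⟪ε • t⁻¹ • u, θ⟫ = 0 := by
    rw [real_inner_smul_left, real_inner_smul_left, inner_perp hθ]; ring
  have hn : 1 ≤ ‖θ + ε • t⁻¹ • u‖ := hθ ▸ norm_le_norm_add_of_inner_eq_zero hw
  have h4 : t * f (θ + ε • t⁻¹ • u) ∈ Icc (1/8 : ℝ) 8 := by
    by_contra hcon; exact h3 (hχ _ hcon)
  rw [hfa _ (by linarith)] at h4
  have h5 : c0 ≤ a (θ + ε • t⁻¹ • u) := by
    have := hlow (θ + ε • t⁻¹ • u); nlinarith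
  have h6 : t * c0 ≤ 8 := le_trans (by gcongr) h4.2
  have h7 : ‖u‖ ^ 2 * t⁻¹ ^ 2 < 1 / 4 := by
    by_contra hcon; exact h2 (cutφ_zero (by linarith))
  have h8 : ‖u‖ ^ 2 < t ^ 2 / 4 := by
    field_simp at h7; linarith
  have h9 := norm_sq_decomp hθ y
  rw [← ht, ← hu] at h9
  have h10 : ‖y‖ ≤ 2 * t := by
    nlinarith [norm_nonneg y]
  rw [div_lt_iff₀ hc0] at hy
  nlinarith

theorem packetAmp_eq (ha : IsDistFn a) (hfs : ContDiff ℝ (⊤ : ℕ∞) f)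
    (hfa : ∀ ξ : Rd d, 1 / 4 < ‖ξ‖ → f =ᶠ[nhds ξ] a)
    (hχ : ∀ x, x ∉ Icc (1/8 : ℝ) 8 → χ x = 0) {C0 : ℝ} (hC0 : 0 < C0)
    (hup : ∀ ξ, a ξ ≤ C0 * ‖ξ‖) {θ : Rd d} (hθ : ‖θ‖ = 1) {ε : ℝ} (hε : 0 < ε) (hε1 : ε ≤ 1)
    (r : ℝ) (y : Rd d) :
    packetAmp f χ (1 / (32 * C0)) (y, θ, ε, r * ε ^ 2) =
      ((χ (a (Tmap θ ε y)) * coneCut ε (Tmap θ ε y) θ : ℝ) : ℂ) *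
        Complex.exp (((r * a (Tmap θ ε y) - r * fderiv ℝ a θ (Tmap θ ε y) : ℝ) : ℂ) *
          Complex.I) := by
  rw [coneCut_Tmap hθ hε]
  set c : ℝ := 1 / (32 * C0) with hcdef
  have hc : 0 < c := by positivity
  set t := ⟪y, θ⟫ with ht
  set u := y - t • θ with hu
  have hper : ⟪u, θ⟫ = 0 := inner_perp hθ y
  have hsmall : t < 2 * c → χ (a (Tmap θ ε y)) *
      (if 0 < t then cutφ (‖u‖ ^ 2 / t ^ 2) else 0) = 0 := by
    intro htc
    split_ifs with h0
    · by_contra hne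
      have h2 := right_ne_zero_of_mul hne
      have h7 : ‖u‖ ^ 2 / t ^ 2 < 1 / 4 := by
        by_contra hcon; exact h2 (cutφ_zero (by linarith))
      have h8 : ‖u‖ ^ 2 < t ^ 2 / 4 := by
        rw [div_lt_iff₀ (by positivity)] at h7; linarith
      have h9 := norm_sq_Tmap hθ ε y
      rw [← ht, ← hu] at h9
      have h10 : ‖Tmap θ ε y‖ < 2 * t := by
        have : ε ^ 2 * ‖u‖ ^ 2 ≤ 1 * ‖u‖ ^ 2 := by gcongr; nlinarith
        nlinarith [norm_nonneg (Tmap θ ε y)]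
      have h11 : a (Tmap θ ε y) < 1 / 8 := by
        calc a (Tmap θ ε y) ≤ C0 * ‖Tmap θ ε y‖ := hup _
          _ < C0 * (2 * t) := by gcongr
          _ < C0 * (2 * (2 * c)) := by gcongr
          _ = 1 / 8 := by rw [hcdef]; field_simp; norm_num
      exact left_ne_zero_of_mul hne (hχ _ fun h => by linarith [h.1])
    · simp
  unfold packetAmp
  simp only
  rw [← ht, ← hu]
  rcases le_or_gt t c with htc | htc
  · rw [hsmall (by linarith), Real.smoothTransition.zero_of_nonpos]
    · simp
    · have : t / c ≤ 1 := by rw [div_le_one hc]; linarith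
      linarith
  have ht0 : 0 < t := hc.trans htc
  rw [cutInv_eq hc htc.le]
  have hTy : t • (θ + ε • t⁻¹ • u) = Tmap θ ε y := by
    unfold Tmap
    rw [← ht, ← hu, smul_add, smul_smul, smul_smul, mul_right_comm,
      mul_inv_cancel₀ ht0.ne', one_mul]
  have hw : ⟪ε • t⁻¹ • u, θ⟫ = 0 := by
    rw [real_inner_smul_left, real_inner_smul_left, hper]; ring
  have hn : 1 ≤ ‖θ + ε • t⁻¹ • u‖ := hθ ▸ norm_le_norm_add_of_inner_eq_zero hw
  have hft : t * f (θ + ε • t⁻¹ • u) = a (Tmap θ ε y) := by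
    rw [← hTy, ha.homog t ht0, (hfa _ (by linarith)).eq_of_nhds]
  have hrem := taylorRem_eq hfs θ (t⁻¹ • u) ε
  have hfθ := hfa θ (by rw [hθ]; norm_num)
  have hθ0 : θ ≠ 0 := by rintro rfl; simp at hθ
  rw [hfθ.eq_of_nhds, hfθ.fderiv_eq] at hrem
  have hlin : fderiv ℝ a θ (Tmap θ ε y) = t * (a θ + fderiv ℝ a θ (ε • t⁻¹ • u)) := by
    rw [← hTy, map_smul, map_add, ha.fderiv_self hθ0, smul_eq_mul]
  have hphase : t * (r * ε ^ 2) * taylorRem f (θ, ε, t⁻¹ • u) =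
      r * a (Tmap θ ε y) - r * fderiv ℝ a θ (Tmap θ ε y) := by
    rw [hlin, ← hft]
    linear_combination (t * r) * hrem
  rw [hphase, hft, if_pos ht0]
  have hcut : ‖u‖ ^ 2 * t⁻¹ ^ 2 = ‖u‖ ^ 2 / t ^ 2 := by field_simp
  rw [hcut]
  congr 2
  rcases lt_or_ge t (2 * c) with h2 | h2
  · have := hsmall h2
    rw [if_pos ht0] at this
    rw [this, mul_assoc, mul_comm (cutφ _), this, mul_zero]
  · rw [Real.smoothTransition.one_of_one_le]
    · ring
    · have : 2 ≤ t / c := by rwa [le_div_iff₀ hc]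
      linarith

/-- Decay of a single wave packet. -/
theorem packet_bound (ha : IsDistFn a) (hχs : ContDiff ℝ (⊤ : ℕ∞) χ)
    (hχ : ∀ x, x ∉ Icc (1/8 : ℝ) 8 → χ x = 0) (N : ℕ) :
    ∃ C : ℝ, 0 < C ∧ ∀ θ : Rd d, ‖θ‖ = 1 → ∀ ε : ℝ, 0 < ε → ε ≤ 1 → ∀ r : ℝ, |r| * ε ^ 2 ≤ 1 →
      ∀ x : Rd d, (1 + ‖Tmap θ ε (x + (r / (2 * π)) • gradient a θ)‖) ^ N *
        ‖∫ ξ : Rd d, ((χ (a ξ) * coneCut ε ξ θ : ℝ) : ℂ) * Complex.exp (Complex.I * r * a ξ) *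
          Complex.exp (2 * π * Complex.I * (inner ℝ x ξ : ℝ))‖ ≤ C * ε ^ (d - 1) := by
  obtain ⟨f, hfs, hfa⟩ := ha.exists_smooth_extension
  obtain ⟨c0, C0, hc0, hC0, hb⟩ := ha.exists_bounds
  have hK : IsCompact ((Metric.sphere (0 : Rd d) 1) ×ˢ ((Icc (0:ℝ) 1) ×ˢ (Icc (-1:ℝ) 1))) :=
    (isCompact_sphere _ _).prod (isCompact_Icc.prod isCompact_Icc)
  have hc : (0:ℝ) < 1 / (32 * C0) := by positivity
  obtain ⟨C, hC, hbd⟩ := fourier_decay_uniform (packetAmp f χ (1 / (32 * C0)))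
    (packetAmp_contDiff hc hfs hχs) _ hK (16 / c0)
    (fun y p hp hy => packetAmp_support (fun ξ h => (hfa ξ h).eq_of_nhds) hχ hc0
      (fun ξ => (hb ξ).1) hc (by simpa using hp.1) _ _ y hy) N
  refine ⟨C, hC, fun θ hθ ε hε hε1 r hr x => ?_⟩
  have hmem : ((θ, ε, r * ε ^ 2) : Rd d × ℝ × ℝ) ∈
      ((Metric.sphere (0 : Rd d) 1) ×ˢ ((Icc (0:ℝ) 1) ×ˢ (Icc (-1:ℝ) 1))) := by
    refine ⟨by simpa using hθ, ⟨hε.le, hε1⟩, ?_⟩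
    have : |r * ε ^ 2| ≤ 1 := by rwa [abs_mul, abs_of_nonneg (sq_nonneg ε)]
    exact abs_le.1 this
  set X := x + (r / (2 * π)) • gradient a θ with hX
  have h1 := hbd _ hmem (-Tmap θ ε X)
  rw [norm_neg] at h1
  have h2 : (∫ ξ : Rd d, ((χ (a ξ) * coneCut ε ξ θ : ℝ) : ℂ) *
      Complex.exp (Complex.I * r * a ξ) * Complex.exp (2 * π * Complex.I * (inner ℝ x ξ : ℝ))) =
      ((ε ^ (d - 1) : ℝ) : ℂ) *
        𝓕 (fun y => packetAmp f χ (1 / (32 * C0)) (y, θ, ε, r * ε ^ 2)) (-Tmap θ ε X) := by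
    rw [integral_comp_Tmap hθ hε, Real.fourier_eq']
    congr 2
    ext y
    rw [packetAmp_eq ha hfs hfa hχ hC0 (fun ξ => (hb ξ).2) hθ hε hε1, smul_eq_mul, mul_assoc,
      ← Complex.exp_add, mul_left_comm, ← Complex.exp_add]
    congr 2
    have h3 : ⟪y, -Tmap θ ε X⟫ = -(⟪x, Tmap θ ε y⟫ + r / (2 * π) * fderiv ℝ a θ (Tmap θ ε y)) := by
      rw [inner_neg_right, Tmap_inner_symm, real_inner_comm, hX, inner_add_left,
        real_inner_smul_left, inner_gradient_left]
    rw [h3]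
    push_cast
    have : (π : ℂ) ≠ 0 := by exact_mod_cast Real.pi_ne_zero
    field_simp
    ring
  rw [h2, norm_mul, Complex.norm_real, Real.norm_of_nonneg (by positivity), mul_left_comm, mul_comm]
  gcongr

end packet

/-- The closed annulus `1 ≤ ‖ζ‖ ≤ 2`. -/
def annulus (d : ℕ) : Set (Rd d) := {ζ | 1 ≤ ‖ζ‖ ∧ ‖ζ‖ ≤ 2}

theorem isCompact_annulus (d : ℕ) : IsCompact (annulus d) := by
  have h : annulus d = Metric.closedBall 0 2 ∩ {ζ | 1 ≤ ‖ζ‖} := by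
    ext ζ; simp [annulus, and_comm]
  rw [h]
  exact (isCompact_closedBall _ _).inter_right (isClosed_le continuous_const continuous_norm)

theorem measurableSet_annulus (d : ℕ) : MeasurableSet (annulus d) :=
  (isCompact_annulus d).isClosed.measurableSet

theorem coneCut_nonneg {d : ℕ} (ε : ℝ) (ξ ζ : Rd d) : 0 ≤ coneCut ε ξ ζ := by
  unfold coneCut; split_ifs; exacts [cutφ_nonneg _, le_rfl]

theorem coneCut_le_one {d : ℕ} (ε : ℝ) (ξ ζ : Rd d) : coneCut ε ξ ζ ≤ 1 := by
  unfold coneCut; split_ifs; exacts [cutφ_le_one _, zero_le_one]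

theorem coneCut_comm {d : ℕ} (ε : ℝ) (ξ ζ : Rd d) : coneCut ε ξ ζ = coneCut ε ζ ξ := by
  unfold coneCut; rw [real_inner_comm, mul_comm (‖ξ‖ ^ 2)]

theorem coneCut_smul {d : ℕ} (ε : ℝ) (ξ ζ : Rd d) {t : ℝ} (ht : 0 < t) :
    coneCut ε ξ (t • ζ) = coneCut ε ξ ζ := by
  unfold coneCut
  rw [real_inner_smul_right, norm_smul, Real.norm_of_nonneg ht.le]
  simp only [mul_pos_iff_of_pos_left ht]
  split_ifs with h
  · congr 2
    field_simp
  · rfl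

theorem measurable_coneCut {d : ℕ} (ε : ℝ) :
    Measurable fun q : Rd d × Rd d => coneCut ε q.1 q.2 := by
  unfold coneCut
  have hm : Measurable fun q : Rd d × Rd d => ⟪q.1, q.2⟫ :=
    (continuous_fst.inner continuous_snd).measurable
  refine Measurable.ite (measurableSet_lt measurable_const hm) ?_ measurable_const
  refine cutφ_contDiff.continuous.measurable.comp ?_
  exact ((((measurable_fst.norm.pow_const 2).mul (measurable_snd.norm.pow_const 2)).div
    (hm.pow_const 2)).sub_const 1).div_const _

/-- total mass of the cone cutoffs -/
def coneMass (d : ℕ) (ε : ℝ) (ξ : Rd d) : ℝ := ∫ ζ in annulus d, coneCut ε ξ ζ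

theorem coneMass_eq {d : ℕ} (ε : ℝ) {ξ ξ' : Rd d} (h : ξ ≠ 0) (h' : ξ' ≠ 0) :
    coneMass d ε ξ = coneMass d ε ξ' := by
  have key : ∀ ξ ξ' : Rd d, ‖ξ‖ = ‖ξ'‖ → coneMass d ε ξ = coneMass d ε ξ' := by
    intro ξ ξ' hn
    set R := (ℝ ∙ (ξ - ξ'))ᗮ.reflection with hR
    have hRξ : R ξ = ξ' := Submodule.reflection_sub hn
    have hmp : MeasurePreserving R volume volume := R.measurePreserving
    have hme : MeasurableEmbedding R := R.toHomeomorph.measurableEmbedding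
    have hpre : R ⁻¹' annulus d = annulus d := by ext ζ; simp [annulus]
    have h1 := hmp.setIntegral_preimage_emb hme (fun ζ => coneCut ε ξ' ζ) (annulus d)
    rw [hpre] at h1
    unfold coneMass
    rw [← h1]
    congr 1
    ext ζ
    rw [← hRξ]
    simp only [coneCut, LinearIsometryEquiv.inner_map_map, LinearIsometryEquiv.norm_map]
  have h1 : coneMass d ε ξ = coneMass d ε ((‖ξ'‖ / ‖ξ‖) • ξ) := by
    have hp : 0 < ‖ξ'‖ / ‖ξ‖ := by positivity
    unfold coneMass
    congr 1; ext ζ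
    rw [coneCut_comm, coneCut_comm _ (_ • _), coneCut_smul _ _ _ hp]
  rw [h1]
  apply key
  rw [norm_smul, norm_div, norm_norm, norm_norm, div_mul_cancel₀ _ (norm_ne_zero_iff.2 h)]

theorem coneMass_lower (d : ℕ) : ∃ c : ℝ, 0 < c ∧ ∀ ε : ℝ, 0 < ε → ε ≤ 1 → ∀ ξ : Rd d, ξ ≠ 0 →
    c * ε ^ (d - 1) ≤ coneMass d ε ξ := by
  refine ⟨(volume (Metric.ball (0 : Rd d) (1/8))).toReal, ?_, fun ε hε hε1 ξ hξ => ?_⟩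
  · exact ENNReal.toReal_pos (Metric.measure_ball_pos _ _ (by norm_num)).ne'
      measure_ball_lt_top.ne
  set e : Rd d := ‖ξ‖⁻¹ • ξ with he
  have hen : ‖e‖ = 1 := by rw [he, norm_smul, norm_inv, norm_norm, inv_mul_cancel₀ (by simpa using hξ)]
  have he0 : e ≠ 0 := by intro h; rw [h] at hen; simp at hen
  rw [coneMass_eq ε hξ he0]
  set B := Metric.ball ((3/2 : ℝ) • e) (1/8)
  have hB : ∀ y ∈ B, Tmap e ε y ∈ annulus d ∧ coneCut ε e (Tmap e ε y) = 1 := by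
    intro y hy
    rw [mem_ball_iff_norm] at hy
    have h1 := norm_sq_decomp hen (y - (3/2 : ℝ) • e)
    have h2 : ⟪y - (3/2 : ℝ) • e, e⟫ = ⟪y, e⟫ - 3/2 := by
      rw [inner_sub_left, real_inner_smul_left, real_inner_self_eq_norm_sq, hen]; ring
    have h3 : y - (3/2 : ℝ) • e - (⟪y, e⟫ - 3/2) • e = y - ⟪y, e⟫ • e := by module
    rw [h2, h3] at h1
    have h4 : ‖y - (3/2 : ℝ) • e‖ ^ 2 < (1/8) ^ 2 := by gcongr
    set t := ⟪y, e⟫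
    set u := y - t • e
    have h5 : (t - 3/2) ^ 2 < (1/8) ^ 2 := by nlinarith [sq_nonneg ‖u‖]
    have h6 : ‖u‖ ^ 2 < (1/8) ^ 2 := by nlinarith [sq_nonneg (t - 3/2)]
    have h7 := abs_lt_of_sq_lt_sq h5 (by norm_num)
    rw [abs_lt] at h7
    have h8 := norm_sq_Tmap hen ε y
    have h9 : ε ^ 2 * ‖u‖ ^ 2 ≤ 1 * (1/8) ^ 2 := by
      gcongr; nlinarith
    refine ⟨⟨?_, ?_⟩, ?_⟩
    · have : 0 ≤ ε ^ 2 * ‖u‖ ^ 2 := by positivity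
      nlinarith [norm_nonneg (Tmap e ε y)]
    · have : ‖Tmap e ε y‖ ^ 2 ≤ 2 ^ 2 := by rw [h8]; nlinarith
      exact (abs_le_of_sq_le_sq' this (by norm_num)).2
    · rw [coneCut_comm, coneCut_Tmap hen hε, if_pos (by linarith)]
      apply cutφ_one
      rw [div_le_iff₀ (by nlinarith)]
      nlinarith
  have hsub : Tmap e ε '' B ⊆ annulus d := by
    rintro _ ⟨y, hy, rfl⟩; exact (hB y hy).1
  have hmeas : MeasurableSet (Tmap e ε '' B) :=
    (TmapE hen hε.ne').measurableEmbedding.measurableSet_image.2 measurableSet_ball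
  have h_int : IntegrableOn (fun ζ => coneCut ε e ζ) (annulus d) := by
    refine Integrable.mono' (g := fun _ => 1)
      (integrableOn_const (isCompact_annulus d).measure_lt_top.ne) ?_ ?_
    · exact ((measurable_coneCut ε).comp (measurable_prodMk_left (x := e))).aestronglyMeasurable
    · exact Filter.Eventually.of_forall fun ζ => by
        rw [Real.norm_of_nonneg (coneCut_nonneg _ _ _)]; exact coneCut_le_one _ _ _
  have h1 : ∫ ζ in Tmap e ε '' B, coneCut ε e ζ ≤ coneMass d ε e :=
    setIntegral_mono_set h_int (Filter.Eventually.of_forall fun ζ => coneCut_nonneg _ _ _)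
      hsub.eventuallyLE
  have h2 : ∫ ζ in Tmap e ε '' B, coneCut ε e ζ = ∫ ζ in Tmap e ε '' B, (1:ℝ) :=
    setIntegral_congr_fun hmeas (by rintro _ ⟨y, hy, rfl⟩; exact (hB y hy).2)
  rw [h2, setIntegral_const, smul_eq_mul, mul_one, Measure.real, volume_image_Tmap hen hε,
    ENNReal.toReal_mul, ENNReal.toReal_ofReal (by positivity), mul_comm,
    Measure.addHaar_ball_center] at h1
  exact h1

section superposition
variable {d : ℕ} {a : Rd d → ℝ} {χ : ℝ → ℝ}

theorem integrable_comp_distFn (ha : IsDistFn a) (hχc : Continuous χ)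
    (hχ : ∀ x, x ∉ Icc (1/8 : ℝ) 8 → χ x = 0) : Integrable fun ξ => χ (a ξ) := by
  obtain ⟨c0, C0, hc0, hC0, hb⟩ := ha.exists_bounds
  refine (hχc.comp ha.continuous).integrable_of_hasCompactSupport ?_
  refine HasCompactSupport.intro (isCompact_closedBall (0 : Rd d) (8 / c0)) fun ξ hξ => ?_
  apply hχ
  intro h
  apply hξ
  rw [mem_closedBall_zero_iff, le_div_iff₀ hc0, mul_comm]
  exact (hb ξ).1.trans h.2

/-- the wave packet in direction `ζ` -/
def packet (a : Rd d → ℝ) (χ : ℝ → ℝ) (r ε : ℝ) (x ζ : Rd d) : ℂ :=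
  ∫ ξ : Rd d, ((χ (a ξ) * coneCut ε ξ ζ : ℝ) : ℂ) * Complex.exp (Complex.I * r * a ξ) *
    Complex.exp (2 * π * Complex.I * (inner ℝ x ξ : ℝ))

theorem norm_exp_I_mul (r s : ℝ) : ‖Complex.exp (Complex.I * r * s)‖ = 1 := by
  rw [show Complex.I * r * s = ((r * s : ℝ) : ℂ) * Complex.I by push_cast; ring]
  exact Complex.norm_exp_ofReal_mul_I _

theorem norm_exp_two_pi_I_mul (s : ℝ) : ‖Complex.exp (2 * π * Complex.I * s)‖ = 1 := by
  rw [show 2 * π * Complex.I * s = ((2 * π * s : ℝ) : ℂ) * Complex.I by push_cast; ring]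
  exact Complex.norm_exp_ofReal_mul_I _

theorem superposition (ha : IsDistFn a) (hχc : Continuous χ)
    (hχ : ∀ x, x ∉ Icc (1/8 : ℝ) 8 → χ x = 0) (r ε : ℝ) (x e : Rd d) (he : e ≠ 0) :
    (coneMass d ε e : ℂ) * Kker a χ r x = ∫ ζ in annulus d, packet a χ r ε x ζ := by
  unfold packet
  rw [integral_integral_swap]
  · unfold Kker
    rw [← integral_const_mul]
    congr 1
    ext ξ
    rcases eq_or_ne ξ 0 with rfl | hξ
    · simp [ha.map_zero, hχ 0 (by norm_num)]
    · rw [coneMass_eq ε he hξ]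
      rw [integral_mul_const, integral_mul_const]
      push_cast
      rw [integral_const_mul, coneMass, ← integral_complex_ofReal]
      ring
  · have h1 : Integrable (fun q : Rd d × Rd d => (1:ℝ) * |χ (a q.2)|)
        ((volume.restrict (annulus d)).prod volume) := by
      refine Integrable.mul_prod (f := fun _ => (1:ℝ)) (g := fun ξ => |χ (a ξ)|) ?_
        (integrable_comp_distFn ha hχc hχ).abs
      exact integrableOn_const (isCompact_annulus d).measure_lt_top.ne
    refine h1.mono' ?_ (Filter.Eventually.of_forall fun q => ?_)
    · apply Measurable.aestronglyMeasurable
      unfold Function.uncurry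
      have m1 : Measurable fun q : Rd d × Rd d => χ (a q.2) :=
        (hχc.comp (ha.continuous.comp continuous_snd)).measurable
      have m2 : Measurable fun q : Rd d × Rd d => coneCut ε q.2 q.1 :=
        (measurable_coneCut ε).comp measurable_swap
      have m3 : Continuous fun q : Rd d × Rd d => Complex.exp (Complex.I * r * a q.2) := by
        have := ha.continuous
        fun_prop
      have m4 : Continuous fun q : Rd d × Rd d =>
          Complex.exp (2 * π * Complex.I * (inner ℝ x q.2 : ℝ)) := by
        fun_prop
      exact ((Complex.measurable_ofReal.comp (m1.mul m2)).mul m3.measurable).mul m4.measurable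
    · unfold Function.uncurry
      rw [norm_mul, norm_mul, norm_exp_I_mul, norm_exp_two_pi_I_mul, Complex.norm_real,
        mul_one, mul_one, norm_mul, Real.norm_of_nonneg (coneCut_nonneg _ _ _), one_mul,
        Real.norm_eq_abs]
      exact mul_le_of_le_one_right (abs_nonneg _) (coneCut_le_one _ _ _)

end superposition

/-- Quantitative local invertibility of a map with injective strict derivative. -/
theorem exists_local_inverse_bounds {E : Type*} [NormedAddCommGroup E] [NormedSpace ℝ E]
    [FiniteDimensional ℝ E] {F : E → E} {f' : E →L[ℝ] E} {x₀ : E}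
    (hF : HasStrictFDerivAt F f' x₀) (hinj : Function.Injective f') :
    ∃ ρ κ : ℝ, 0 < ρ ∧ 0 < κ ∧
      (∀ x ∈ Metric.ball x₀ ρ, ∀ y ∈ Metric.ball x₀ ρ, κ * ‖x - y‖ ≤ ‖F x - F y‖) ∧
      ∀ x t, 0 ≤ t → Metric.closedBall x t ⊆ Metric.ball x₀ ρ →
        Metric.closedBall (F x) (κ * t) ⊆ F '' Metric.closedBall x t := by
  have := FiniteDimensional.complete ℝ E
  set e : E ≃L[ℝ] E :=
    (LinearEquiv.ofInjectiveEndo (f' : E →ₗ[ℝ] E) hinj).toContinuousLinearEquiv with he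
  have hef : (e : E →L[ℝ] E) = f' := by ext v; rfl
  rw [← hef] at hF
  obtain ⟨s, hs, hso, happ⟩ := hF.approximates_deriv_on_open_nhds
  obtain ⟨ρ, hρ, hρs⟩ := Metric.isOpen_iff.1 hso x₀ hs
  rcases e.subsingleton_or_nnnorm_symm_pos with hsub | hpos
  · exact ⟨ρ, 1, hρ, one_pos, fun x _ y _ => by simp [Subsingleton.elim x y],
      fun x t ht _ y _ => ⟨x, Metric.mem_closedBall_self ht, Subsingleton.elim _ _⟩⟩
  set N : ℝ≥0 := ‖(e.symm : E →L[ℝ] E)‖₊ with hN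
  have hNpos : (0:ℝ) < N := hpos
  refine ⟨ρ, (N : ℝ)⁻¹ / 2, hρ, by positivity, fun x hx y hy => ?_, fun x t ht hsub => ?_⟩
  · have h1 := happ x (hρs hx) y (hρs hy)
    have h2 : ‖x - y‖ ≤ N * ‖e (x - y)‖ := by
      have := (e.symm : E →L[ℝ] E).le_opNorm (e (x - y))
      rwa [ContinuousLinearEquiv.coe_coe, e.symm_apply_apply] at this
    have h3 : (N : ℝ)⁻¹ * ‖x - y‖ ≤ ‖e (x - y)‖ := by
      rw [inv_mul_le_iff₀ hNpos]; exact h2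
    have h4 : ‖e (x - y)‖ ≤ ‖F x - F y - e (x - y)‖ + ‖F x - F y‖ := by
      have := norm_sub_le (F x - F y) (F x - F y - e (x - y))
      rw [sub_sub_cancel] at this; linarith
    have h5 : ‖F x - F y - e (x - y)‖ ≤ (N : ℝ)⁻¹ / 2 * ‖x - y‖ := by
      simpa using h1
    linarith
  · have h1 := happ.surjOn_closedBall_of_nonlinearRightInverse e.toNonlinearRightInverse ht
      (hsub.trans hρs)
    have h2 : ((e.toNonlinearRightInverse.nnnorm : ℝ)⁻¹ - ((N⁻¹ / 2 : ℝ≥0) : ℝ)) = (N : ℝ)⁻¹ / 2 := by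
      have : e.toNonlinearRightInverse.nnnorm = N := rfl
      rw [this]; push_cast; ring
    rw [h2] at h1
    exact h1

section geometry
variable {d : ℕ} {a : Rd d → ℝ}

theorem IsDistFn.gradient_contDiffAt (ha : IsDistFn a) {ξ : Rd d} (h : ξ ≠ 0) :
    ContDiffAt ℝ (⊤ : ℕ∞) (gradient a) ξ := by
  have h1 : ContDiffAt ℝ (⊤ : ℕ∞) (fderiv ℝ a) ξ := (ha.contDiffAt h).fderiv_right (by simp)
  exact ((InnerProductSpace.toDual ℝ (Rd d)).symm.contDiff.contDiffAt).comp ξ h1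

theorem IsDistFn.gradient_smul (ha : IsDistFn a) {t : ℝ} (ht : 0 < t) {ξ : Rd d} (h : ξ ≠ 0) :
    gradient a (t • ξ) = gradient a ξ := by
  unfold gradient; rw [ha.fderiv_smul ht h]

theorem IsDistFn.fderiv_fderiv_self (ha : IsDistFn a) {ξ : Rd d} (h : ξ ≠ 0) (v : Rd d) :
    fderiv ℝ (fderiv ℝ a) ξ v ξ = 0 := by
  have h1 : DifferentiableAt ℝ (fderiv ℝ a) ξ :=
    ((ha.contDiffAt h).fderiv_right (m := (⊤ : ℕ∞)) (by simp)).differentiableAt (by simp)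
  have h2 : HasFDerivAt (fun η => fderiv ℝ a η η) _ ξ :=
    h1.hasFDerivAt.clm_apply (hasFDerivAt_id ξ)
  have h3 : HasFDerivAt (fun η => fderiv ℝ a η η) (fderiv ℝ a ξ) ξ := by
    refine (ha.differentiableAt h).hasFDerivAt.congr_of_eventuallyEq ?_
    filter_upwards [isOpen_ne.mem_nhds h] with η hη using ha.fderiv_self hη
  have h4 := congrArg (fun L : Rd d →L[ℝ] ℝ => L v) (h2.unique h3)
  simpa using h4

theorem IsDistFn.fderiv_fderiv_smul (ha : IsDistFn a) {t : ℝ} (ht : 0 < t) {ξ : Rd d}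
    (h : ξ ≠ 0) : t • fderiv ℝ (fderiv ℝ a) (t • ξ) = fderiv ℝ (fderiv ℝ a) ξ := by
  have hne : t • ξ ≠ 0 := smul_ne_zero ht.ne' h
  have h1 : DifferentiableAt ℝ (fderiv ℝ a) (t • ξ) :=
    ((ha.contDiffAt hne).fderiv_right (m := (⊤ : ℕ∞)) (by simp)).differentiableAt (by simp)
  have hl : HasFDerivAt (fun η : Rd d => t • η) (t • ContinuousLinearMap.id ℝ (Rd d)) ξ :=
    (hasFDerivAt_id ξ).const_smul t
  have h2 := h1.hasFDerivAt.comp ξ hl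
  have h3 : fderiv ℝ (fderiv ℝ a) ξ = (fderiv ℝ (fderiv ℝ a) (t • ξ)).comp
      (t • ContinuousLinearMap.id ℝ (Rd d)) := by
    refine (h2.congr_of_eventuallyEq ?_).fderiv
    filter_upwards [isOpen_ne.mem_nhds h] with η hη
    exact (ha.fderiv_smul ht hη).symm
  rw [h3]
  ext v w
  simp

/-- The gradient of `a² / 2`. -/
def halfSqGrad (a : Rd d → ℝ) (ζ : Rd d) : Rd d := a ζ • gradient a ζ

theorem halfSqGrad_contDiffAt (ha : IsDistFn a) {ζ : Rd d} (h : ζ ≠ 0) :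
    ContDiffAt ℝ (⊤ : ℕ∞) (halfSqGrad a) ζ :=
  (ha.contDiffAt h).smul (ha.gradient_contDiffAt h)

theorem halfSqGrad_fderiv_injective (ha : IsDistFn a) (hcurv : CurvNondeg a) {ζ : Rd d}
    (h : ζ ≠ 0) : Function.Injective (fderiv ℝ (halfSqGrad a) ζ) := by
  rw [injective_iff_map_eq_zero]
  intro v hv
  have hfd : DifferentiableAt ℝ (fderiv ℝ a) ζ :=
    ((ha.contDiffAt h).fderiv_right (m := (⊤ : ℕ∞)) (by simp)).differentiableAt (by simp)
  have key : ∀ w, fderiv ℝ a ζ v * fderiv ℝ a ζ w + a ζ * fderiv ℝ (fderiv ℝ a) ζ v w = 0 := by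
    intro w
    have h1 : HasFDerivAt (fun η => ⟪halfSqGrad a η, w⟫) _ ζ :=
      ((halfSqGrad_contDiffAt ha h).differentiableAt (by simp)).hasFDerivAt.inner ℝ
        (hasFDerivAt_const w ζ)
    have h2 : (fun η => ⟪halfSqGrad a η, w⟫) = fun η => a η * fderiv ℝ a η w := by
      ext η
      rw [halfSqGrad, real_inner_smul_left, inner_gradient_left]
    rw [h2] at h1
    have h3 : HasFDerivAt (fun η => a η * fderiv ℝ a η w) _ ζ :=
      (ha.differentiableAt h).hasFDerivAt.mul (hfd.hasFDerivAt.clm_apply (hasFDerivAt_const w ζ))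
    have h4 := congrArg (fun L : Rd d →L[ℝ] ℝ => L v) (h1.unique h3)
    simp [hv] at h4
    linarith
  have hapos := ha.pos ζ h
  have h1 := key ζ
  rw [ha.fderiv_fderiv_self h, ha.fderiv_self h, mul_zero, add_zero] at h1
  have hv0 : fderiv ℝ a ζ v = 0 := by
    rcases mul_eq_zero.1 h1 with h1 | h1
    · exact h1
    · exact absurd h1 hapos.ne'
  by_contra hvne
  set t := (a ζ)⁻¹ with ht
  have htpos : 0 < t := by positivity
  obtain ⟨w, hw, hne⟩ := hcurv (t • ζ) (by rw [ha.homog t htpos, ht, inv_mul_cancel₀ hapos.ne']) v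
    (by rw [ha.fderiv_smul htpos h]; exact hv0) hvne
  rw [iteratedFDeriv_two_apply] at hne
  apply hne
  have h2 := key w
  rw [hv0, zero_mul, zero_add] at h2
  have h3 : fderiv ℝ (fderiv ℝ a) ζ v w = 0 := (mul_eq_zero.1 h2).resolve_left hapos.ne'
  rw [← ha.fderiv_fderiv_smul htpos h] at h3
  simp at h3
  simpa using h3.resolve_left htpos.ne'

theorem exists_uniform_inverse_bounds (ha : IsDistFn a) (hcurv : CurvNondeg a) :
    ∃ κ δ : ℝ, 0 < κ ∧ 0 < δ ∧ ∀ ζ ∈ annulus d,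
      (∀ x ∈ Metric.ball ζ δ, ∀ y ∈ Metric.ball ζ δ,
        κ * ‖x - y‖ ≤ ‖halfSqGrad a x - halfSqGrad a y‖) ∧
      ∀ t, 0 ≤ t → t < δ → Metric.closedBall (halfSqGrad a ζ) (κ * t) ⊆
        halfSqGrad a '' Metric.closedBall ζ t := by
  refine (isCompact_annulus d).induction_on (p := fun s => ∃ κ δ : ℝ, 0 < κ ∧ 0 < δ ∧ ∀ ζ ∈ s,
      (∀ x ∈ Metric.ball ζ δ, ∀ y ∈ Metric.ball ζ δ,
        κ * ‖x - y‖ ≤ ‖halfSqGrad a x - halfSqGrad a y‖) ∧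
      ∀ t, 0 ≤ t → t < δ → Metric.closedBall (halfSqGrad a ζ) (κ * t) ⊆
        halfSqGrad a '' Metric.closedBall ζ t) ⟨1, 1, one_pos, one_pos, by simp⟩ ?_ ?_ ?_
  · rintro s t hst ⟨κ, δ, hκ, hδ, h⟩
    exact ⟨κ, δ, hκ, hδ, fun ζ hζ => h ζ (hst hζ)⟩
  · rintro s t ⟨κ, δ, hκ, hδ, h⟩ ⟨κ', δ', hκ', hδ', h'⟩
    refine ⟨min κ κ', min δ δ', lt_min hκ hκ', lt_min hδ hδ', ?_⟩
    rintro ζ (hζ | hζ)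
    · obtain ⟨h1, h2⟩ := h ζ hζ
      refine ⟨fun x hx y hy => le_trans (by gcongr; exact min_le_left _ _)
        (h1 x (Metric.ball_subset_ball (min_le_left _ _) hx) y
          (Metric.ball_subset_ball (min_le_left _ _) hy)), fun t ht ht' => ?_⟩
      exact (Metric.closedBall_subset_closedBall (by gcongr; exact min_le_left _ _)).trans
        (h2 t ht (ht'.trans_le (min_le_left _ _)))
    · obtain ⟨h1, h2⟩ := h' ζ hζ
      refine ⟨fun x hx y hy => le_trans (by gcongr; exact min_le_right _ _)
        (h1 x (Metric.ball_subset_ball (min_le_right _ _) hx) y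
          (Metric.ball_subset_ball (min_le_right _ _) hy)), fun t ht ht' => ?_⟩
      exact (Metric.closedBall_subset_closedBall (by gcongr; exact min_le_right _ _)).trans
        (h2 t ht (ht'.trans_le (min_le_right _ _)))
  · intro ζ hζ
    have h0 : ζ ≠ 0 := by rintro rfl; simpa using hζ.1.trans_lt' one_pos
    obtain ⟨ρ, κ, hρ, hκ, h1, h2⟩ := exists_local_inverse_bounds
      ((halfSqGrad_contDiffAt ha h0).hasStrictFDerivAt (by simp))
      (halfSqGrad_fderiv_injective ha hcurv h0)
    refine ⟨Metric.ball ζ (ρ / 2), mem_nhdsWithin_of_mem_nhds (Metric.ball_mem_nhds _ (by positivity)),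
      κ, ρ / 2, hκ, by positivity, fun ζ' hζ' => ?_⟩
    have hsub : Metric.ball ζ' (ρ / 2) ⊆ Metric.ball ζ ρ :=
      Metric.ball_subset_ball' (by rw [Metric.mem_ball] at hζ'; linarith)
    exact ⟨fun x hx y hy => h1 x (hsub hx) y (hsub hy), fun t ht ht' =>
      h2 ζ' t ht ((Metric.closedBall_subset_ball ht').trans hsub)⟩

end geometry

section geometry
variable {d : ℕ} {a : Rd d → ℝ}

theorem norm_normalize {ζ : Rd d} (h : ζ ≠ 0) : ‖‖ζ‖⁻¹ • ζ‖ = 1 := by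
  rw [norm_smul, norm_inv, norm_norm, inv_mul_cancel₀ (norm_ne_zero_iff.2 h)]

theorem ne_zero_of_norm_eq_one {θ : Rd d} (h : ‖θ‖ = 1) : θ ≠ 0 := by
  rintro rfl; simp at h

theorem IsDistFn.gradient_normalize (ha : IsDistFn a) {ζ : Rd d} (h : ζ ≠ 0) :
    gradient a (‖ζ‖⁻¹ • ζ) = gradient a ζ :=
  ha.gradient_smul (inv_pos.2 (norm_pos_iff.2 h)) h

theorem IsDistFn.exists_gradient_bound (ha : IsDistFn a) :
    ∃ G : ℝ, 0 < G ∧ ∀ ζ : Rd d, ζ ≠ 0 → ‖gradient a ζ‖ ≤ G := by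
  obtain ⟨C, hC⟩ := (isCompact_sphere (0 : Rd d) 1).exists_bound_of_continuousOn
    (f := gradient a) fun θ hθ =>
      (ha.gradient_contDiffAt (ne_zero_of_norm_eq_one (by simpa using hθ))).continuousAt.continuousWithinAt
  refine ⟨max C 1, by positivity, fun ζ h => ?_⟩
  rw [← ha.gradient_normalize h]
  exact (hC _ (by simpa using norm_normalize h)).trans (le_max_left _ _)

theorem IsDistFn.exists_taylor_bound (ha : IsDistFn a) :
    ∃ K : ℝ, 0 < K ∧ ∀ θ ζ : Rd d, ‖θ‖ = 1 → ‖ζ - θ‖ ≤ 1 / 2 →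
      |a θ - a ζ - fderiv ℝ a ζ (θ - ζ)| ≤ K * ‖ζ - θ‖ ^ 2 := by
  obtain ⟨f, hfs, hfa⟩ := ha.exists_smooth_extension
  have h1 : ContDiff ℝ (⊤ : ℕ∞) (fderiv ℝ f) := hfs.fderiv_right (by simp)
  have h2 : ContDiff ℝ (⊤ : ℕ∞) (fderiv ℝ (fderiv ℝ f)) := h1.fderiv_right (by simp)
  obtain ⟨M, hM⟩ := (isCompact_closedBall (0 : Rd d) 2).exists_bound_of_continuousOn
    (f := fderiv ℝ (fderiv ℝ f)) h2.continuous.continuousOn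
  refine ⟨max M 1, by positivity, fun θ ζ hθ hζ => ?_⟩
  have hζn : 1 / 2 ≤ ‖ζ‖ := by
    have := norm_sub_norm_le θ ζ
    rw [norm_sub_rev, hθ] at this; linarith
  have hζn2 : ‖ζ‖ ≤ 3 / 2 := by
    have := norm_sub_norm_le ζ θ
    rw [hθ] at this; linarith
  have hfζ := hfa ζ (by linarith)
  have hfθ := hfa θ (by rw [hθ]; norm_num)
  have h3 := taylor_two_integral f hfs ζ (θ - ζ)
  rw [add_sub_cancel, hfζ.eq_of_nhds, hfθ.eq_of_nhds, hfζ.fderiv_eq] at h3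
  rw [h3, ← Real.norm_eq_abs, norm_sub_rev ζ θ]
  have h4 := intervalIntegral.norm_integral_le_of_norm_le_const (a := 0) (b := 1)
    (C := max M 1 * ‖θ - ζ‖ ^ 2)
    (f := fun s => (1 - s) * fderiv ℝ (fderiv ℝ f) (ζ + s • (θ - ζ)) (θ - ζ) (θ - ζ)) ?_
  · simpa using h4
  intro s hs
  rw [uIoc_of_le zero_le_one] at hs
  rw [norm_mul]
  have h5 : ‖ζ + s • (θ - ζ)‖ ≤ 2 := by
    calc ‖ζ + s • (θ - ζ)‖ ≤ ‖ζ‖ + ‖s • (θ - ζ)‖ := norm_add_le _ _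
      _ ≤ 3 / 2 + 1 * (1 / 2) := by
        rw [norm_smul, norm_sub_rev θ ζ]
        gcongr
        rw [Real.norm_of_nonneg hs.1.le]; exact hs.2
      _ = 2 := by norm_num
  have h6 := hM (ζ + s • (θ - ζ)) (by simpa using h5)
  have h7 : ‖fderiv ℝ (fderiv ℝ f) (ζ + s • (θ - ζ)) (θ - ζ) (θ - ζ)‖ ≤
      max M 1 * ‖θ - ζ‖ * ‖θ - ζ‖ := by
    refine (ContinuousLinearMap.le_opNorm₂ _ _ _).trans ?_
    gcongr
    exact h6.trans (le_max_left _ _)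
  have h8 : ‖1 - s‖ ≤ 1 := by
    rw [Real.norm_of_nonneg (by linarith [hs.2])]; linarith [hs.1]
  calc _ ≤ 1 * (max M 1 * ‖θ - ζ‖ * ‖θ - ζ‖) := by gcongr
    _ = _ := by ring

theorem IsDistFn.exists_gradient_lipschitz (ha : IsDistFn a) :
    ∃ L : ℝ, 0 < L ∧ ∀ θ θ' : Rd d, ‖θ‖ = 1 → ‖θ'‖ = 1 →
      ‖gradient a θ - gradient a θ'‖ ≤ L * ‖θ - θ'‖ := by
  obtain ⟨f, hfs, hfa⟩ := ha.exists_smooth_extension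
  have h1 : ContDiff ℝ (⊤ : ℕ∞) (fderiv ℝ f) := hfs.fderiv_right (by simp)
  have h2 : ContDiff ℝ (⊤ : ℕ∞) (fderiv ℝ (fderiv ℝ f)) := h1.fderiv_right (by simp)
  obtain ⟨M, hM⟩ := (isCompact_closedBall (0 : Rd d) 1).exists_bound_of_continuousOn
    (f := fderiv ℝ (fderiv ℝ f)) h2.continuous.continuousOn
  refine ⟨max M 1, by positivity, fun θ θ' hθ hθ' => ?_⟩
  have h3 := (convex_closedBall (0 : Rd d) 1).norm_image_sub_le_of_norm_fderiv_le (𝕜 := ℝ)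
    (fun x _ => h1.differentiable (by simp) x) (fun x hx => (hM x hx).trans (le_max_left M 1))
    (show θ' ∈ _ by simp [hθ']) (show θ ∈ _ by simp [hθ])
  rw [(hfa θ (by rw [hθ]; norm_num)).fderiv_eq, (hfa θ' (by rw [hθ']; norm_num)).fderiv_eq] at h3
  unfold gradient
  rw [← map_sub, LinearIsometryEquiv.norm_map]
  exact h3

theorem measurable_gradient (a : Rd d → ℝ) : Measurable (gradient a) := by
  unfold gradient
  exact (InnerProductSpace.toDual ℝ (Rd d)).symm.continuous.measurable.comp (measurable_fderiv ℝ a)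

theorem exists_volume_gradient_near_le (hd : 1 ≤ d) (ha : IsDistFn a) (hcurv : CurvNondeg a) :
    ∃ C : ℝ, 0 < C ∧ ∀ (y : Rd d) (δ : ℝ), 0 < δ →
      volume (annulus d ∩ {ζ | ‖gradient a ζ - y‖ ≤ δ}) ≤ ENNReal.ofReal (C * δ ^ (d - 1)) := by
  obtain ⟨κ, δ₁, hκ, hδ₁, hun⟩ := exists_uniform_inverse_bounds ha hcurv
  obtain ⟨c0, C0, hc0, hC0, hb⟩ := ha.exists_bounds
  obtain ⟨G, hG, hGb⟩ := ha.exists_gradient_bound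
  obtain ⟨t, htA, htf, htc⟩ := (isCompact_annulus d).finite_cover_balls hδ₁
  set C2 : ℝ := (4 * C0 + G + 1) / κ with hC2
  have hC2p : 0 < C2 := by positivity
  set T := htf.toFinset
  set V := (volume (annulus d)).toReal
  set V1 := (volume (Metric.ball (0 : Rd d) 1)).toReal
  have hVtop := (isCompact_annulus d).measure_lt_top (μ := volume)
  have hV1top : volume (Metric.ball (0 : Rd d) 1) ≠ ∞ := measure_ball_lt_top.ne
  refine ⟨V + 1 + T.card * (2 * C0 + 1) * (C2 ^ d * V1), by positivity, fun y δ hδ => ?_⟩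
  have hT : 0 ≤ T.card * (2 * C0 + 1) * (C2 ^ d * V1) := by positivity
  rcases le_or_gt 1 δ with h1 | h1
  · calc volume (annulus d ∩ {ζ | ‖gradient a ζ - y‖ ≤ δ}) ≤ volume (annulus d) :=
          measure_mono inter_subset_left
      _ = ENNReal.ofReal V := (ENNReal.ofReal_toReal hVtop.ne).symm
      _ ≤ _ := by
        apply ENNReal.ofReal_le_ofReal
        have h2 : (1:ℝ) ≤ δ ^ (d - 1) := one_le_pow₀ h1
        have hV : 0 ≤ V := ENNReal.toReal_nonneg
        nlinarith
  set n := ⌊2 * C0 / δ⌋₊ + 1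
  set piece : Rd d → ℕ → Set (Rd d) := fun ζ₀ i =>
    (annulus d ∩ {ζ | ‖gradient a ζ - y‖ ≤ δ}) ∩ Metric.ball ζ₀ δ₁ ∩
      {ζ | i * δ ≤ a ζ ∧ a ζ ≤ (i + 1) * δ}
  have hpiece : ∀ ζ₀ ∈ T, ∀ i ∈ Finset.range n,
      volume (piece ζ₀ i) ≤ ENNReal.ofReal ((C2 * δ) ^ d * V1) := by
    intro ζ₀ hζ₀ i _
    rcases (piece ζ₀ i).eq_empty_or_nonempty with he | ⟨ζ₁, hζ₁⟩
    · rw [he]; simp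
    have hsub : piece ζ₀ i ⊆ Metric.closedBall ζ₁ (C2 * δ) := by
      rintro ζ ⟨⟨⟨hA, hg⟩, hbal⟩, hi1, hi2⟩
      obtain ⟨⟨⟨hA', hg'⟩, hbal'⟩, hi1', hi2'⟩ := hζ₁
      rw [mem_closedBall_iff_norm]
      have hanti := (hun ζ₀ (htA (htf.mem_toFinset.1 hζ₀))).1 ζ hbal ζ₁ hbal'
      have hy : ‖y‖ ≤ G + 1 := by
        have h0 : ζ₁ ≠ 0 := by rintro rfl; simpa using hA'.1.trans_lt' one_pos
        have := norm_sub_norm_le y (gradient a ζ₁)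
        rw [norm_sub_rev] at this
        have hg'' : ‖gradient a ζ₁ - y‖ ≤ δ := hg'
        linarith [hGb ζ₁ h0]
      have hdec : halfSqGrad a ζ - halfSqGrad a ζ₁ = a ζ • (gradient a ζ - y) -
          a ζ₁ • (gradient a ζ₁ - y) + (a ζ - a ζ₁) • y := by
        unfold halfSqGrad; module
      have haζ : ∀ ζ ∈ annulus d, |a ζ| ≤ 2 * C0 := fun ζ hζ => by
        rw [abs_of_nonneg (ha.nonneg ζ)]
        have := (hb ζ).2; nlinarith [hζ.2]
      have hn : ‖halfSqGrad a ζ - halfSqGrad a ζ₁‖ ≤ 2 * C0 * δ + 2 * C0 * δ + δ * (G + 1) := by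
        rw [hdec]
        refine (norm_add_le _ _).trans ?_
        refine add_le_add ((norm_sub_le _ _).trans (add_le_add ?_ ?_)) ?_
        · rw [norm_smul]
          exact mul_le_mul (haζ ζ hA) hg (norm_nonneg _) (by positivity)
        · rw [norm_smul]
          exact mul_le_mul (haζ ζ₁ hA') hg' (norm_nonneg _) (by positivity)
        · rw [norm_smul]
          refine mul_le_mul ?_ hy (norm_nonneg _) hδ.le
          rw [Real.norm_eq_abs, abs_le]; constructor <;> linarith
      rw [hC2, div_mul_eq_mul_div, le_div_iff₀ hκ]
      linarith
    calc volume (piece ζ₀ i) ≤ volume (Metric.closedBall ζ₁ (C2 * δ)) := measure_mono hsub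
      _ = ENNReal.ofReal ((C2 * δ) ^ d) * volume (Metric.ball (0 : Rd d) 1) := by
        rw [Measure.addHaar_closedBall _ _ (by positivity), finrank_euclideanSpace_fin]
      _ = _ := by rw [ENNReal.ofReal_mul (by positivity), ENNReal.ofReal_toReal hV1top]
  have hcover : annulus d ∩ {ζ | ‖gradient a ζ - y‖ ≤ δ} ⊆
      ⋃ ζ₀ ∈ T, ⋃ i ∈ Finset.range n, piece ζ₀ i := by
    intro ζ hζ
    obtain ⟨ζ₀, hζ₀, hζb⟩ := mem_iUnion₂.1 (htc hζ.1)
    refine mem_iUnion₂.2 ⟨ζ₀, htf.mem_toFinset.2 hζ₀, mem_iUnion₂.2 ⟨⌊a ζ / δ⌋₊, ?_, ?_⟩⟩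
    · rw [Finset.mem_range, Nat.lt_succ_iff]
      apply Nat.floor_le_floor
      gcongr
      have := (hb ζ).2; nlinarith [hζ.1.2]
    · refine ⟨⟨hζ, hζb⟩, ?_, ?_⟩
      · have := Nat.floor_le (div_nonneg (ha.nonneg ζ) hδ.le)
        rwa [le_div_iff₀ hδ] at this
      · have := (Nat.lt_floor_add_one (a ζ / δ)).le
        rwa [div_le_iff₀ hδ] at this
  calc volume (annulus d ∩ {ζ | ‖gradient a ζ - y‖ ≤ δ})
      ≤ volume (⋃ ζ₀ ∈ T, ⋃ i ∈ Finset.range n, piece ζ₀ i) := measure_mono hcover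
    _ ≤ ∑ ζ₀ ∈ T, volume (⋃ i ∈ Finset.range n, piece ζ₀ i) := measure_biUnion_finset_le _ _
    _ ≤ ∑ ζ₀ ∈ T, ∑ i ∈ Finset.range n, volume (piece ζ₀ i) :=
        Finset.sum_le_sum fun _ _ => measure_biUnion_finset_le _ _
    _ ≤ ∑ ζ₀ ∈ T, ∑ i ∈ Finset.range n, ENNReal.ofReal ((C2 * δ) ^ d * V1) :=
        Finset.sum_le_sum fun ζ₀ h => Finset.sum_le_sum fun i hi => hpiece ζ₀ h i hi
    _ = ENNReal.ofReal (T.card * (n * ((C2 * δ) ^ d * V1))) := by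
        rw [Finset.sum_const, Finset.sum_const, Finset.card_range, nsmul_eq_mul, nsmul_eq_mul,
          ENNReal.ofReal_mul (Nat.cast_nonneg T.card), ENNReal.ofReal_mul (Nat.cast_nonneg n),
          ENNReal.ofReal_natCast, ENNReal.ofReal_natCast]
    _ ≤ _ := by
        apply ENNReal.ofReal_le_ofReal
        have hn : (n : ℝ) * δ ≤ 2 * C0 + 1 := by
          have : (n : ℝ) ≤ 2 * C0 / δ + 1 := by
            push_cast [n]
            gcongr
            exact Nat.floor_le (by positivity)
          calc (n : ℝ) * δ ≤ (2 * C0 / δ + 1) * δ := by gcongr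
            _ = 2 * C0 + δ := by field_simp
            _ ≤ _ := by linarith
        have hV : 0 ≤ V := ENNReal.toReal_nonneg
        have hpow : δ ^ d = δ * δ ^ (d - 1) := by
          rw [← pow_succ', Nat.sub_add_cancel hd]
        calc T.card * (n * ((C2 * δ) ^ d * V1)) = T.card * (n * δ) * (C2 ^ d * V1) * δ ^ (d - 1) := by
              rw [mul_pow, hpow]; ring
          _ ≤ T.card * (2 * C0 + 1) * (C2 ^ d * V1) * δ ^ (d - 1) := by gcongr
          _ ≤ _ := by gcongr; linarith

theorem inv_one_add_pow_le_tsum (d : ℕ) {s : ℝ} (hs : 0 ≤ s) :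
    ENNReal.ofReal (((1 + s) ^ d)⁻¹) ≤
      ∑' k : ℕ, if s ≤ 2 ^ k then ENNReal.ofReal (2 ^ d * ((2 ^ k) ^ d)⁻¹) else 0 := by
  have hex : ∃ k : ℕ, s ≤ 2 ^ k := by
    obtain ⟨k, hk⟩ := pow_unbounded_of_one_lt s (one_lt_two (α := ℝ))
    exact ⟨k, hk.le⟩
  obtain ⟨k, hk, hmin⟩ : ∃ k : ℕ, s ≤ 2 ^ k ∧ ∀ m < k, ¬ s ≤ 2 ^ m :=
    ⟨Nat.find hex, Nat.find_spec hex, fun m hm => Nat.find_min hex hm⟩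
  refine le_trans ?_ (ENNReal.le_tsum k)
  rw [if_pos hk]
  apply ENNReal.ofReal_le_ofReal
  have h1 : (2:ℝ) ^ k ≤ 2 * (1 + s) := by
    rcases k with _ | m
    · simp; linarith
    · have := hmin m (Nat.lt_succ_self m)
      rw [pow_succ]; linarith
  rw [inv_le_comm₀ (by positivity) (by positivity), mul_inv, inv_inv, ← inv_pow, ← mul_pow]
  gcongr
  rw [inv_mul_le_iff₀ (by norm_num)]
  exact h1

theorem exists_lintegral_gradient_decay (hd : 1 ≤ d) (ha : IsDistFn a) (hcurv : CurvNondeg a) :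
    ∃ C : ℝ, 0 < C ∧ ∀ (y : Rd d) (ε : ℝ), 0 < ε →
      ∫⁻ ζ in annulus d, ENNReal.ofReal (((1 + ‖gradient a ζ - y‖ / ε) ^ d)⁻¹) ≤
        ENNReal.ofReal (C * ε ^ (d - 1)) := by
  obtain ⟨C, hC, hv⟩ := exists_volume_gradient_near_le hd ha hcurv
  refine ⟨2 ^ d * C * 2, by positivity, fun y ε hε => ?_⟩
  have hm : Measurable fun ζ => ‖gradient a ζ - y‖ / ε :=
    (((measurable_gradient a).sub_const y).norm).div_const ε
  have hms : ∀ k : ℕ, MeasurableSet {ζ | ‖gradient a ζ - y‖ / ε ≤ 2 ^ k} := fun k =>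
    measurableSet_le hm measurable_const
  calc ∫⁻ ζ in annulus d, ENNReal.ofReal (((1 + ‖gradient a ζ - y‖ / ε) ^ d)⁻¹)
      ≤ ∫⁻ ζ in annulus d, ∑' k : ℕ, if ‖gradient a ζ - y‖ / ε ≤ 2 ^ k then
          ENNReal.ofReal (2 ^ d * ((2 ^ k) ^ d)⁻¹) else 0 :=
        lintegral_mono fun ζ => inv_one_add_pow_le_tsum d (by positivity)
    _ = ∑' k : ℕ, ∫⁻ ζ in annulus d, if ‖gradient a ζ - y‖ / ε ≤ 2 ^ k then
          ENNReal.ofReal (2 ^ d * ((2 ^ k) ^ d)⁻¹) else 0 :=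
        lintegral_tsum fun k => (Measurable.ite (hms k) measurable_const
          measurable_const).aemeasurable
    _ ≤ ∑' k : ℕ, ENNReal.ofReal (2 ^ d * C * ε ^ (d - 1) * (1 / 2) ^ k) := by
        refine ENNReal.tsum_le_tsum fun k => ?_
        have h1 : (fun ζ => if ‖gradient a ζ - y‖ / ε ≤ 2 ^ k then
          ENNReal.ofReal (2 ^ d * ((2 ^ k) ^ d)⁻¹) else 0) =
          {ζ | ‖gradient a ζ - y‖ / ε ≤ 2 ^ k}.indicator
            fun _ => ENNReal.ofReal (2 ^ d * ((2 ^ k) ^ d)⁻¹) := by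
          ext ζ; simp [indicator]
        rw [h1, lintegral_indicator_const (hms k), Measure.restrict_apply (hms k), inter_comm]
        have h2 : {ζ | ‖gradient a ζ - y‖ / ε ≤ 2 ^ k} = {ζ | ‖gradient a ζ - y‖ ≤ 2 ^ k * ε} := by
          ext ζ; simp [div_le_iff₀ hε]
        rw [h2]
        refine (mul_le_mul_right (hv y (2 ^ k * ε) (by positivity)) _).trans ?_
        rw [← ENNReal.ofReal_mul (by positivity)]
        apply ENNReal.ofReal_le_ofReal
        apply le_of_eq
        have hpow : ((2:ℝ) ^ k) ^ d = 2 ^ k * (2 ^ k) ^ (d - 1) := by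
          rw [← pow_succ', Nat.sub_add_cancel hd]
        rw [hpow, mul_pow, one_div, inv_pow]
        field_simp
    _ = ENNReal.ofReal (2 ^ d * C * 2 * ε ^ (d - 1)) := by
        rw [← ENNReal.ofReal_tsum_of_nonneg (fun k => by positivity)
          (summable_geometric_two.mul_left _), tsum_mul_left, tsum_geometric_two]
        ring_nf

/-- The singular set of `K_r`. -/
def waveSet (a : Rd d → ℝ) (r : ℝ) : Set (Rd d) :=
  (fun θ => (-(r / (2 * π))) • gradient a θ) '' Metric.sphere 0 1

theorem mem_waveSet (ha : IsDistFn a) (r : ℝ) {ζ : Rd d} (h : ζ ≠ 0) :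
    (-(r / (2 * π))) • gradient a ζ ∈ waveSet a r :=
  ⟨‖ζ‖⁻¹ • ζ, by simpa using norm_normalize h, by simp only [ha.gradient_normalize h]⟩

theorem abs_inner_le_norm_Tmap {θ : Rd d} (hθ : ‖θ‖ = 1) (ε : ℝ) (X : Rd d) :
    |⟪X, θ⟫| ≤ ‖Tmap θ ε X‖ := by
  rw [← inner_Tmap hθ ε]
  simpa [hθ] using abs_real_inner_le_norm (Tmap θ ε X) θ

theorem mul_norm_le_norm_Tmap {θ : Rd d} (hθ : ‖θ‖ = 1) {ε : ℝ} (hε : 0 ≤ ε) (hε1 : ε ≤ 1)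
    (X : Rd d) : ε * ‖X‖ ≤ ‖Tmap θ ε X‖ := by
  apply abs_le_of_sq_le_sq' _ (norm_nonneg _) |>.2
  rw [mul_pow, norm_sq_Tmap hθ, norm_sq_decomp hθ X]
  have : ε ^ 2 ≤ 1 := by nlinarith
  nlinarith [sq_nonneg ⟪X, θ⟫]

set_option maxHeartbeats 1600000 in
theorem exists_infDist_waveSet_le (ha : IsDistFn a) (hcurv : CurvNondeg a) :
    ∃ C : ℝ, 0 < C ∧ ∀ (r : ℝ) (x θ : Rd d), ‖θ‖ = 1 → ∀ ε : ℝ, 0 < ε →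
      ε ^ 2 * (1 + |r|) = 1 → 1 + Metric.infDist x (waveSet a r) ≤
        C * (1 + ‖Tmap θ ε (x + (r / (2 * π)) • gradient a θ)‖) ^ 2 := by
  obtain ⟨κ, δ₁, hκ, hδ₁, hun⟩ := exists_uniform_inverse_bounds ha hcurv
  obtain ⟨c0, C0, hc0, hC0, hb⟩ := ha.exists_bounds
  obtain ⟨G, hG, hGb⟩ := ha.exists_gradient_bound
  obtain ⟨K, hK, htay⟩ := ha.exists_taylor_bound
  set δ₂ := min δ₁ (1/2) / 2 with hδ₂
  have hmin : 0 < min δ₁ (1/2) := by positivity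
  have hδ₂p : 0 < δ₂ := by positivity
  have hδ₂1 : δ₂ < δ₁ := by have := min_le_left δ₁ (1/2); linarith
  have hδ₂2 : δ₂ ≤ 1/2 := by have := min_le_right δ₁ (1/2); linarith
  set δ := κ * δ₂ / C0 with hδ
  have hδp : 0 < δ := by positivity
  set C3 := (1 / c0) * (2 * π + (2 * C0 / c0) * K * (C0 ^ 2 * (2 * π) ^ 2 * 2 / κ ^ 2)) with hC3
  have hC3p : 0 < C3 := by positivity
  refine ⟨1 + 2 + 4 * π / δ + G * C3, by positivity, fun r x θ hθ ε hε hεr => ?_⟩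
  have hε1 : ε ≤ 1 := by nlinarith [abs_nonneg r, mul_nonneg (sq_nonneg ε) (abs_nonneg r)]
  have hθ0 := ne_zero_of_norm_eq_one hθ
  set X := x + (r / (2 * π)) • gradient a θ with hX
  set τ := ‖Tmap θ ε X‖ with hτ
  have hτ0 : 0 ≤ τ := norm_nonneg _
  have hX1 : ε * ‖X‖ ≤ τ := mul_norm_le_norm_Tmap hθ hε.le hε1 X
  have hX2 : |⟪X, θ⟫| ≤ τ := abs_inner_le_norm_Tmap hθ ε X
  have hDX : Metric.infDist x (waveSet a r) ≤ ‖X‖ := by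
    refine (Metric.infDist_le_dist_of_mem (mem_waveSet ha r hθ0)).trans (le_of_eq ?_)
    rw [dist_eq_norm, hX, neg_smul, sub_neg_eq_add]
  have suff : ∀ A : ℝ, 0 ≤ A → Metric.infDist x (waveSet a r) ≤ A * (1 + τ) ^ 2 →
      A ≤ 2 + 4 * π / δ + G * C3 → 1 + Metric.infDist x (waveSet a r) ≤
        (1 + 2 + 4 * π / δ + G * C3) * (1 + τ) ^ 2 := by
    intro A hA h1 h2
    have h3 : 1 ≤ (1 + τ) ^ 2 := by nlinarith
    nlinarith
  have hp1 : 0 < 4 * π / δ := by positivity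
  have hp2 : 0 < G * C3 := by positivity
  rcases le_or_gt |r| 1 with hr | hr
  · apply suff 2 (by norm_num) _ (by linarith)
    have : 1 / 2 ≤ ε := by
      by_contra hcon
      have : ε ^ 2 < 1 / 4 := by nlinarith
      nlinarith
    nlinarith [norm_nonneg X]
  have hr0 : r ≠ 0 := by rintro rfl; simp at hr; linarith
  have hrp : 0 < |r| := by linarith
  set y := (-(2 * π / r)) • x with hy
  have hXy : X = (r / (2 * π)) • (gradient a θ - y) := by
    rw [hX, hy, smul_sub, smul_smul]
    have : r / (2 * π) * -(2 * π / r) = -1 := by field_simp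
    rw [this]; module
  have hXn : ‖X‖ = |r| / (2 * π) * ‖gradient a θ - y‖ := by
    rw [hXy, norm_smul, Real.norm_eq_abs, abs_div, abs_of_pos (by positivity : (0:ℝ) < 2 * π)]
  have hε2 : 1 ≤ ε ^ 2 * (2 * |r|) := by nlinarith [sq_nonneg ε]
  have hXsq : ‖X‖ ^ 2 ≤ 2 * |r| * τ ^ 2 := by
    have h1 : (ε * ‖X‖) ^ 2 ≤ τ ^ 2 := by gcongr
    calc ‖X‖ ^ 2 ≤ (ε ^ 2 * (2 * |r|)) * ‖X‖ ^ 2 := le_mul_of_one_le_left (by positivity) hε2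
      _ = 2 * |r| * (ε * ‖X‖) ^ 2 := by ring
      _ ≤ _ := by gcongr
  rcases le_or_gt δ ‖gradient a θ - y‖ with hcase | hcase
  · apply suff (4 * π / δ) (by positivity) _ (by linarith)
    have h1 : |r| / (2 * π) * δ ≤ ‖X‖ := by rw [hXn]; gcongr
    have h2 : ‖X‖ * (|r| / (2 * π) * δ) ≤ 2 * |r| * τ ^ 2 := by
      refine le_trans ?_ hXsq
      rw [sq]; gcongr
    have h3 : ‖X‖ ≤ 4 * π / δ * τ ^ 2 := by
      rw [div_mul_eq_mul_div, le_div_iff₀ hδp]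
      have h4 : |r| * (‖X‖ * δ) ≤ |r| * (4 * π * τ ^ 2) := by
        calc |r| * (‖X‖ * δ) = ‖X‖ * (|r| / (2 * π) * δ) * (2 * π) := by field_simp
          _ ≤ 2 * |r| * τ ^ 2 * (2 * π) := mul_le_mul_of_nonneg_right h2 (by positivity)
          _ = |r| * (4 * π * τ ^ 2) := by ring
      exact le_of_mul_le_mul_left h4 hrp
    refine hDX.trans (h3.trans ?_)
    gcongr; linarith
  · apply suff (G * C3) (by positivity) _ (by linarith)
    have haθ : 0 < a θ := ha.pos θ hθ0
    have haθ1 : a θ ≤ C0 := by simpa [hθ] using (hb θ).2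
    have haθ2 : c0 ≤ a θ := by simpa [hθ] using (hb θ).1
    set t := a θ * ‖gradient a θ - y‖ / κ with ht
    have ht0 : 0 ≤ t := by positivity
    have htδ : t ≤ δ₂ := by
      rw [ht, div_le_iff₀ hκ]
      calc a θ * ‖gradient a θ - y‖ ≤ C0 * δ := by gcongr
        _ = δ₂ * κ := by rw [hδ]; field_simp
    have hθA : θ ∈ annulus d := ⟨hθ.ge, by rw [hθ]; norm_num⟩
    obtain ⟨ζ, hζ, hFζ⟩ := (hun θ hθA).2 t ht0 (by linarith) (show a θ • y ∈ _ by
      rw [mem_closedBall_iff_norm, halfSqGrad, ← smul_sub, norm_smul, norm_sub_rev,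
        Real.norm_of_nonneg haθ.le, ht]
      apply le_of_eq; field_simp)
    rw [mem_closedBall_iff_norm] at hζ
    have hζn : 1 / 2 ≤ ‖ζ‖ := by
      have := norm_sub_norm_le θ ζ
      rw [norm_sub_rev, hθ] at this; linarith
    have hζn2 : ‖ζ‖ ≤ 3 / 2 := by
      have := norm_sub_norm_le ζ θ
      rw [hθ] at this; linarith
    have hζ0 : ζ ≠ 0 := by rintro rfl; simp at hζn; linarith
    set s := a ζ / a θ with hs
    have hys : y = s • gradient a ζ := by
      have h1 : a θ • y = a θ • (s • gradient a ζ) := by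
        rw [← hFζ, smul_smul, hs, mul_div_cancel₀ _ haθ.ne', halfSqGrad]
      exact smul_right_injective _ haθ.ne' h1
    have hs0 : 0 ≤ s := div_nonneg (ha.nonneg _) haθ.le
    have hs1 : s ≤ 2 * C0 / c0 := by
      rw [hs]
      have : a ζ ≤ 2 * C0 := by have := (hb ζ).2; nlinarith
      gcongr
    have hxs : x - (-(r / (2 * π))) • gradient a ζ = (r / (2 * π) * (1 - s)) • gradient a ζ := by
      have : x = (-(r / (2 * π))) • y := by
        rw [hy, smul_smul]
        have : -(r / (2 * π)) * -(2 * π / r) = 1 := by field_simp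
        rw [this, one_smul]
      rw [this, hys]; module
    have hD : Metric.infDist x (waveSet a r) ≤ |r| / (2 * π) * |1 - s| * G := by
      refine (Metric.infDist_le_dist_of_mem (mem_waveSet ha r hζ0)).trans ?_
      rw [dist_eq_norm, hxs, norm_smul, norm_mul, Real.norm_eq_abs, Real.norm_eq_abs, abs_div,
        abs_of_pos (by positivity : (0:ℝ) < 2 * π)]
      gcongr
      exact hGb ζ hζ0
    set Er := a θ - a ζ - fderiv ℝ a ζ (θ - ζ) with hEr
    have hE : |Er| ≤ K * t ^ 2 :=
      (htay θ ζ hθ (by linarith)).trans (by gcongr)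
    have hin : ⟪X, θ⟫ = r / (2 * π) * (a θ * (1 - s) + s * Er) := by
      have h1 : ⟪gradient a θ, θ⟫ = a θ := by rw [inner_gradient_left, ha.fderiv_self hθ0]
      have h2 : ⟪gradient a ζ, θ⟫ = a θ - Er := by
        rw [inner_gradient_left, hEr, map_sub, ha.fderiv_self hζ0]; ring
      rw [hXy, real_inner_smul_left, inner_sub_left, h1, hys, real_inner_smul_left, h2]
      ring
    have hkey : |r| / (2 * π) * (a θ * |1 - s|) ≤ τ + |r| / (2 * π) * (s * (K * t ^ 2)) := by
      have h1 : r / (2 * π) * (a θ * (1 - s)) = ⟪X, θ⟫ - r / (2 * π) * (s * Er) := by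
        rw [hin]; ring
      have h2 : |r / (2 * π) * (a θ * (1 - s))| = |r| / (2 * π) * (a θ * |1 - s|) := by
        rw [abs_mul, abs_div, abs_of_pos (by positivity : (0:ℝ) < 2 * π), abs_mul, abs_of_pos haθ]
      rw [← h2, h1]
      refine (abs_sub _ _).trans (add_le_add hX2 ?_)
      rw [abs_mul, abs_div, abs_of_pos (by positivity : (0:ℝ) < 2 * π), abs_mul, abs_of_nonneg hs0]
      gcongr
    have ht2 : |r| * t ^ 2 ≤ C0 ^ 2 * (2 * π) ^ 2 * 2 / κ ^ 2 * τ ^ 2 := by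
      have h1 : ‖gradient a θ - y‖ = 2 * π * ‖X‖ / |r| := by rw [hXn]; field_simp
      have h2 : |r| * t ^ 2 = a θ ^ 2 * (2 * π) ^ 2 / κ ^ 2 * (‖X‖ ^ 2 / |r|) := by
        rw [ht, h1]; field_simp
      have h3 : ‖X‖ ^ 2 / |r| ≤ 2 * τ ^ 2 := by
        rw [div_le_iff₀ hrp]; linarith
      rw [h2]
      calc a θ ^ 2 * (2 * π) ^ 2 / κ ^ 2 * (‖X‖ ^ 2 / |r|)
          ≤ C0 ^ 2 * (2 * π) ^ 2 / κ ^ 2 * (2 * τ ^ 2) := by gcongr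
        _ = _ := by ring
    set B := C0 ^ 2 * (2 * π) ^ 2 * 2 / κ ^ 2 with hB
    have hBp : 0 < B := by positivity
    have hfin : |r| / (2 * π) * |1 - s| ≤ C3 * (1 + τ) ^ 2 := by
      have h1 : |r| / (2 * π) * (s * (K * t ^ 2)) ≤ (2 * C0 / c0) * K * (B * τ ^ 2) := by
        have h2 : |r| / (2 * π) * (s * (K * t ^ 2)) = s * K * (|r| * t ^ 2) / (2 * π) := by ring
        rw [h2]
        have h3 : s * K * (|r| * t ^ 2) ≤ (2 * C0 / c0) * K * (B * τ ^ 2) := by gcongr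
        refine (div_le_self (by positivity) ?_).trans h3
        linarith [Real.pi_gt_three]
      have h4 : |r| / (2 * π) * (c0 * |1 - s|) ≤ |r| / (2 * π) * (a θ * |1 - s|) := by gcongr
      have h5 : c0 * (|r| / (2 * π) * |1 - s|) ≤
          (2 * π + (2 * C0 / c0) * K * B) * (1 + τ) ^ 2 := by
        have h6 : τ ≤ 2 * π * (1 + τ) ^ 2 := by nlinarith [Real.pi_gt_three]
        have h7 : (2 * C0 / c0) * K * (B * τ ^ 2) ≤ (2 * C0 / c0) * K * B * (1 + τ) ^ 2 := by
          rw [← mul_assoc]; gcongr; linarith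
        nlinarith
      have h8 : |r| / (2 * π) * |1 - s| ≤ (1 / c0) * ((2 * π + (2 * C0 / c0) * K * B) * (1 + τ) ^ 2) := by
        rw [one_div, le_inv_mul_iff₀ hc0]; exact h5
      rw [hC3]; linarith
    calc Metric.infDist x (waveSet a r) ≤ |r| / (2 * π) * |1 - s| * G := hD
      _ ≤ C3 * (1 + τ) ^ 2 * G := by gcongr
      _ = _ := by ring

end geometry

section kernel
variable {d : ℕ} {a : Rd d → ℝ} {χ : ℝ → ℝ}

theorem exists_packet_decay (ha : IsDistFn a) (hcurv : CurvNondeg a)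
    (hχs : ContDiff ℝ (⊤ : ℕ∞) χ) (hχ : ∀ x, x ∉ Icc (1/8 : ℝ) 8 → χ x = 0) (N : ℕ) :
    ∃ C : ℝ, 0 < C ∧ ∀ (r : ℝ) (x ζ : Rd d), ζ ≠ 0 → ∀ ε : ℝ, 0 < ε → ε ^ 2 * (1 + |r|) = 1 →
      (1 + Metric.infDist x (waveSet a r)) ^ N * ‖packet a χ r ε x ζ‖ ≤
        C * ε ^ (d - 1) * ((1 + ε * ‖x + (r / (2 * π)) • gradient a ζ‖) ^ d)⁻¹ := by
  obtain ⟨Cp, hCp, hp⟩ := packet_bound ha hχs hχ (2 * N + d)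
  obtain ⟨Cd, hCd, hdist⟩ := exists_infDist_waveSet_le ha hcurv
  refine ⟨Cd ^ N * Cp, by positivity, fun r x ζ hζ ε hε hεr => ?_⟩
  have hε1 : ε ≤ 1 := by nlinarith [abs_nonneg r, mul_nonneg (sq_nonneg ε) (abs_nonneg r)]
  have hrε : |r| * ε ^ 2 ≤ 1 := by nlinarith [sq_nonneg ε]
  set θ := ‖ζ‖⁻¹ • ζ with hθ
  have hθ1 : ‖θ‖ = 1 := norm_normalize hζ
  have hpk : packet a χ r ε x ζ = packet a χ r ε x θ := by
    simp only [packet, hθ, coneCut_smul ε _ ζ (inv_pos.2 (norm_pos_iff.2 hζ))]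
  have hg : gradient a ζ = gradient a θ := (ha.gradient_normalize hζ).symm
  rw [hpk, hg]
  have h1 := hp θ hθ1 ε hε hε1 r hrε x
  have h2 := hdist r x θ hθ1 ε hε hεr
  have h3 := mul_norm_le_norm_Tmap hθ1 hε.le hε1 (x + (r / (2 * π)) • gradient a θ)
  change (1 + ‖Tmap θ ε (x + (r / (2 * π)) • gradient a θ)‖) ^ (2 * N + d) *
    ‖packet a χ r ε x θ‖ ≤ Cp * ε ^ (d - 1) at h1
  set X := x + (r / (2 * π)) • gradient a θ
  set T := ‖Tmap θ ε X‖
  have hT : 0 ≤ T := norm_nonneg _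
  have hX : 0 ≤ ε * ‖X‖ := by positivity
  have hD : 0 ≤ Metric.infDist x (waveSet a r) := Metric.infDist_nonneg
  rw [← div_eq_mul_inv, le_div_iff₀ (by positivity)]
  calc (1 + Metric.infDist x (waveSet a r)) ^ N * ‖packet a χ r ε x θ‖ * (1 + ε * ‖X‖) ^ d
      ≤ (Cd * (1 + T) ^ 2) ^ N * ‖packet a χ r ε x θ‖ * (1 + T) ^ d := by gcongr
    _ = Cd ^ N * ((1 + T) ^ (2 * N + d) * ‖packet a χ r ε x θ‖) := by
        rw [mul_pow, pow_add, pow_mul]; ring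
    _ ≤ Cd ^ N * (Cp * ε ^ (d - 1)) := by gcongr
    _ = _ := by ring

theorem exists_lintegral_wave_decay (hd : 1 ≤ d) (ha : IsDistFn a) (hcurv : CurvNondeg a) :
    ∃ C : ℝ, 0 < C ∧ ∀ (r : ℝ) (x : Rd d) (ε : ℝ), 0 < ε → ε ^ 2 * (1 + |r|) = 1 →
      ∫⁻ ζ in annulus d, ENNReal.ofReal
        (((1 + ε * ‖x + (r / (2 * π)) • gradient a ζ‖) ^ d)⁻¹) ≤
        ENNReal.ofReal (C * ε ^ (d - 1)) := by
  obtain ⟨C, hC, hdec⟩ := exists_lintegral_gradient_decay hd ha hcurv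
  set V := (volume (annulus d)).toReal with hV
  have hVtop : volume (annulus d) ≠ ⊤ := (isCompact_annulus d).measure_lt_top.ne
  refine ⟨C * (4 * π) ^ (d - 1) + V * 2 ^ (d - 1), by positivity, fun r x ε hε hεr => ?_⟩
  rcases le_or_gt |r| 1 with hr | hr
  · have hε2 : 1 ≤ 2 * ε := by
      by_contra hcon
      have : ε ^ 2 < 1 / 4 := by nlinarith
      nlinarith
    calc _ ≤ ∫⁻ ζ in annulus d, 1 := by
          refine lintegral_mono fun ζ => ?_
          rw [ENNReal.ofReal_le_one]
          apply inv_le_one_of_one_le₀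
          apply one_le_pow₀
          have : 0 ≤ ε * ‖x + (r / (2 * π)) • gradient a ζ‖ := by positivity
          linarith
      _ = ENNReal.ofReal V := by simp [hV, ENNReal.ofReal_toReal hVtop]
      _ ≤ _ := by
          apply ENNReal.ofReal_le_ofReal
          have h1 : 1 ≤ 2 ^ (d - 1) * ε ^ (d - 1) := by rw [← mul_pow]; exact one_le_pow₀ hε2
          have h2 : 0 ≤ V := ENNReal.toReal_nonneg
          have h3 : 0 ≤ C * (4 * π) ^ (d - 1) * ε ^ (d - 1) := by positivity
          nlinarith
  · have hr0 : r ≠ 0 := by rintro rfl; simp at hr; linarith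
    have hrp : 0 < |r| := by linarith
    set y := (-(2 * π / r)) • x with hy
    have hX : ∀ ζ, ‖gradient a ζ - y‖ / (4 * π * ε) ≤ ε * ‖x + (r / (2 * π)) • gradient a ζ‖ := by
      intro ζ
      have h1 : x + (r / (2 * π)) • gradient a ζ = (r / (2 * π)) • (gradient a ζ - y) := by
        rw [hy, smul_sub, smul_smul]
        have : r / (2 * π) * -(2 * π / r) = -1 := by field_simp
        rw [this]; module
      rw [h1, norm_smul, Real.norm_eq_abs, abs_div, abs_of_pos (by positivity : (0:ℝ) < 2 * π),
        div_le_iff₀ (by positivity)]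
      have h2 : 1 ≤ ε ^ 2 * (2 * |r|) := by nlinarith [sq_nonneg ε]
      calc ‖gradient a ζ - y‖ ≤ ‖gradient a ζ - y‖ * (ε ^ 2 * (2 * |r|)) :=
            le_mul_of_one_le_right (norm_nonneg _) h2
        _ = _ := by field_simp; ring
    calc _ ≤ ∫⁻ ζ in annulus d, ENNReal.ofReal
          (((1 + ‖gradient a ζ - y‖ / (4 * π * ε)) ^ d)⁻¹) := by
          refine lintegral_mono fun ζ => ENNReal.ofReal_le_ofReal ?_
          gcongr
          exact hX ζ
      _ ≤ _ := hdec y (4 * π * ε) (by positivity)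
      _ ≤ _ := by
          apply ENNReal.ofReal_le_ofReal
          rw [mul_pow, add_mul, ← mul_assoc]
          have : 0 ≤ V * 2 ^ (d - 1) * ε ^ (d - 1) := by positivity
          linarith

/-- Decay of the kernel away from the wave front set, with the dispersive gain in `r`. -/
theorem exists_Kker_decay (hd : 1 ≤ d) (ha : IsDistFn a) (hcurv : CurvNondeg a)
    (hχs : ContDiff ℝ (⊤ : ℕ∞) χ) (hχ : ∀ x, x ∉ Icc (1/8 : ℝ) 8 → χ x = 0) (N : ℕ) :
    ∃ C : ℝ, 0 < C ∧ ∀ (r : ℝ) (x : Rd d) (ε : ℝ), 0 < ε → ε ^ 2 * (1 + |r|) = 1 →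
      ‖Kker a χ r x‖ ≤ C * ε ^ (d - 1) * ((1 + Metric.infDist x (waveSet a r)) ^ N)⁻¹ := by
  obtain ⟨C₁, hC₁, hpk⟩ := exists_packet_decay ha hcurv hχs hχ N
  obtain ⟨C₂, hC₂, h_int⟩ := exists_lintegral_wave_decay hd ha hcurv
  obtain ⟨c, hc, hmass⟩ := coneMass_lower d
  refine ⟨C₁ * C₂ / c, by positivity, fun r x ε hε hεr => ?_⟩
  have hε1 : ε ≤ 1 := by nlinarith [abs_nonneg r, mul_nonneg (sq_nonneg ε) (abs_nonneg r)]
  set e : Rd d := EuclideanSpace.single ⟨0, hd⟩ 1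
  have he : e ≠ 0 := by
    intro h
    have := congrArg norm h
    simp [e] at this
  have hD : 0 ≤ Metric.infDist x (waveSet a r) := Metric.infDist_nonneg
  set D := (1 + Metric.infDist x (waveSet a r)) ^ N with hDdef
  have hDp : 0 < D := by positivity
  have h1 := superposition (r := r) (ε := ε) (x := x) ha hχs.continuous hχ e he
  have h2 : ‖∫ ζ in annulus d, packet a χ r ε x ζ‖ ≤ C₁ * ε ^ (d - 1) * D⁻¹ * (C₂ * ε ^ (d - 1)) := by
    rw [← ENNReal.ofReal_le_ofReal_iff (by positivity), ofReal_norm]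
    refine (enorm_integral_le_lintegral_enorm _).trans ?_
    calc _ ≤ ∫⁻ ζ in annulus d, ENNReal.ofReal (C₁ * ε ^ (d - 1) * D⁻¹) *
          ENNReal.ofReal (((1 + ε * ‖x + (r / (2 * π)) • gradient a ζ‖) ^ d)⁻¹) := by
          refine setLIntegral_mono' (measurableSet_annulus d) fun ζ hζ => ?_
          have hζ0 : ζ ≠ 0 := by rintro rfl; have := hζ.1; simp at this; linarith
          rw [← ENNReal.ofReal_mul (by positivity), ← ofReal_norm]
          apply ENNReal.ofReal_le_ofReal
          have := hpk r x ζ hζ0 ε hε hεr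
          rw [← hDdef] at this
          rw [mul_right_comm, ← div_eq_mul_inv, le_div_iff₀ hDp, mul_comm]
          exact this
      _ = ENNReal.ofReal (C₁ * ε ^ (d - 1) * D⁻¹) * ∫⁻ ζ in annulus d,
          ENNReal.ofReal (((1 + ε * ‖x + (r / (2 * π)) • gradient a ζ‖) ^ d)⁻¹) :=
          lintegral_const_mul' _ _ ENNReal.ofReal_ne_top
      _ ≤ _ := by
          rw [ENNReal.ofReal_mul (p := C₁ * ε ^ (d - 1) * D⁻¹) (by positivity)]
          gcongr
          exact h_int r x ε hε hεr
  rw [← h1, norm_mul, Complex.norm_real, Real.norm_eq_abs] at h2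
  have h3 : c * ε ^ (d - 1) * ‖Kker a χ r x‖ ≤ |coneMass d ε e| * ‖Kker a χ r x‖ := by
    gcongr
    exact (hmass ε hε hε1 e he).trans (le_abs_self _)
  have h4 : 0 < ε ^ (d - 1) := by positivity
  have h5 : c * ε ^ (d - 1) * ‖Kker a χ r x‖ ≤
      c * ε ^ (d - 1) * (C₁ * C₂ / c * ε ^ (d - 1) * D⁻¹) := by
    refine (h3.trans h2).trans (le_of_eq ?_)
    field_simp
  exact le_of_mul_le_mul_left h5 (by positivity)

end kernel

section symbol
variable {d : ℕ} {a : Rd d → ℝ} {χ : ℝ → ℝ}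

/-- The multiplier of the kernel `Kker a χ r` translated by `w`. -/
def waveSymbol (a : Rd d → ℝ) (χ : ℝ → ℝ) (r : ℝ) (w ξ : Rd d) : ℂ :=
  (χ (a ξ) : ℂ) * Complex.exp (Complex.I * r * a ξ) *
    Complex.exp (2 * π * Complex.I * (inner ℝ w ξ : ℝ))

theorem waveSymbol_contDiff (ha : IsDistFn a) (hχs : ContDiff ℝ (⊤ : ℕ∞) χ)
    (hχ : ∀ x, x ∉ Icc (1/8 : ℝ) 8 → χ x = 0) (r : ℝ) (w : Rd d) :
    ContDiff ℝ (⊤ : ℕ∞) (waveSymbol a χ r w) := by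
  have hofReal : ∀ {f : Rd d → ℝ} {ξ : Rd d}, ContDiffAt ℝ (⊤ : ℕ∞) f ξ →
      ContDiffAt ℝ (⊤ : ℕ∞) (fun ξ => (f ξ : ℂ)) ξ := fun {f ξ} h =>
    Complex.ofRealCLM.contDiff.contDiffAt.comp ξ h
  rw [contDiff_iff_contDiffAt]
  intro ξ
  rcases eq_or_ne ξ 0 with rfl | h
  · obtain ⟨c0, C0, hc0, hC0, hb⟩ := ha.exists_bounds
    refine (contDiffAt_const (c := (0:ℂ))).congr_of_eventuallyEq ?_
    filter_upwards [Metric.ball_mem_nhds (0 : Rd d) (show 0 < 1 / (8 * C0) by positivity)] with ξ hξ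
    have h1 : a ξ < 1 / 8 := by
      refine (hb ξ).2.trans_lt ?_
      rw [mem_ball_zero_iff, lt_div_iff₀ (by positivity)] at hξ
      linarith
    simp [waveSymbol, hχ (a ξ) (fun hh => by linarith [hh.1])]
  · have h1 := ha.contDiffAt h
    refine ((hofReal (hχs.contDiffAt.comp ξ h1)).mul ?_).mul ?_
    · exact (contDiffAt_const.mul (hofReal h1)).cexp
    · exact (contDiffAt_const.mul (hofReal (contDiffAt_const.inner ℝ contDiffAt_id))).cexp

theorem waveSymbol_hasCompactSupport (ha : IsDistFn a)
    (hχ : ∀ x, x ∉ Icc (1/8 : ℝ) 8 → χ x = 0) (r : ℝ) (w : Rd d) :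
    HasCompactSupport (waveSymbol a χ r w) := by
  obtain ⟨c0, C0, hc0, hC0, hb⟩ := ha.exists_bounds
  refine HasCompactSupport.intro (isCompact_closedBall 0 (8 / c0)) fun ξ hξ => ?_
  have h1 : 8 < a ξ := by
    refine lt_of_lt_of_le ?_ (hb ξ).1
    rw [mem_closedBall_zero_iff, not_le, div_lt_iff₀ hc0] at hξ
    linarith
  simp [waveSymbol, hχ (a ξ) (fun hh => by linarith [hh.2])]

/-- The multiplier of `Kker a χ r` translated by `w`, as a Schwartz function. -/
def waveSchwartz (ha : IsDistFn a) (hχs : ContDiff ℝ (⊤ : ℕ∞) χ)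
    (hχ : ∀ x, x ∉ Icc (1/8 : ℝ) 8 → χ x = 0) (r : ℝ) (w : Rd d) : SchwartzMap (Rd d) ℂ :=
  (waveSymbol_hasCompactSupport ha hχ r w).toSchwartzMap (waveSymbol_contDiff ha hχs hχ r w)

theorem Kker_eq_fourierInv (ha : IsDistFn a) (hχs : ContDiff ℝ (⊤ : ℕ∞) χ)
    (hχ : ∀ x, x ∉ Icc (1/8 : ℝ) 8 → χ x = 0) (r : ℝ) (w x : Rd d) :
    Kker a χ r (x + w) = 𝓕⁻ (waveSchwartz ha hχs hχ r w) x := by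
  rw [SchwartzMap.fourierInv_coe, Real.fourierInv_eq']
  unfold Kker
  congr 1
  ext ξ
  rw [smul_eq_mul]
  change _ = _ * waveSymbol a χ r w ξ
  rw [waveSymbol, inner_add_left, real_inner_comm x ξ]
  push_cast
  rw [mul_add, Complex.exp_add, show (2 * π * (inner ℝ x ξ : ℝ) * Complex.I : ℂ) =
    2 * π * Complex.I * (inner ℝ x ξ : ℝ) by ring]
  ring

theorem integrable_Kker (ha : IsDistFn a) (hχs : ContDiff ℝ (⊤ : ℕ∞) χ)
    (hχ : ∀ x, x ∉ Icc (1/8 : ℝ) 8 → χ x = 0) (r : ℝ) : Integrable (Kker a χ r) := by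
  have : Kker a χ r = 𝓕⁻ (waveSchwartz ha hχs hχ r 0) := by
    ext x; simpa using Kker_eq_fourierInv ha hχs hχ r 0 x
  rw [this]
  exact SchwartzMap.integrable _

theorem continuous_Kker (ha : IsDistFn a) (hχs : ContDiff ℝ (⊤ : ℕ∞) χ)
    (hχ : ∀ x, x ∉ Icc (1/8 : ℝ) 8 → χ x = 0) (r : ℝ) : Continuous (Kker a χ r) := by
  have : Kker a χ r = 𝓕⁻ (waveSchwartz ha hχs hχ r 0) := by
    ext x; simpa using Kker_eq_fourierInv ha hχs hχ r 0 x
  rw [this]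
  exact SchwartzMap.continuous _

/-- Plancherel for translated kernels. -/
theorem integral_conj_Kker_mul_Kker (ha : IsDistFn a) (hχs : ContDiff ℝ (⊤ : ℕ∞) χ)
    (hχ : ∀ x, x ∉ Icc (1/8 : ℝ) 8 → χ x = 0) (r r' : ℝ) (y y' : Rd d) :
    ∫ x, (starRingEnd ℂ) (Kker a χ r (x - y)) * Kker a χ r' (x - y') =
      Kker a (fun t => χ t ^ 2) (r' - r) (y - y') := by
  have h := SchwartzMap.integral_inner_fourier_fourier
    (𝓕⁻ (waveSchwartz ha hχs hχ r (-y))) (𝓕⁻ (waveSchwartz ha hχs hχ r' (-y')))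
  simp only [FourierTransform.fourier_fourierInv_eq, RCLike.inner_apply'] at h
  simp only [sub_eq_add_neg, Kker_eq_fourierInv ha hχs hχ]
  rw [← h]
  unfold Kker
  congr 1
  ext ξ
  change (starRingEnd ℂ) (waveSymbol a χ r (-y) ξ) * waveSymbol a χ r' (-y') ξ = _
  simp only [waveSymbol, map_mul, Complex.conj_ofReal, ← Complex.exp_conj, Complex.conj_I, map_ofNat]
  have e1 : Complex.exp (Complex.I * ((r' + -r : ℝ) : ℂ) * a ξ) =
      Complex.exp (-Complex.I * r * a ξ) * Complex.exp (Complex.I * r' * a ξ) := by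
    rw [← Complex.exp_add]; congr 1; push_cast; ring
  have e2 : Complex.exp (2 * π * Complex.I * ((inner ℝ (y + -y') ξ : ℝ) : ℂ)) =
      Complex.exp (2 * π * -Complex.I * ((inner ℝ (-y) ξ : ℝ) : ℂ)) *
      Complex.exp (2 * π * Complex.I * ((inner ℝ (-y') ξ : ℝ) : ℂ)) := by
    rw [← Complex.exp_add]; congr 1
    simp only [inner_add_left, inner_neg_left]; push_cast; ring
  rw [e1, e2]
  push_cast
  ring

end symbol

section cubes
variable {d : ℕ}

theorem norm_le_of_forall_abs_le {x : Rd d} {A : ℝ} (hA : 0 ≤ A) (h : ∀ i, |x i| ≤ A) :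
    ‖x‖ ≤ d * A := by
  apply abs_le_of_sq_le_sq' _ (by positivity) |>.2
  rw [EuclideanSpace.norm_sq_eq]
  calc ∑ i, ‖x i‖ ^ 2 ≤ ∑ _i : Fin d, A ^ 2 := by
        refine Finset.sum_le_sum fun i _ => ?_
        rw [Real.norm_eq_abs]
        gcongr
        exact h i
    _ = d * A ^ 2 := by simp
    _ ≤ (d * d) * A ^ 2 := by
        gcongr
        exact_mod_cast Nat.le_mul_self d
    _ = _ := by ring

theorem qcube_eq_preimage (z : Fin d → ℤ) :
    qcube d z = WithLp.ofLp ⁻¹' (univ.pi fun i => Ico (z i : ℝ) (z i + 1)) := by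
  ext y; simp [qcube, mem_pi]

theorem measurableSet_qcube (z : Fin d → ℤ) : MeasurableSet (qcube d z) := by
  rw [qcube_eq_preimage]
  exact (PiLp.volume_preserving_ofLp (Fin d)).measurable
    (MeasurableSet.univ_pi fun i => measurableSet_Ico)

theorem volume_qcube (z : Fin d → ℤ) : volume (qcube d z) = 1 := by
  rw [qcube_eq_preimage, (PiLp.volume_preserving_ofLp (Fin d)).measure_preimage
    (MeasurableSet.univ_pi fun i => measurableSet_Ico).nullMeasurableSet, Real.volume_pi_Ico]
  simp

theorem norm_sub_latticeVec_le {z : Fin d → ℤ} {y : Rd d} (hy : y ∈ qcube d z) :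
    ‖y - latticeVec d z‖ ≤ d := by
  have := norm_le_of_forall_abs_le (x := y - latticeVec d z) zero_le_one fun i => by
    have := hy i
    simp only [latticeVec, PiLp.sub_apply]
    rw [abs_le]; constructor <;> linarith
  simpa using this

theorem IsNormalized.norm_le_indicator {z : Fin d → ℤ} {b : Rd d → ℂ} (hb : IsNormalized z b)
    (y : Rd d) : ‖b y‖ ≤ (qcube d z).indicator (fun _ => (1:ℝ)) y := by
  by_cases hy : y ∈ qcube d z
  · simpa [hy] using hb.2.1 y
  · simp [hy, hb.2.2 y hy]

theorem integrable_indicator_qcube (z : Fin d → ℤ) (c : ℝ) :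
    Integrable ((qcube d z).indicator fun _ => c) :=
  (integrable_indicator_iff (measurableSet_qcube z)).2
    (integrableOn_const (by rw [volume_qcube]; exact ENNReal.one_ne_top))

theorem integral_indicator_qcube (z : Fin d → ℤ) (c : ℝ) :
    ∫ y, (qcube d z).indicator (fun _ => c) y = c := by
  rw [integral_indicator_const _ (measurableSet_qcube z), Measure.real, volume_qcube]
  simp

theorem IsNormalized.integrable {z : Fin d → ℤ} {b : Rd d → ℂ} (hb : IsNormalized z b) :
    Integrable b :=
  (integrable_indicator_qcube z 1).mono' hb.1.aestronglyMeasurable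
    (Filter.Eventually.of_forall hb.norm_le_indicator)

theorem inv_one_add_pow_le {s t c : ℝ} (hs : 0 ≤ s) (ht : 0 ≤ t) (h : 1 + t ≤ c * (1 + s))
    (N : ℕ) : ((1 + s) ^ N)⁻¹ ≤ c ^ N * ((1 + t) ^ N)⁻¹ := by
  rw [← div_eq_mul_inv, le_div_iff₀ (by positivity), inv_mul_le_iff₀ (by positivity), mul_comm,
    ← mul_pow]
  exact pow_le_pow_left₀ (by positivity) h N

theorem inv_one_add_infDist_le {S : Set (Rd d)} {x x' : Rd d} {δ : ℝ}
    (h : dist x x' ≤ δ) (N : ℕ) : ((1 + Metric.infDist x S) ^ N)⁻¹ ≤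
      (1 + δ) ^ N * ((1 + Metric.infDist x' S) ^ N)⁻¹ := by
  have h0 : 0 ≤ Metric.infDist x S := Metric.infDist_nonneg
  have hδ : 0 ≤ δ := dist_nonneg.trans h
  refine inv_one_add_pow_le h0 Metric.infDist_nonneg ?_ N
  have : Metric.infDist x' S ≤ Metric.infDist x S + dist x' x := Metric.infDist_le_infDist_add_dist
  rw [dist_comm] at this
  nlinarith

end cubes

section conv
variable {d : ℕ} {a : Rd d → ℝ} {χ : ℝ → ℝ}

theorem conv_eq_convolution (K b : Rd d → ℂ) :
    conv K b = convolution b K (ContinuousLinearMap.mul ℂ ℂ) := by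
  ext x
  simp [conv, convolution, mul_comm]

theorem exists_conv_decay (hd : 1 ≤ d) (ha : IsDistFn a) (hcurv : CurvNondeg a)
    (hχs : ContDiff ℝ (⊤ : ℕ∞) χ) (hχ : ∀ x, x ∉ Icc (1/8 : ℝ) 8 → χ x = 0) (N : ℕ) :
    ∃ C : ℝ, 0 < C ∧ ∀ (r ε : ℝ), 0 < ε → ε ^ 2 * (1 + |r|) = 1 →
      ∀ (z : Fin d → ℤ) (b : Rd d → ℂ), IsNormalized z b → ∀ x : Rd d,
      ‖conv (Kker a χ r) b x‖ ≤ C * ε ^ (d - 1) *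
        ((1 + Metric.infDist (x - latticeVec d z) (waveSet a r)) ^ N)⁻¹ := by
  obtain ⟨C, hC, hK⟩ := exists_Kker_decay hd ha hcurv hχs hχ N
  refine ⟨C * (1 + d) ^ N, by positivity, fun r ε hε hεr z b hb x => ?_⟩
  rw [← integral_indicator_qcube z (C * (1 + d) ^ N * ε ^ (d - 1) *
        ((1 + Metric.infDist (x - latticeVec d z) (waveSet a r)) ^ N)⁻¹)]
  refine norm_integral_le_of_norm_le (integrable_indicator_qcube z _)
    (Filter.Eventually.of_forall fun y => ?_)
  rw [norm_mul]
  by_cases hy : y ∈ qcube d z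
  · rw [indicator_of_mem hy]
    have h1 : dist (x - y) (x - latticeVec d z) ≤ d := by
      rw [dist_eq_norm, show x - y - (x - latticeVec d z) = -(y - latticeVec d z) by abel, norm_neg]
      exact norm_sub_latticeVec_le hy
    calc ‖Kker a χ r (x - y)‖ * ‖b y‖
        ≤ C * ε ^ (d - 1) * ((1 + Metric.infDist (x - y) (waveSet a r)) ^ N)⁻¹ * 1 := by
          gcongr
          · have : 0 ≤ Metric.infDist (x - y) (waveSet a r) := Metric.infDist_nonneg
            positivity
          · exact hK r (x - y) ε hε hεr
          · exact hb.2.1 y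
      _ ≤ C * ε ^ (d - 1) * ((1 + d) ^ N *
            ((1 + Metric.infDist (x - latticeVec d z) (waveSet a r)) ^ N)⁻¹) * 1 := by
          gcongr
          exact inv_one_add_infDist_le h1 N
      _ = _ := by ring
  · rw [indicator_of_notMem hy, hb.2.2 y hy]; simp

theorem integrable_conv (ha : IsDistFn a) (hχs : ContDiff ℝ (⊤ : ℕ∞) χ)
    (hχ : ∀ x, x ∉ Icc (1/8 : ℝ) 8 → χ x = 0) (r : ℝ) {z : Fin d → ℤ} {b : Rd d → ℂ}
    (hb : IsNormalized z b) : Integrable (conv (Kker a χ r) b) := by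
  rw [conv_eq_convolution]
  exact hb.integrable.integrable_convolution _ (integrable_Kker ha hχs hχ r)

theorem exists_norm_conv_le (hd : 1 ≤ d) (ha : IsDistFn a) (hcurv : CurvNondeg a)
    (hχs : ContDiff ℝ (⊤ : ℕ∞) χ) (hχ : ∀ x, x ∉ Icc (1/8 : ℝ) 8 → χ x = 0) :
    ∃ C : ℝ, 0 < C ∧ ∀ (r : ℝ) (z : Fin d → ℤ) (b : Rd d → ℂ), IsNormalized z b →
      ∀ x : Rd d, ‖conv (Kker a χ r) b x‖ ≤ C := by
  obtain ⟨C, hC, h⟩ := exists_conv_decay hd ha hcurv hχs hχ 0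
  refine ⟨C, hC, fun r z b hb x => ?_⟩
  have hr : 0 < 1 + |r| := by positivity
  have hε : (√(1 + |r|))⁻¹ ^ 2 * (1 + |r|) = 1 := by
    rw [inv_pow, Real.sq_sqrt hr.le, inv_mul_cancel₀ hr.ne']
  refine (h r (√(1 + |r|))⁻¹ (by positivity) hε z b hb x).trans ?_
  simp only [pow_zero, inv_one, mul_one]
  apply mul_le_of_le_one_right hC.le
  apply pow_le_one₀ (by positivity)
  apply inv_le_one_of_one_le₀
  rw [Real.one_le_sqrt]
  linarith [abs_nonneg r]

theorem memLp_conv (hd : 1 ≤ d) (ha : IsDistFn a) (hcurv : CurvNondeg a)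
    (hχs : ContDiff ℝ (⊤ : ℕ∞) χ) (hχ : ∀ x, x ∉ Icc (1/8 : ℝ) 8 → χ x = 0) (r : ℝ)
    {z : Fin d → ℤ} {b : Rd d → ℂ} (hb : IsNormalized z b) :
    MemLp (conv (Kker a χ r) b) 2 := by
  have h_int := integrable_conv ha hχs hχ r hb
  obtain ⟨C, hC, h⟩ := exists_norm_conv_le hd ha hcurv hχs hχ
  rw [memLp_two_iff_integrable_sq_norm h_int.aestronglyMeasurable]
  refine (h_int.norm.const_mul C).mono' (h_int.aestronglyMeasurable.norm.pow 2)
    (Filter.Eventually.of_forall fun x => ?_)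
  rw [Real.norm_of_nonneg (by positivity), sq]
  gcongr
  exact h r z b hb x

/-- The `L²` pairing of two wave packets as a double integral against a single kernel. -/
theorem integral_conj_conv_mul_conv (ha : IsDistFn a) (hχs : ContDiff ℝ (⊤ : ℕ∞) χ)
    (hχ : ∀ x, x ∉ Icc (1/8 : ℝ) 8 → χ x = 0) {M : ℝ} (r r' : ℝ)
    (hM : ∀ x, ‖Kker a χ r' x‖ ≤ M)
    {z z' : Fin d → ℤ} {b b' : Rd d → ℂ} (hb : IsNormalized z b) (hb' : IsNormalized z' b') :
    ∫ x, (starRingEnd ℂ) (conv (Kker a χ r) b x) * conv (Kker a χ r') b' x =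
      ∫ p : Rd d × Rd d, (starRingEnd ℂ) (b p.1) * b' p.2 *
        Kker a (fun t => χ t ^ 2) (r' - r) (p.1 - p.2) := by
  have h1 : ∀ x, (starRingEnd ℂ) (conv (Kker a χ r) b x) * conv (Kker a χ r') b' x =
      ∫ p : Rd d × Rd d, (starRingEnd ℂ) (Kker a χ r (x - p.1) * b p.1) *
        (Kker a χ r' (x - p.2) * b' p.2) := by
    intro x
    rw [conv, conv, ← integral_conj, ← integral_prod_mul]
    rfl
  simp_rw [h1]
  rw [integral_integral_swap]
  · congr 1
    ext p
    have h2 : ∀ x, (starRingEnd ℂ) (Kker a χ r (x - p.1) * b p.1) * (Kker a χ r' (x - p.2) * b' p.2)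
        = (starRingEnd ℂ) (b p.1) * b' p.2 *
          ((starRingEnd ℂ) (Kker a χ r (x - p.1)) * Kker a χ r' (x - p.2)) := by
      intro x; rw [map_mul]; ring
    simp_rw [h2]
    rw [integral_const_mul, integral_conj_Kker_mul_Kker ha hχs hχ]
  · have i1 : Integrable (fun p : Rd d × Rd d => b p.2 * Kker a χ r (p.1 - p.2)) :=
      hb.integrable.convolution_integrand (ContinuousLinearMap.mul ℂ ℂ)
        (integrable_Kker ha hχs hχ r)
    have i2 := (Complex.conjCLE.toContinuousLinearMap.integrable_comp i1).mul_prod hb'.integrable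
    have i3 := (measurePreserving_prodAssoc (volume : Measure (Rd d)) (volume : Measure (Rd d))
      (volume : Measure (Rd d))).symm.integrable_comp_emb
        (MeasurableEquiv.measurableEmbedding _) |>.2 i2
    have hc := continuous_Kker ha hχs hχ r'
    refine (i3.bdd_mul (f := fun p => Kker a χ r' (p.1 - p.2.2)) (c := M) ?_ ?_).congr
      (Filter.Eventually.of_forall fun p => ?_)
    · exact (hc.comp (continuous_fst.sub (continuous_snd.comp continuous_snd))).aestronglyMeasurable
    · exact Filter.Eventually.of_forall fun p => hM _
    · simp [Function.uncurry, MeasurableEquiv.prodAssoc]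
      ring

theorem exists_integral_conj_conv_le (hd : 1 ≤ d) (ha : IsDistFn a) (hcurv : CurvNondeg a)
    (hχs : ContDiff ℝ (⊤ : ℕ∞) χ) (hχ : ∀ x, x ∉ Icc (1/8 : ℝ) 8 → χ x = 0) (N : ℕ) :
    ∃ C : ℝ, 0 < C ∧ ∀ (r r' ε : ℝ), 0 < ε → ε ^ 2 * (1 + |r' - r|) = 1 →
      ∀ (z z' : Fin d → ℤ) (b b' : Rd d → ℂ), IsNormalized z b → IsNormalized z' b' →
      ‖∫ x, (starRingEnd ℂ) (conv (Kker a χ r) b x) * conv (Kker a χ r') b' x‖ ≤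
        C * ε ^ (d - 1) * ((1 + Metric.infDist (latticeVec d z - latticeVec d z')
          (waveSet a (r' - r))) ^ N)⁻¹ := by
  obtain ⟨C, hC, hK⟩ := exists_Kker_decay (χ := fun t => χ t ^ 2) hd ha hcurv (hχs.pow 2)
    (fun x hx => by simp [hχ x hx]) N
  refine ⟨C * (1 + (d + d)) ^ N, by positivity, fun r r' ε hε hεr z z' b b' hb hb' => ?_⟩
  obtain ⟨M, hM⟩ : ∃ M, ∀ x, ‖Kker a χ r' x‖ ≤ M := by
    refine ⟨∫ ξ, ‖waveSymbol a χ r' 0 ξ‖, fun x => ?_⟩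
    refine (norm_integral_le_integral_norm _).trans (le_of_eq ?_)
    congr 1
    ext ξ
    simp only [waveSymbol, norm_mul, norm_exp_two_pi_I_mul]
  rw [integral_conj_conv_mul_conv ha hχs hχ r r' hM hb hb']
  set A := C * (1 + (d + d)) ^ N * ε ^ (d - 1) * ((1 + Metric.infDist (latticeVec d z -
    latticeVec d z') (waveSet a (r' - r))) ^ N)⁻¹
  have hA : A = ∫ p : Rd d × Rd d, (qcube d z).indicator (fun _ => A) p.1 *
      (qcube d z').indicator (fun _ => (1:ℝ)) p.2 := by
    rw [Measure.volume_eq_prod, integral_prod_mul, integral_indicator_qcube,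
      integral_indicator_qcube, mul_one]
  rw [hA]
  refine norm_integral_le_of_norm_le
    ((integrable_indicator_qcube z _).mul_prod (integrable_indicator_qcube z' _))
    (Filter.Eventually.of_forall fun p => ?_)
  rw [norm_mul, norm_mul, RCLike.norm_conj]
  by_cases hy : p.1 ∈ qcube d z
  swap
  · simp [indicator_of_notMem hy, hb.2.2 _ hy]
  by_cases hy' : p.2 ∈ qcube d z'
  swap
  · simp [indicator_of_notMem hy', hb'.2.2 _ hy']
  rw [indicator_of_mem hy, indicator_of_mem hy', mul_one]
  have h1 : dist (p.1 - p.2) (latticeVec d z - latticeVec d z') ≤ d + d := by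
    rw [dist_eq_norm, show p.1 - p.2 - (latticeVec d z - latticeVec d z') =
      (p.1 - latticeVec d z) - (p.2 - latticeVec d z') by abel]
    exact (norm_sub_le _ _).trans
      (add_le_add (norm_sub_latticeVec_le hy) (norm_sub_latticeVec_le hy'))
  have h2 : ‖b p.1‖ * ‖b' p.2‖ ≤ 1 := by
    have := hb.2.1 p.1
    have := hb'.2.1 p.2
    exact mul_le_one₀ (hb.2.1 p.1) (norm_nonneg _) (hb'.2.1 p.2)
  calc ‖b p.1‖ * ‖b' p.2‖ * ‖Kker a (fun t => χ t ^ 2) (r' - r) (p.1 - p.2)‖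
      ≤ 1 * (C * ε ^ (d - 1) * ((1 + Metric.infDist (p.1 - p.2) (waveSet a (r' - r))) ^ N)⁻¹) := by
        gcongr
        exact hK _ _ ε hε hεr
    _ ≤ 1 * (C * ε ^ (d - 1) * ((1 + (d + d)) ^ N * ((1 + Metric.infDist (latticeVec d z -
          latticeVec d z') (waveSet a (r' - r))) ^ N)⁻¹)) := by
        gcongr
        exact inv_one_add_infDist_le h1 N
    _ = A := by simp only [A]; ring

end conv

section waveSetCover
variable {d : ℕ} {a : Rd d → ℝ}

theorem norm_normalize_sub_normalize_le {w m : Rd d} (hw : w ≠ 0) (hm : m ≠ 0) :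
    ‖‖w‖⁻¹ • w - ‖m‖⁻¹ • m‖ ≤ 2 * ‖w - m‖ / ‖w‖ := by
  have hw' := norm_pos_iff.2 hw
  have hm' := norm_pos_iff.2 hm
  have h1 : ‖w‖⁻¹ • w - ‖m‖⁻¹ • m = ‖w‖⁻¹ • (w - m) + (‖w‖⁻¹ - ‖m‖⁻¹) • m := by
    rw [smul_sub, sub_smul]; abel
  have h2 : ‖(‖w‖⁻¹ - ‖m‖⁻¹) • m‖ ≤ ‖w - m‖ / ‖w‖ := by
    have h3 : (‖w‖⁻¹ - ‖m‖⁻¹) * ‖m‖ = (‖m‖ - ‖w‖) / ‖w‖ := by field_simp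
    rw [norm_smul, Real.norm_eq_abs, ← abs_norm m, ← abs_mul, abs_norm, h3, abs_div, abs_norm]
    gcongr
    rw [abs_sub_comm]
    exact abs_norm_sub_norm_le w m
  calc _ ≤ ‖‖w‖⁻¹ • (w - m)‖ + ‖(‖w‖⁻¹ - ‖m‖⁻¹) • m‖ := h1 ▸ norm_add_le _ _
    _ ≤ ‖w - m‖ / ‖w‖ + ‖w - m‖ / ‖w‖ := by
      gcongr
      rw [norm_smul, norm_inv, norm_norm, div_eq_inv_mul]
    _ = _ := by ring

theorem exists_sphere_net (d : ℕ) {M : ℕ} (hM : 1 ≤ M) :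
    ∃ T : Finset (Rd d), (T.card : ℝ) ≤ 2 * d * (2 * M + 1) ^ (d - 1) ∧
      ∀ θ : Rd d, ‖θ‖ = 1 → ∃ t ∈ T, ‖t‖ = 1 ∧ ‖θ - t‖ ≤ 2 * d / M := by
  set box : Fin d → ℤ → Finset (Fin d → ℤ) := fun i s =>
    Fintype.piFinset (Function.update (fun _ => Finset.Icc (-(M:ℤ)) M) i {s})
  set nrm : (Fin d → ℤ) → Rd d := fun m => ‖latticeVec d m‖⁻¹ • latticeVec d m
  have hbox : ∀ i s, (box i s).card = (2 * M + 1) ^ (d - 1) := by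
    intro i s
    rw [Fintype.card_piFinset]
    have : ∀ k, (Function.update (fun _ => Finset.Icc (-(M:ℤ)) M) i {s} k).card =
        Function.update (fun _ => 2 * M + 1) i 1 k := by
      intro k
      by_cases hk : k = i
      · subst hk; simp
      · simp [hk]; omega
    simp_rw [this]
    rw [Finset.prod_update_of_mem (Finset.mem_univ i), Finset.prod_const, one_mul,
      Finset.card_sdiff_of_subset (by simp)]
    simp
  refine ⟨(Finset.univ ×ˢ {(M:ℤ), -(M:ℤ)} : Finset (Fin d × ℤ)).biUnion fun p =>
    (box p.1 p.2).image nrm, ?_, fun θ hθ => ?_⟩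
  · have h1 := Finset.card_biUnion_le_card_mul (Finset.univ ×ˢ {(M:ℤ), -(M:ℤ)} : Finset (Fin d × ℤ))
      (fun p => (box p.1 p.2).image nrm) ((2 * M + 1) ^ (d - 1))
      (fun p _ => Finset.card_image_le.trans (hbox _ _).le)
    have h2 : (Finset.univ ×ˢ {(M:ℤ), -(M:ℤ)} : Finset (Fin d × ℤ)).card ≤ 2 * d := by
      rw [Finset.card_product, Finset.card_univ, Fintype.card_fin, mul_comm]
      gcongr
      exact Finset.card_le_two
    exact_mod_cast h1.trans (Nat.mul_le_mul_right _ h2)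
  · have hθ0 := ne_zero_of_norm_eq_one hθ
    have hM0 : (0:ℝ) < M := by exact_mod_cast hM
    have hne : Nonempty (Fin d) := by
      by_contra hcon
      rw [not_nonempty_iff] at hcon
      exact hθ0 (by ext i; exact hcon.elim i)
    obtain ⟨i, hi⟩ := Finite.exists_max fun i => |θ i|
    have hA : 0 < |θ i| := by
      rw [abs_pos]
      intro h0
      apply hθ0
      ext k
      have := hi k
      rw [h0, abs_zero] at this
      simpa using this
    set w : Rd d := (M / |θ i|) • θ with hw
    have hwk : ∀ k, w k = M / |θ i| * θ k := fun k => by simp [hw]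
    have hwM : ∀ k, |w k| ≤ M := fun k => by
      rw [hwk, abs_mul, abs_div, abs_abs, abs_of_pos hM0, div_mul_eq_mul_div, div_le_iff₀ hA]
      exact mul_le_mul_of_nonneg_left (hi k) hM0.le
    have hwi : w i = M ∨ w i = -M := by
      rw [hwk]
      rcases abs_choice (θ i) with h | h <;> rw [h]
      · left; field_simp [abs_pos.1 hA]
      · right
        have := abs_pos.1 hA
        field_simp
    set m : Fin d → ℤ := fun k => ⌊w k⌋ with hm
    have hmk : ∀ k, -(M:ℤ) ≤ m k ∧ m k ≤ M := fun k => by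
      have := abs_le.1 (hwM k)
      refine ⟨Int.le_floor.2 (by push_cast; exact this.1), ?_⟩
      have h2 : ((⌊w k⌋ : ℤ) : ℝ) ≤ ((M : ℤ) : ℝ) := (Int.floor_le (w k)).trans this.2
      exact Int.cast_le.1 h2
    have hmi : m i = M ∨ m i = -M := by
      rcases hwi with h | h
      · left; rw [hm]; simp [h]
      · right; rw [hm]; simp only [h]; exact_mod_cast Int.floor_intCast (-(M:ℤ))
    have hm0 : latticeVec d m ≠ 0 := by
      intro h0
      have h1 : (latticeVec d m) i = 0 := by rw [h0]; rfl
      simp only [latticeVec] at h1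
      have h2 : m i = 0 := by exact_mod_cast h1
      omega
    have hcM : 0 < M / |θ i| := by positivity
    have hw0 : w ≠ 0 := smul_ne_zero hcM.ne' hθ0
    have hθw : ‖w‖⁻¹ • w = θ := by
      rw [hw, norm_smul, hθ, smul_smul, mul_one, Real.norm_eq_abs, abs_of_pos hcM,
        inv_mul_cancel₀ hcM.ne', one_smul]
    refine ⟨nrm m, ?_, norm_normalize hm0, ?_⟩
    · refine Finset.mem_biUnion.2 ⟨(i, m i), ?_, Finset.mem_image_of_mem _ ?_⟩
      · simpa using hmi
      · simp only [box, Fintype.mem_piFinset]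
        intro k
        by_cases hk : k = i
        · subst hk; simp
        · simpa [hk] using abs_le.1 (abs_le.2 (hmk k))
    · have h1 := norm_normalize_sub_normalize_le hw0 hm0
      rw [hθw] at h1
      have h2 : ‖w - latticeVec d m‖ ≤ d := by
        have := norm_le_of_forall_abs_le (x := w - latticeVec d m) zero_le_one fun k => by
          simp only [latticeVec, PiLp.sub_apply, hm]
          rw [abs_of_nonneg (by linarith [Int.floor_le (w k)])]
          linarith [Int.lt_floor_add_one (w k)]
        simpa using this
      have h3 : (M:ℝ) ≤ ‖w‖ := by
        calc (M:ℝ) = |w i| := by rcases hwi with h | h <;> simp [h]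
          _ ≤ ‖w‖ := PiLp.norm_apply_le w i
      refine h1.trans ?_
      gcongr

theorem isCompact_waveSet (ha : IsDistFn a) (r : ℝ) : IsCompact (waveSet a r) :=
  (isCompact_sphere (0 : Rd d) 1).image_of_continuousOn fun θ hθ =>
    ContinuousAt.continuousWithinAt (((ha.gradient_contDiffAt (ne_zero_of_norm_eq_one
      (by simpa using hθ))).continuousAt).const_smul (-(r / (2 * π))))

theorem waveSet_nonempty (hd : 1 ≤ d) (a : Rd d → ℝ) (r : ℝ) : (waveSet a r).Nonempty := by
  have : Nonempty (Fin d) := ⟨⟨0, hd⟩⟩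
  have : Nontrivial (Rd d) := inferInstance
  exact ((NormedSpace.sphere_nonempty (E := Rd d)).2 zero_le_one).image _

theorem exists_waveSet_cover (hd : 1 ≤ d) (ha : IsDistFn a) :
    ∃ C : ℝ, 0 < C ∧ ∀ r : ℝ, ∃ P : Finset (Rd d), (P.card : ℝ) ≤ C * (1 + |r|) ^ (d - 1) ∧
      ∀ x, ∃ p ∈ P, 1 + ‖x - p‖ ≤ C * (1 + Metric.infDist x (waveSet a r)) := by
  obtain ⟨L, hL, hLip⟩ := ha.exists_gradient_lipschitz
  refine ⟨max (2 * (d:ℝ) * 5 ^ (d - 1)) (1 + L * (2 * d)), by positivity, fun r => ?_⟩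
  set M := ⌈|r|⌉₊ + 1 with hM
  have hM1 : (1:ℝ) ≤ M := by simp [hM]
  have hMr : |r| ≤ M := by rw [hM]; push_cast; linarith [Nat.le_ceil |r|]
  have hMr2 : (M:ℝ) ≤ |r| + 2 := by
    rw [hM]; push_cast; linarith [Nat.ceil_lt_add_one (abs_nonneg r)]
  obtain ⟨T, hTc, hT⟩ := exists_sphere_net d (M := M) (by omega)
  refine ⟨T.image fun θ => (-(r / (2 * π))) • gradient a θ, ?_, fun x => ?_⟩
  · calc ((T.image fun θ => (-(r / (2 * π))) • gradient a θ).card : ℝ) ≤ T.card := by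
          exact_mod_cast Finset.card_image_le
      _ ≤ 2 * d * (2 * M + 1) ^ (d - 1) := hTc
      _ ≤ 2 * d * (5 * (1 + |r|)) ^ (d - 1) := by
        gcongr
        linarith [abs_nonneg r]
      _ = 2 * d * 5 ^ (d - 1) * (1 + |r|) ^ (d - 1) := by rw [mul_pow]; ring
      _ ≤ _ := by gcongr; exact le_max_left _ _
  · obtain ⟨y, ⟨θ, hθ, rfl⟩, hxy⟩ := (isCompact_waveSet ha r).exists_infDist_eq_dist
      (waveSet_nonempty hd a r) x
    have hθ1 : ‖θ‖ = 1 := by simpa using hθ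
    obtain ⟨t, htT, ht1, ht⟩ := hT θ hθ1
    refine ⟨_, Finset.mem_image_of_mem _ htT, ?_⟩
    rw [hxy]
    set y := (-(r / (2 * π))) • gradient a θ
    set p := (-(r / (2 * π))) • gradient a t
    have h1 : ‖y - p‖ ≤ L * (2 * d) := by
      rw [← smul_sub, norm_smul, norm_neg, norm_div, Real.norm_eq_abs, Real.norm_eq_abs,
        abs_of_pos (by positivity : 0 < 2 * π)]
      calc |r| / (2 * π) * ‖gradient a θ - gradient a t‖ ≤ |r| / 1 * (L * (2 * d / M)) := by
            gcongr
            · linarith [Real.pi_gt_three]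
            · exact (hLip θ t hθ1 ht1).trans (by gcongr)
        _ = |r| / M * (L * (2 * d)) := by ring
        _ ≤ 1 * (L * (2 * d)) := by
          gcongr
          exact div_le_one_of_le₀ hMr (by positivity)
        _ = _ := one_mul _
    have h2 : ‖x - p‖ ≤ dist x y + ‖y - p‖ := by
      rw [dist_eq_norm]; exact norm_sub_le_norm_sub_add_norm_sub x y p
    have h3 : 1 + L * (2 * d) ≤ max (2 * (d:ℝ) * 5 ^ (d - 1)) (1 + L * (2 * d)) := le_max_right _ _
    have h4 : 0 ≤ L * (2 * d) := by positivity
    have h5 : 0 ≤ dist x y := dist_nonneg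
    calc 1 + ‖x - p‖ ≤ 1 + (dist x y + L * (2 * d)) := by linarith
      _ ≤ (1 + L * (2 * d)) * (1 + dist x y) := by nlinarith
      _ ≤ _ := by gcongr

end waveSetCover

section waveWeight
variable {d : ℕ} {a : Rd d → ℝ}

/-- The weight `(1 + dist(x, rΣ*))^{-N}` measuring the distance to the wave front at time `r`. -/
def waveWeight (a : Rd d → ℝ) (N : ℕ) (r : ℝ) (x : Rd d) : ℝ :=
  ((1 + Metric.infDist x (waveSet a r)) ^ N)⁻¹

theorem waveWeight_nonneg (N : ℕ) (r : ℝ) (x : Rd d) : 0 ≤ waveWeight a N r x := by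
  have := Metric.infDist_nonneg (x := x) (s := waveSet a r)
  unfold waveWeight
  positivity

theorem waveWeight_le_mul {x y : Rd d} {r r' : ℝ} {c : ℝ}
    (h : 1 + Metric.infDist y (waveSet a r') ≤ c * (1 + Metric.infDist x (waveSet a r))) (N : ℕ) :
    waveWeight a N r x ≤ c ^ N * waveWeight a N r' y :=
  inv_one_add_pow_le Metric.infDist_nonneg Metric.infDist_nonneg h N

theorem continuous_waveWeight (a : Rd d → ℝ) (N : ℕ) (r : ℝ) : Continuous (waveWeight a N r) := by
  unfold waveWeight
  refine Continuous.inv₀ ?_ fun x => ?_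
  · exact (continuous_const.add (Metric.continuous_infDist_pt _)).pow N
  · have := Metric.infDist_nonneg (x := x) (s := waveSet a r)
    positivity

theorem exists_lintegral_waveWeight_le (hd : 1 ≤ d) (ha : IsDistFn a) :
    ∃ C : ℝ, 0 < C ∧ ∀ r : ℝ,
      ∫⁻ x, ENNReal.ofReal (waveWeight a (d + 1) r x) ≤ ENNReal.ofReal (C * (1 + |r|) ^ (d - 1)) := by
  obtain ⟨C, hC, hcov⟩ := exists_waveSet_cover hd ha
  have hI : (∫⁻ x : Rd d, ENNReal.ofReal ((1 + ‖x‖) ^ (-((d:ℝ) + 1)))) < ∞ :=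
    finite_integral_one_add_norm (by simp)
  set I := ∫⁻ x : Rd d, ENNReal.ofReal ((1 + ‖x‖) ^ (-((d:ℝ) + 1))) with hIdef
  refine ⟨C * (C ^ (d + 1) * (I.toReal + 1)), by positivity, fun r => ?_⟩
  obtain ⟨P, hPc, hP⟩ := hcov r
  have hpt : ∀ x, ENNReal.ofReal (waveWeight a (d + 1) r x) ≤
      ∑ p ∈ P, ENNReal.ofReal (C ^ (d + 1)) * ENNReal.ofReal ((1 + ‖x - p‖) ^ (-((d:ℝ) + 1))) := by
    intro x
    obtain ⟨p, hp, hxp⟩ := hP x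
    refine le_trans ?_ (Finset.single_le_sum (f := fun p => ENNReal.ofReal (C ^ (d + 1)) *
      ENNReal.ofReal ((1 + ‖x - p‖) ^ (-((d:ℝ) + 1)))) (fun _ _ => zero_le) hp)
    rw [← ENNReal.ofReal_mul (by positivity)]
    refine ENNReal.ofReal_le_ofReal ?_
    have h1 := inv_one_add_pow_le Metric.infDist_nonneg (norm_nonneg (x - p)) hxp (d + 1)
    rw [Real.rpow_neg (by positivity)]
    exact_mod_cast h1
  calc ∫⁻ x, ENNReal.ofReal (waveWeight a (d + 1) r x)
      ≤ ∫⁻ x, ∑ p ∈ P, ENNReal.ofReal (C ^ (d + 1)) *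
          ENNReal.ofReal ((1 + ‖x - p‖) ^ (-((d:ℝ) + 1))) := lintegral_mono hpt
    _ = ∑ _p ∈ P, ENNReal.ofReal (C ^ (d + 1)) * I := by
      rw [lintegral_finsetSum _ fun p _ => by fun_prop]
      refine Finset.sum_congr rfl fun p _ => ?_
      rw [lintegral_const_mul _ (by fun_prop), hIdef,
        lintegral_sub_right_eq_self (fun x => ENNReal.ofReal ((1 + ‖x‖) ^ (-((d:ℝ) + 1)))) p]
    _ ≤ ENNReal.ofReal (P.card * (C ^ (d + 1) * (I.toReal + 1))) := by
      rw [Finset.sum_const, nsmul_eq_mul, ENNReal.ofReal_mul (by positivity),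
        ENNReal.ofReal_mul (by positivity), ENNReal.ofReal_natCast]
      gcongr
      rw [← ENNReal.ofReal_toReal hI.ne]
      exact ENNReal.ofReal_le_ofReal (by simp)
    _ ≤ _ := by
      refine ENNReal.ofReal_le_ofReal ?_
      calc (P.card:ℝ) * (C ^ (d + 1) * (I.toReal + 1)) ≤
          (C * (1 + |r|) ^ (d - 1)) * (C ^ (d + 1) * (I.toReal + 1)) := by gcongr
        _ = _ := by ring

theorem pairwise_disjoint_qcube (d : ℕ) : Pairwise (Function.onFun Disjoint (qcube d)) := by
  intro z z' hne
  rw [Function.onFun, Set.disjoint_left]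
  intro y hy hy'
  apply hne
  ext i
  have h1 := hy i
  have h2 := hy' i
  have h3 : (z i : ℝ) < z' i + 1 := by linarith
  have h4 : (z' i : ℝ) < z i + 1 := by linarith
  have h5 : z i < z' i + 1 := by exact_mod_cast h3
  have h6 : z' i < z i + 1 := by exact_mod_cast h4
  omega

theorem exists_sum_waveWeight_le (hd : 1 ≤ d) (ha : IsDistFn a) :
    ∃ C : ℝ, 0 < C ∧ ∀ (r : ℝ) (w : Rd d) (M : Finset (Fin d → ℤ)),
      ∑ m ∈ M, waveWeight a (d + 1) r (w - latticeVec d m) ≤ C * (1 + |r|) ^ (d - 1) ∧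
      ∑ m ∈ M, waveWeight a (d + 1) r (latticeVec d m - w) ≤ C * (1 + |r|) ^ (d - 1) := by
  obtain ⟨C, hC, hI⟩ := exists_lintegral_waveWeight_le hd ha
  refine ⟨(1 + d) ^ (d + 1) * C, by positivity, fun r w M => ?_⟩
  have key : ∀ (T : (Fin d → ℤ) → Rd d) (g : Rd d → Rd d),
      (∀ m, ∀ y ∈ qcube d m, dist (T m) (g y) ≤ d) → Measurable g →
      (∫⁻ y, ENNReal.ofReal (waveWeight a (d + 1) r (g y)) =
        ∫⁻ y, ENNReal.ofReal (waveWeight a (d + 1) r y)) →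
      ∑ m ∈ M, waveWeight a (d + 1) r (T m) ≤ (1 + d) ^ (d + 1) * C * (1 + |r|) ^ (d - 1) := by
    intro T g hTg hg hgI
    rw [← ENNReal.ofReal_le_ofReal_iff (by positivity),
      ENNReal.ofReal_sum_of_nonneg fun _ _ => waveWeight_nonneg _ _ _]
    have hm : ∀ m ∈ M, ENNReal.ofReal (waveWeight a (d + 1) r (T m)) ≤
        ∫⁻ y in qcube d m, ENNReal.ofReal ((1 + d) ^ (d + 1)) *
          ENNReal.ofReal (waveWeight a (d + 1) r (g y)) := by
      intro m _
      have h1 : ENNReal.ofReal (waveWeight a (d + 1) r (T m)) =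
          ∫⁻ _y in qcube d m, ENNReal.ofReal (waveWeight a (d + 1) r (T m)) := by
        rw [setLIntegral_const, volume_qcube, mul_one]
      rw [h1]
      refine setLIntegral_mono' (measurableSet_qcube m) fun y hy => ?_
      rw [← ENNReal.ofReal_mul (by positivity)]
      exact ENNReal.ofReal_le_ofReal (inv_one_add_infDist_le (hTg m y hy) _)
    calc ∑ m ∈ M, ENNReal.ofReal (waveWeight a (d + 1) r (T m))
        ≤ ∑ m ∈ M, ∫⁻ y in qcube d m, ENNReal.ofReal ((1 + d) ^ (d + 1)) *
          ENNReal.ofReal (waveWeight a (d + 1) r (g y)) := Finset.sum_le_sum hm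
      _ = ∫⁻ y in ⋃ m ∈ M, qcube d m, ENNReal.ofReal ((1 + d) ^ (d + 1)) *
          ENNReal.ofReal (waveWeight a (d + 1) r (g y)) := by
        rw [lintegral_biUnion_finset ((pairwise_disjoint_qcube d).set_pairwise _)
          fun m _ => measurableSet_qcube m]
      _ ≤ ∫⁻ y, ENNReal.ofReal ((1 + d) ^ (d + 1)) *
          ENNReal.ofReal (waveWeight a (d + 1) r (g y)) := setLIntegral_le_lintegral _ _
      _ = ENNReal.ofReal ((1 + d) ^ (d + 1)) *
          ∫⁻ y, ENNReal.ofReal (waveWeight a (d + 1) r y) := by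
        have h2 : Measurable fun y => ENNReal.ofReal (waveWeight a (d + 1) r (g y)) :=
          ((continuous_waveWeight a (d + 1) r).measurable.comp hg).ennreal_ofReal
        rw [lintegral_const_mul _ h2, hgI]
      _ ≤ ENNReal.ofReal ((1 + d) ^ (d + 1)) * ENNReal.ofReal (C * (1 + |r|) ^ (d - 1)) := by
        gcongr
        exact hI r
      _ = _ := by rw [← ENNReal.ofReal_mul (by positivity), mul_assoc]
  constructor
  · refine key _ (fun y => w - y) (fun m y hy => ?_) (by fun_prop)
      (lintegral_sub_left_eq_self (fun y => ENNReal.ofReal (waveWeight a (d + 1) r y)) w)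
    rw [dist_eq_norm, sub_sub_sub_cancel_left]
    exact norm_sub_latticeVec_le hy
  · refine key _ (fun y => y - w) (fun m y hy => ?_) (by fun_prop)
      (lintegral_sub_right_eq_self (fun y => ENNReal.ofReal (waveWeight a (d + 1) r y)) w)
    rw [dist_eq_norm, sub_sub_sub_cancel_right, ← norm_neg, neg_sub]
    exact norm_sub_latticeVec_le hy

open scoped Pointwise in
theorem waveSet_mul (a : Rd d → ℝ) (t r : ℝ) : waveSet a (t * r) = t • waveSet a r := by
  rw [waveSet, waveSet, ← Set.image_smul, Set.image_image]
  congr 1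
  ext θ : 1
  rw [smul_smul]
  congr 1
  ring

open scoped Pointwise in
theorem infDist_smul_waveSet (a : Rd d → ℝ) {t : ℝ} (ht : 0 < t) (r : ℝ) (x : Rd d) :
    Metric.infDist (t • x) (waveSet a (t * r)) = t * Metric.infDist x (waveSet a r) := by
  rw [waveSet_mul, infDist_smul₀ ht.ne', Real.norm_eq_abs, abs_of_pos ht]

theorem exists_infDist_waveSet_le_add (hd : 1 ≤ d) (ha : IsDistFn a) :
    ∃ G : ℝ, 0 < G ∧ ∀ (r r' : ℝ) (x : Rd d),
      Metric.infDist x (waveSet a r) ≤ Metric.infDist x (waveSet a r') + G * |r - r'| := by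
  obtain ⟨G, hG, hGb⟩ := ha.exists_gradient_bound
  refine ⟨G, hG, fun r r' x => ?_⟩
  obtain ⟨y, ⟨θ, hθ, rfl⟩, hxy⟩ := (isCompact_waveSet ha r').exists_infDist_eq_dist
    (waveSet_nonempty hd a r') x
  have hθ0 : θ ≠ 0 := ne_zero_of_norm_eq_one (by simpa using hθ)
  rw [hxy]
  refine (Metric.infDist_le_dist_of_mem (mem_waveSet ha r hθ0)).trans
    ((dist_triangle _ ((-(r' / (2 * π))) • gradient a θ) _).trans ?_)
  gcongr
  rw [dist_eq_norm, ← sub_smul, norm_smul, Real.norm_eq_abs,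
    show -(r' / (2 * π)) - -(r / (2 * π)) = (r - r') / (2 * π) by ring, abs_div,
    abs_of_pos (by positivity : 0 < 2 * π), mul_comm]
  gcongr
  · exact hGb θ hθ0
  · exact div_le_self (abs_nonneg _) (by linarith [Real.pi_gt_three])

theorem exists_volume_waveSet_near_le (hd : 1 ≤ d) (ha : IsDistFn a) {A : ℝ} (hA : 0 < A) :
    ∃ C : ℝ, 0 < C ∧ ∀ (r ρ : ℝ) (w : Rd d), 0 < ρ →
      volume {x | Metric.infDist (x - w) (waveSet a r) ≤ A * ρ} ≤
        ENNReal.ofReal (C * ρ ^ d * (1 + |r| / ρ) ^ (d - 1)) := by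
  have : Nonempty (Fin d) := ⟨⟨0, hd⟩⟩
  obtain ⟨C, hC, hcov⟩ := exists_waveSet_cover hd ha
  have hB : volume (Metric.ball (0 : Rd d) 1) ≠ ∞ := measure_ball_lt_top.ne
  set B := (volume (Metric.ball (0 : Rd d) 1)).toReal
  refine ⟨C * (C * (1 + A)) ^ d * (B + 1), by positivity, fun r ρ w hρ => ?_⟩
  obtain ⟨P, hPc, hP⟩ := hcov (r / ρ)
  have hsub : {x | Metric.infDist (x - w) (waveSet a r) ≤ A * ρ} ⊆
      ⋃ p ∈ P, Metric.closedBall (w + ρ • p) (ρ * (C * (1 + A))) := by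
    intro x hx
    obtain ⟨p, hp, hxp⟩ := hP (ρ⁻¹ • (x - w))
    refine mem_biUnion hp ?_
    have h1 := infDist_smul_waveSet a hρ (r / ρ) (ρ⁻¹ • (x - w))
    rw [smul_inv_smul₀ hρ.ne', mul_div_cancel₀ _ hρ.ne'] at h1
    rw [mem_setOf_eq, h1, mul_comm A] at hx
    have h2 := le_of_mul_le_mul_left hx hρ
    have h3 : ‖ρ⁻¹ • (x - w) - p‖ ≤ C * (1 + A) := by
      have : C * (1 + Metric.infDist (ρ⁻¹ • (x - w)) (waveSet a (r / ρ))) ≤ C * (1 + A) := by gcongr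
      linarith
    rw [Metric.mem_closedBall, dist_eq_norm,
      show x - (w + ρ • p) = ρ • (ρ⁻¹ • (x - w) - p) by
        rw [smul_sub, smul_inv_smul₀ hρ.ne']; abel, norm_smul, Real.norm_eq_abs, abs_of_pos hρ]
    gcongr
  calc volume {x | Metric.infDist (x - w) (waveSet a r) ≤ A * ρ}
      ≤ ∑ p ∈ P, volume (Metric.closedBall (w + ρ • p) (ρ * (C * (1 + A)))) :=
        (measure_mono hsub).trans (measure_biUnion_finset_le _ _)
    _ = ENNReal.ofReal (P.card * ((ρ * (C * (1 + A))) ^ d * B)) := by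
      simp_rw [Measure.addHaar_closedBall _ _ (by positivity : 0 ≤ ρ * (C * (1 + A))),
        finrank_euclideanSpace_fin]
      rw [Finset.sum_const, nsmul_eq_mul, ENNReal.ofReal_mul (by positivity),
        ENNReal.ofReal_mul (by positivity), ENNReal.ofReal_natCast, ENNReal.ofReal_toReal hB]
    _ ≤ _ := by
      refine ENNReal.ofReal_le_ofReal ?_
      calc (P.card:ℝ) * ((ρ * (C * (1 + A))) ^ d * B)
          ≤ (C * (1 + |r / ρ|) ^ (d - 1)) * ((ρ * (C * (1 + A))) ^ d * (B + 1)) := by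
            gcongr
            linarith
        _ = _ := by rw [abs_div, abs_of_pos hρ, mul_pow ρ]; ring

end waveWeight

section hilbert
variable {H ι : Type*} [NormedAddCommGroup H] [InnerProductSpace ℂ H]

theorem norm_sum_sq_le_sum_norm_inner (s : Finset ι) (x : ι → H) :
    ‖∑ i ∈ s, x i‖ ^ 2 ≤ ∑ i ∈ s, ∑ k ∈ s, ‖inner ℂ (x i) (x k)‖ := by
  have h1 : ‖∑ i ∈ s, x i‖ ^ 2 = ‖inner ℂ (∑ i ∈ s, x i) (∑ i ∈ s, x i)‖ := by
    rw [inner_self_eq_norm_sq_to_K]; simp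
  rw [h1, sum_inner]
  refine (norm_sum_le _ _).trans (Finset.sum_le_sum fun i _ => ?_)
  rw [inner_sum]
  exact norm_sum_le _ _

theorem sum_norm_inner_near_le (s : Finset ι) (x : ι → H) (R : ι → ι → Prop)
    [DecidableRel R] (hR : ∀ i k, R i k → R k i) {D : ℝ}
    (hD : ∀ i ∈ s, ((s.filter (R i)).card : ℝ) ≤ D) :
    ∑ i ∈ s, ∑ k ∈ s with R i k, ‖inner ℂ (x i) (x k)‖ ≤ D * ∑ i ∈ s, ‖x i‖ ^ 2 := by
  have h1 : ∑ i ∈ s, ∑ k ∈ s with R i k, ‖x i‖ ^ 2 ≤ D * ∑ i ∈ s, ‖x i‖ ^ 2 := by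
    rw [Finset.mul_sum]
    refine Finset.sum_le_sum fun i hi => ?_
    rw [Finset.sum_const, nsmul_eq_mul]
    gcongr
    exact hD i hi
  have h2 : ∑ i ∈ s, ∑ k ∈ s with R i k, ‖x k‖ ^ 2 ≤ D * ∑ i ∈ s, ‖x i‖ ^ 2 := by
    refine le_trans (le_of_eq ?_) h1
    simp_rw [Finset.sum_filter]
    rw [Finset.sum_comm]
    refine Finset.sum_congr rfl fun i _ => Finset.sum_congr rfl fun k _ => ?_
    simp only [show R k i ↔ R i k from ⟨hR _ _, hR _ _⟩]
  calc ∑ i ∈ s, ∑ k ∈ s with R i k, ‖inner ℂ (x i) (x k)‖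
      ≤ ∑ i ∈ s, ∑ k ∈ s with R i k, (‖x i‖ ^ 2 / 2 + ‖x k‖ ^ 2 / 2) := by
        refine Finset.sum_le_sum fun i _ => Finset.sum_le_sum fun k _ => ?_
        have := norm_inner_le_norm (𝕜 := ℂ) (x i) (x k)
        nlinarith [sq_nonneg (‖x i‖ - ‖x k‖)]
    _ = (∑ i ∈ s, ∑ k ∈ s with R i k, ‖x i‖ ^ 2 +
          ∑ i ∈ s, ∑ k ∈ s with R i k, ‖x k‖ ^ 2) / 2 := by
        simp_rw [Finset.sum_add_distrib, ← Finset.sum_div]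
        rw [add_div]
    _ ≤ _ := by linarith

theorem card_le_of_forall_mem_Icc {T : Finset ℕ} {x L : ℝ} (hL : 0 ≤ L)
    (h : ∀ t ∈ T, x ≤ t ∧ (t : ℝ) ≤ x + L) : (T.card : ℝ) ≤ L + 1 := by
  rcases T.eq_empty_or_nonempty with rfl | hT
  · simp; linarith
  have h1 : T ⊆ Finset.Icc (T.min' hT) (T.max' hT) := fun t ht =>
    Finset.mem_Icc.2 ⟨T.min'_le t ht, T.le_max' t ht⟩
  have h2 := Finset.card_le_card h1
  have h3 := T.min'_le _ (T.max'_mem hT)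
  rw [Nat.card_Icc] at h2
  have h4 : T.card + T.min' hT ≤ T.max' hT + 1 := by omega
  have h5 : (T.card : ℝ) + T.min' hT ≤ T.max' hT + 1 := by exact_mod_cast h4
  have := (h _ (T.min'_mem hT)).1
  have := (h _ (T.max'_mem hT)).2
  linarith

theorem sum_comp_le_card_mul_sum {α β γ : Type*} [DecidableEq β] [DecidableEq γ]
    (E : Finset α) (f : α → β × γ) {K : ℝ}
    (hK : 0 ≤ K) (hE : ∀ Q, ((E.filter (f · = Q)).card : ℝ) ≤ K) {g : γ → ℝ} (hg : ∀ c, 0 ≤ g c) :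
    ∑ e ∈ E, g (f e).2 ≤ K * (E.image fun e => (f e).1).card *
      ∑ m ∈ E.image fun e => (f e).2, g m := by
  set T := E.image fun e => (f e).1
  set M := E.image fun e => (f e).2
  have h1 : ∑ e ∈ E, g (f e).2 = ∑ Q ∈ T ×ˢ M, ∑ e ∈ E with f e = Q, g (f e).2 :=
    (Finset.sum_fiberwise_of_maps_to (g := f) (fun e he => Finset.mem_product.2
      ⟨Finset.mem_image_of_mem (fun e => (f e).1) he,
        Finset.mem_image_of_mem (fun e => (f e).2) he⟩) _).symm
  have h2 : ∀ Q, ∑ e ∈ E with f e = Q, g (f e).2 ≤ K * g Q.2 := by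
    intro Q
    have h3 : ∑ e ∈ E with f e = Q, g (f e).2 = ∑ e ∈ E with f e = Q, g Q.2 :=
      Finset.sum_congr rfl fun e he => by rw [(Finset.mem_filter.1 he).2]
    rw [h3, Finset.sum_const, nsmul_eq_mul]
    exact mul_le_mul_of_nonneg_right (hE Q) (hg _)
  rw [h1]
  refine (Finset.sum_le_sum fun Q _ => h2 Q).trans (le_of_eq ?_)
  rw [← Finset.mul_sum, Finset.sum_product]
  simp only [Finset.sum_const, nsmul_eq_mul, mul_assoc]

end hilbert

section count
variable {d : ℕ} {a : Rd d → ℝ}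

/-- The index of the dyadic cube of side `2 ^ l` containing a lattice point. -/
def cell (l : ℕ) (e : ℕ × (Fin d → ℤ)) : ℕ × (Fin d → ℤ) :=
  (e.1 / 2 ^ l, fun i => e.2 i / 2 ^ l)

theorem norm_smul_latticeVec_sub_le (l : ℕ) (e : ℕ × (Fin d → ℤ)) :
    ‖((2:ℝ) ^ l)⁻¹ • latticeVec d e.2 - latticeVec d (cell l e).2‖ ≤ d := by
  have h2 : (0:ℝ) < 2 ^ l := by positivity
  have := norm_le_of_forall_abs_le (x := ((2:ℝ) ^ l)⁻¹ • latticeVec d e.2 -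
    latticeVec d (cell l e).2) zero_le_one fun i => by
      simp only [latticeVec, PiLp.sub_apply, PiLp.smul_apply, smul_eq_mul, cell]
      have h1 : ((2:ℝ) ^ l)⁻¹ * (e.2 i : ℝ) = (e.2 i : ℝ) / ((2 ^ l : ℕ) : ℝ) := by
        push_cast; rw [div_eq_inv_mul]
      have h3 : (e.2 i / 2 ^ l : ℤ) = ⌊(e.2 i : ℝ) / ((2 ^ l : ℕ) : ℝ)⌋ := by
        rw [← Int.floor_intCast (R := ℝ) (e.2 i), Int.floor_div_natCast]; simp
      rw [h1, h3, abs_of_nonneg (by linarith [Int.floor_le ((e.2 i : ℝ) / ((2 ^ l : ℕ) : ℝ))])]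
      linarith [Int.lt_floor_add_one ((e.2 i : ℝ) / ((2 ^ l : ℕ) : ℝ))]
  simpa using this

theorem cell_fst_mem (l : ℕ) (e : ℕ × (Fin d → ℤ)) :
    ((cell l e).1 : ℝ) ≤ (e.1 : ℝ) / 2 ^ l ∧ (e.1 : ℝ) / 2 ^ l ≤ (cell l e).1 + 1 := by
  have h2 : (0:ℝ) < 2 ^ l := by positivity
  have h3 : 0 < 2 ^ l := by positivity
  rw [le_div_iff₀ h2, div_le_iff₀ h2]
  constructor
  · exact_mod_cast Nat.div_mul_le_self e.1 (2 ^ l)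
  · have := (Nat.lt_div_mul_add h3 (a := e.1)).le
    have h4 : e.1 ≤ (e.1 / 2 ^ l + 1) * 2 ^ l := by rw [add_mul, one_mul]; exact this
    exact_mod_cast h4

theorem exists_sum_waveWeight_cell_le (hd : 1 ≤ d) (ha : IsDistFn a) {B : ℝ} (hB : 0 ≤ B) :
    ∃ C : ℝ, 0 < C ∧ ∀ (l : ℕ) (K : ℝ) (E : Finset (ℕ × (Fin d → ℤ))), 0 ≤ K →
      (∀ Q, ((E.filter (cell l · = Q)).card : ℝ) ≤ K) → ∀ (s r : ℝ) (z : Fin d → ℤ),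
      ∑ e ∈ E with |(e.1 : ℝ) - s - r| ≤ B * 2 ^ l,
        waveWeight a (d + 1) (e.1 - s) (latticeVec d z - latticeVec d e.2) ≤
          C * K * (1 + |r| / 2 ^ l) ^ (d - 1) := by
  obtain ⟨G, hG, hmove⟩ := exists_infDist_waveSet_le_add hd ha
  obtain ⟨C, hC, hsum⟩ := exists_sum_waveWeight_le hd ha
  refine ⟨(1 + d + G * B) ^ (d + 1) * (2 * B + 2) * C, by positivity,
    fun l K E hK hE s r z => ?_⟩
  have h2 : (0:ℝ) < 2 ^ l := by positivity
  set E' := E.filter fun e => |(e.1 : ℝ) - s - r| ≤ B * 2 ^ l with hE'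
  set g : ℕ × (Fin d → ℤ) → ℝ := fun Q => (1 + d + G * B) ^ (d + 1) *
    waveWeight a (d + 1) (r / 2 ^ l) (((2:ℝ) ^ l)⁻¹ • latticeVec d z - latticeVec d Q.2) with hg
  have hg0 : ∀ Q, 0 ≤ g Q := fun Q => mul_nonneg (by positivity) (waveWeight_nonneg _ _ _)
  have hpt : ∀ e ∈ E', waveWeight a (d + 1) (e.1 - s) (latticeVec d z - latticeVec d e.2) ≤
      g (cell l e) := by
    intro e he
    have he1 := (Finset.mem_filter.1 he).2
    refine waveWeight_le_mul ?_ _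
    set D := Metric.infDist (latticeVec d z - latticeVec d e.2) (waveSet a (e.1 - s))
    have hD : 0 ≤ D := Metric.infDist_nonneg
    have h3 := hmove r (e.1 - s) (latticeVec d z - latticeVec d e.2)
    rw [abs_sub_comm] at h3
    have h4 := infDist_smul_waveSet a (inv_pos.2 h2) r (latticeVec d z - latticeVec d e.2)
    rw [← div_eq_inv_mul, ← div_eq_inv_mul] at h4
    have h5 : Metric.infDist (((2:ℝ) ^ l)⁻¹ • latticeVec d z - latticeVec d (cell l e).2)
        (waveSet a (r / 2 ^ l)) ≤
        Metric.infDist (((2:ℝ) ^ l)⁻¹ • (latticeVec d z - latticeVec d e.2))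
          (waveSet a (r / 2 ^ l)) + d := by
      refine (Metric.infDist_le_infDist_add_dist (y := ((2:ℝ) ^ l)⁻¹ • (latticeVec d z -
        latticeVec d e.2))).trans ?_
      gcongr
      rw [dist_eq_norm, smul_sub, sub_sub_sub_cancel_left]
      exact norm_smul_latticeVec_sub_le l e
    have h6 : Metric.infDist (latticeVec d z - latticeVec d e.2) (waveSet a r) / 2 ^ l ≤
        D + G * B := by
      rw [div_le_iff₀ h2]
      have h7 : G * |(e.1:ℝ) - s - r| ≤ G * (B * 2 ^ l) := by gcongr
      have h8 : D ≤ D * 2 ^ l := le_mul_of_one_le_right hD (one_le_pow₀ one_le_two)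
      calc _ ≤ _ := h3
        _ ≤ D * 2 ^ l + G * (B * 2 ^ l) := by linarith
        _ = _ := by ring
    rw [h4] at h5
    have h9 : 0 ≤ G * B * D := by positivity
    have h10 : 0 ≤ d * D := by positivity
    calc _ ≤ 1 + (D + G * B + d) := by linarith
      _ ≤ (1 + d + G * B) * (1 + D) := by linarith
  set T := E'.image fun e => (cell l e).1
  set M := E'.image fun e => (cell l e).2
  have hT : (T.card : ℝ) ≤ 2 * B + 2 := by
    have h3 := card_le_of_forall_mem_Icc (T := T) (x := (s + r) / 2 ^ l - B - 1) (L := 2 * B + 1)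
      (by linarith) fun t ht => by
        obtain ⟨e, he, rfl⟩ := Finset.mem_image.1 ht
        have he1 := abs_le.1 (Finset.mem_filter.1 he).2
        obtain ⟨h3, h4⟩ := cell_fst_mem l e
        have h5 : (s + r) / 2 ^ l - B ≤ (e.1:ℝ) / 2 ^ l := by
          rw [sub_le_iff_le_add, div_le_iff₀ h2, add_mul, div_mul_cancel₀ _ h2.ne']
          linarith
        have h6 : (e.1:ℝ) / 2 ^ l ≤ (s + r) / 2 ^ l + B := by
          rw [div_add' _ _ _ h2.ne', div_le_div_iff_of_pos_right h2]
          linarith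
        constructor <;> linarith
    linarith
  have h3 := (hsum (r / 2 ^ l) (((2:ℝ) ^ l)⁻¹ • latticeVec d z) M).1
  have h4 := sum_comp_le_card_mul_sum E' (cell l) hK (fun Q => le_trans (Nat.cast_le.2
      (Finset.card_le_card (Finset.filter_subset_filter _ (Finset.filter_subset _ _)))) (hE Q)) (g := fun m =>
      waveWeight a (d + 1) (r / 2 ^ l) (((2:ℝ) ^ l)⁻¹ • latticeVec d z - latticeVec d m))
      (fun m => waveWeight_nonneg _ _ _)
  have h5 : 0 ≤ ∑ m ∈ M, waveWeight a (d + 1) (r / 2 ^ l)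
    (((2:ℝ) ^ l)⁻¹ • latticeVec d z - latticeVec d m) :=
    Finset.sum_nonneg fun _ _ => waveWeight_nonneg _ _ _
  calc ∑ e ∈ E', waveWeight a (d + 1) (e.1 - s) (latticeVec d z - latticeVec d e.2)
      ≤ ∑ e ∈ E', g (cell l e) := Finset.sum_le_sum hpt
    _ ≤ (1 + d + G * B) ^ (d + 1) * (K * T.card * ∑ m ∈ M, waveWeight a (d + 1) (r / 2 ^ l)
          (((2:ℝ) ^ l)⁻¹ • latticeVec d z - latticeVec d m)) := by
        rw [← Finset.mul_sum]
        exact mul_le_mul_of_nonneg_left h4 (by positivity)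
    _ ≤ (1 + d + G * B) ^ (d + 1) * (K * (2 * B + 2) * (C * (1 + |r / 2 ^ l|) ^ (d - 1))) := by
        gcongr
    _ = _ := by rw [abs_div, abs_of_pos h2]; ring

end count

section nearFar
variable {H : Type*} [NormedAddCommGroup H] [InnerProductSpace ℂ H]

theorem norm_sum_sq_le_near_add_far {α β : Type*} [DecidableEq β] (E : Finset α) (f : α → β)
    (v : α → H) (R : β → β → Prop) [DecidableRel R] (hR : ∀ i k, R i k → R k i) {D : ℝ}
    (hD : ∀ n ∈ E.image f, (((E.image f).filter (R n)).card : ℝ) ≤ D) :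
    ‖∑ e ∈ E, v e‖ ^ 2 ≤ D * ∑ n ∈ E.image f, ‖∑ e ∈ E with f e = n, v e‖ ^ 2 +
      ∑ e ∈ E, ∑ e' ∈ E with ¬ R (f e) (f e'), ‖inner ℂ (v e) (v e')‖ := by
  set N := E.image f with hN
  set g : β → H := fun n => ∑ e ∈ E with f e = n, v e with hg
  have hmaps : ∀ e ∈ E, f e ∈ N := fun e he => Finset.mem_image_of_mem f he
  have h1 : ∑ e ∈ E, v e = ∑ n ∈ N, g n :=
    (Finset.sum_fiberwise_of_maps_to hmaps _).symm
  have h2 : ∑ n ∈ N, ∑ k ∈ N with ¬ R n k, ‖inner ℂ (g n) (g k)‖ ≤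
      ∑ e ∈ E, ∑ e' ∈ E with ¬ R (f e) (f e'), ‖inner ℂ (v e) (v e')‖ := by
    have h3 : ∀ n, ∑ k ∈ N with ¬ R n k, ‖inner ℂ (g n) (g k)‖ ≤
        ∑ e ∈ E with f e = n, ∑ e' ∈ E with ¬ R n (f e'), ‖inner ℂ (v e) (v e')‖ := by
      intro n
      have h4 : ∀ k ∈ N.filter (¬ R n ·), ‖inner ℂ (g n) (g k)‖ ≤
          ∑ e ∈ E with f e = n, ∑ e' ∈ E.filter (fun e' => ¬ R n (f e')) with f e' = k,
            ‖inner ℂ (v e) (v e')‖ := by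
        intro k hk
        have h5 : (E.filter (fun e' => ¬ R n (f e'))).filter (f · = k) = E.filter (f · = k) := by
          ext e
          simp only [Finset.mem_filter]
          constructor
          · rintro ⟨⟨h, _⟩, h'⟩; exact ⟨h, h'⟩
          · rintro ⟨h, rfl⟩; exact ⟨⟨h, (Finset.mem_filter.1 hk).2⟩, rfl⟩
        rw [h5, hg, sum_inner]
        refine (norm_sum_le _ _).trans (Finset.sum_le_sum fun e _ => ?_)
        rw [inner_sum]
        exact norm_sum_le _ _
      refine (Finset.sum_le_sum h4).trans ?_
      rw [Finset.sum_comm]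
      refine Finset.sum_le_sum fun e _ => le_of_eq ?_
      exact Finset.sum_fiberwise_of_maps_to (fun e' he' => Finset.mem_filter.2
        ⟨hmaps _ (Finset.mem_filter.1 he').1, (Finset.mem_filter.1 he').2⟩) _
    refine (Finset.sum_le_sum fun n _ => h3 n).trans (le_of_eq ?_)
    rw [← Finset.sum_fiberwise_of_maps_to hmaps]
    refine Finset.sum_congr rfl fun n _ => Finset.sum_congr rfl fun e he => ?_
    rw [(Finset.mem_filter.1 he).2]
  calc ‖∑ e ∈ E, v e‖ ^ 2 ≤ ∑ n ∈ N, ∑ k ∈ N, ‖inner ℂ (g n) (g k)‖ := by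
        rw [h1]; exact norm_sum_sq_le_sum_norm_inner N g
    _ = ∑ n ∈ N, ∑ k ∈ N with R n k, ‖inner ℂ (g n) (g k)‖ +
        ∑ n ∈ N, ∑ k ∈ N with ¬ R n k, ‖inner ℂ (g n) (g k)‖ := by
      rw [← Finset.sum_add_distrib]
      refine Finset.sum_congr rfl fun n _ => ?_
      rw [Finset.sum_filter_add_sum_filter_not]
    _ ≤ _ := add_le_add (sum_norm_inner_near_le N g R hR hD) h2

end nearFar

section almostOrthogonal
variable {d : ℕ} {a : Rd d → ℝ} {H : Type*} [NormedAddCommGroup H] [InnerProductSpace ℂ H]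

/-- Almost orthogonality of wave packets at times `e.1` and lattice positions `e.2`. -/
def WaveAlmostOrtho (a : Rd d → ℝ) (C₀ : ℝ) (v : ℕ × (Fin d → ℤ) → H) : Prop :=
  ∀ (e e' : ℕ × (Fin d → ℤ)) (ε : ℝ), 0 < ε → 1 ≤ ε ^ 2 * (1 + |(e'.1 : ℝ) - e.1|) →
    ‖inner ℂ (v e) (v e')‖ ≤ C₀ * ε ^ (d - 1) *
      waveWeight a (d + 1) (e'.1 - e.1) (latticeVec d e.2 - latticeVec d e'.2)

/-- The constant `2^{-1/2}`. -/
def invSqrtTwo : ℝ := (√2)⁻¹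

theorem invSqrtTwo_pos : 0 < invSqrtTwo := by unfold invSqrtTwo; positivity

theorem invSqrtTwo_sq : invSqrtTwo ^ 2 = 1 / 2 := by
  unfold invSqrtTwo; rw [inv_pow, Real.sq_sqrt (by norm_num)]; norm_num

theorem invSqrtTwo_lt_one : invSqrtTwo < 1 := by
  have h1 := invSqrtTwo_sq
  have h2 := invSqrtTwo_pos
  nlinarith

theorem invSqrtTwo_pow_pow_sq (l : ℕ) : (invSqrtTwo ^ l) ^ 2 = ((2:ℝ) ^ l)⁻¹ := by
  rw [← pow_mul, mul_comm, pow_mul, invSqrtTwo_sq, one_div, inv_pow]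

theorem two_mul_invSqrtTwo_pow (hd : 4 ≤ d) : 2 * invSqrtTwo ^ (d - 1) = invSqrtTwo ^ (d - 3) := by
  rw [show d - 1 = (d - 3) + 2 by omega, pow_add, invSqrtTwo_sq]; ring

theorem invSqrtTwo_pow_lt_one (hd : 4 ≤ d) : invSqrtTwo ^ (d - 3) < 1 :=
  pow_lt_one₀ invSqrtTwo_pos.le invSqrtTwo_lt_one (by omega)

theorem exists_norm_sum_sq_le_same_time (hd : 1 ≤ d) (ha : IsDistFn a) :
    ∃ C : ℝ, 0 < C ∧ ∀ (v : ℕ × (Fin d → ℤ) → H) (C₀ : ℝ), 0 ≤ C₀ → WaveAlmostOrtho a C₀ v →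
      ∀ (n : ℕ) (E : Finset (ℕ × (Fin d → ℤ))), (∀ e ∈ E, e.1 = n) →
        ‖∑ e ∈ E, v e‖ ^ 2 ≤ C * C₀ * E.card := by
  obtain ⟨C, hC, hsum⟩ := exists_sum_waveWeight_le hd ha
  refine ⟨C, hC, fun v C₀ hC₀ hv n E hE => ?_⟩
  refine (norm_sum_sq_le_sum_norm_inner E v).trans ?_
  rw [mul_comm, ← nsmul_eq_mul, ← Finset.sum_const]
  refine Finset.sum_le_sum fun e he => ?_
  have h1 : ∀ e' ∈ E, ‖inner ℂ (v e) (v e')‖ ≤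
      C₀ * waveWeight a (d + 1) 0 (latticeVec d e.2 - latticeVec d e'.2) := by
    intro e' he'
    have := hv e e' 1 one_pos (by simp)
    rwa [hE e he, hE e' he', sub_self, one_pow, mul_one] at this
  refine (Finset.sum_le_sum h1).trans ?_
  have h2 : Set.InjOn Prod.snd (E : Set (ℕ × (Fin d → ℤ))) := by
    intro x hx y hy hxy
    exact Prod.ext ((hE x hx).trans (hE y hy).symm) hxy
  have h3 := (hsum 0 (latticeVec d e.2) (E.image Prod.snd)).1
  rw [Finset.sum_image h2] at h3
  rw [← Finset.mul_sum, mul_comm C]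
  gcongr
  simpa using h3

theorem exists_sum_inner_far_le (hd : 4 ≤ d) (ha : IsDistFn a) :
    ∃ C : ℝ, 0 < C ∧ ∀ (v : ℕ × (Fin d → ℤ) → H) (C₀ : ℝ), 0 ≤ C₀ → WaveAlmostOrtho a C₀ v →
      ∀ (m j : ℕ) (u : ℝ) (E : Finset (ℕ × (Fin d → ℤ))), 0 ≤ u →
      u * (invSqrtTwo ^ m) ^ (d - 1) ≤ 1 →
      (∀ e ∈ E, (2:ℝ) ^ j ≤ e.1 ∧ (e.1:ℝ) < 2 ^ (j + 1)) →
      (∀ l ≤ j, ∀ Q, ((E.filter (cell l · = Q)).card : ℝ) ≤ u * 2 ^ l) → ∀ e ∈ E,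
        ∑ e' ∈ E with ¬ |(e.1:ℝ) - e'.1| ≤ 2 ^ m, ‖inner ℂ (v e) (v e')‖ ≤ C * C₀ * 2 ^ m := by
  obtain ⟨C, hC, hcount⟩ := exists_sum_waveWeight_cell_le (d := d) (by omega) ha zero_le_two
  set q := invSqrtTwo ^ (d - 3) with hq
  have hq0 : 0 < q := pow_pos invSqrtTwo_pos _
  have hq1 : q < 1 := invSqrtTwo_pow_lt_one hd
  have hq1' : 0 < 1 - q := sub_pos.2 hq1
  have hσ := invSqrtTwo_pos
  refine ⟨C / (1 - q), by positivity, fun v C₀ hC₀ hv m j u E hu hum hE hsp e he => ?_⟩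
  set w : ℕ × (Fin d → ℤ) → ℝ := fun e' =>
    waveWeight a (d + 1) (e'.1 - e.1) (latticeVec d e.2 - latticeVec d e'.2)
  have hw : ∀ e', 0 ≤ w e' := fun e' => waveWeight_nonneg _ _ _
  have h1 : ∀ e' ∈ E.filter (fun e' => ¬ |(e.1:ℝ) - e'.1| ≤ 2 ^ m), ‖inner ℂ (v e) (v e')‖ ≤
      ∑ l ∈ Finset.Ico m (j + 1), if |(e'.1:ℝ) - e.1 - 0| ≤ 2 * 2 ^ l then
        C₀ * (invSqrtTwo ^ l) ^ (d - 1) * w e' else 0 := by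
    intro e' he'
    obtain ⟨heE, hfar⟩ := Finset.mem_filter.1 he'
    rw [abs_sub_comm, not_le] at hfar
    obtain ⟨l, hl1, hl2⟩ := exists_nat_pow_near (y := (2:ℝ))
      ((one_le_pow₀ one_le_two).trans hfar.le) one_lt_two
    have hlt : |(e'.1:ℝ) - e.1| < 2 ^ j := by
      have h3 := hE e he
      have h4 := hE e' heE
      rw [pow_succ] at h3 h4
      rw [abs_lt]; constructor <;> linarith
    have hml : m < l + 1 := (pow_lt_pow_iff_right₀ one_lt_two).1 (hfar.trans hl2)
    have hlj : l < j := (pow_lt_pow_iff_right₀ one_lt_two).1 (hl1.trans_lt hlt)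
    have hlmem : l ∈ Finset.Ico m (j + 1) := Finset.mem_Ico.2 ⟨by omega, by omega⟩
    refine le_trans ?_ (Finset.single_le_sum (f := fun l => if |(e'.1:ℝ) - e.1 - 0| ≤ 2 * 2 ^ l then
        C₀ * (invSqrtTwo ^ l) ^ (d - 1) * w e' else 0) (fun i _ => ?_) hlmem)
    · have h5 : |(e'.1:ℝ) - e.1 - 0| ≤ 2 * 2 ^ l := by
        rw [sub_zero]; rw [pow_succ] at hl2; linarith
      simp only [h5, if_true]
      refine hv e e' _ (pow_pos hσ l) ?_
      rw [invSqrtTwo_pow_pow_sq, ← div_eq_inv_mul, le_div_iff₀ (by positivity)]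
      linarith
    · have := hw e'
      split_ifs
      · positivity
      · exact le_rfl
  have h2 : ∀ l ∈ Finset.Ico m (j + 1), (∑ e' ∈ E with ¬ |(e.1:ℝ) - e'.1| ≤ 2 ^ m,
      if |(e'.1:ℝ) - e.1 - 0| ≤ 2 * 2 ^ l then
        C₀ * (invSqrtTwo ^ l) ^ (d - 1) * w e' else 0) ≤ C₀ * C * u * q ^ l := by
    intro l hl
    have h3 : (∑ e' ∈ E with ¬ |(e.1:ℝ) - e'.1| ≤ 2 ^ m,
      if |(e'.1:ℝ) - e.1 - 0| ≤ 2 * 2 ^ l then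
        C₀ * (invSqrtTwo ^ l) ^ (d - 1) * w e' else 0) ≤
      ∑ e' ∈ E, if |(e'.1:ℝ) - e.1 - 0| ≤ 2 * 2 ^ l then
        C₀ * (invSqrtTwo ^ l) ^ (d - 1) * w e' else 0 := by
      refine Finset.sum_le_sum_of_subset_of_nonneg (Finset.filter_subset _ _) fun e' _ _ => ?_
      have := hw e'
      split_ifs
      · positivity
      · exact le_rfl
    refine h3.trans ?_
    rw [← Finset.sum_filter, ← Finset.mul_sum]
    have h4 := hcount l (u * 2 ^ l) E (by positivity)
      (hsp l (by have := Finset.mem_Ico.1 hl; omega)) e.1 0 e.2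
    rw [abs_zero, zero_div, add_zero, one_pow, mul_one] at h4
    have h5 : (invSqrtTwo ^ l) ^ (d - 1) * 2 ^ l = q ^ l := by
      rw [hq, ← two_mul_invSqrtTwo_pow hd, mul_pow, ← pow_mul, ← pow_mul, mul_comm l]; ring
    calc _ ≤ C₀ * (invSqrtTwo ^ l) ^ (d - 1) * (C * (u * 2 ^ l)) := by gcongr
      _ = C₀ * C * u * ((invSqrtTwo ^ l) ^ (d - 1) * 2 ^ l) := by ring
      _ = _ := by rw [h5]
  refine (Finset.sum_le_sum h1).trans ?_
  rw [Finset.sum_comm]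
  refine (Finset.sum_le_sum h2).trans ?_
  rw [← Finset.mul_sum]
  have h6 := geom_sum_Ico_le_of_lt_one hq0.le hq1 (m := m) (n := j + 1)
  have h7 : u * q ^ m ≤ 2 ^ m := by
    have h8 : q ^ m = (invSqrtTwo ^ m) ^ (d - 1) * 2 ^ m := by
      rw [hq, ← two_mul_invSqrtTwo_pow hd, mul_pow, ← pow_mul, ← pow_mul, mul_comm m]; ring
    rw [h8, ← mul_assoc]
    exact mul_le_of_le_one_left (by positivity) hum
  calc _ ≤ C₀ * C * u * (q ^ m / (1 - q)) := by gcongr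
    _ = C₀ * C / (1 - q) * (u * q ^ m) := by ring
    _ ≤ C₀ * C / (1 - q) * 2 ^ m := by gcongr
    _ = _ := by ring

end almostOrthogonal

section almostOrthogonal
variable {d : ℕ} {a : Rd d → ℝ} {H : Type*} [NormedAddCommGroup H] [InnerProductSpace ℂ H]

theorem exists_norm_sum_sq_le_sparse (hd : 4 ≤ d) (ha : IsDistFn a) :
    ∃ C : ℝ, 0 < C ∧ ∀ (v : ℕ × (Fin d → ℤ) → H) (C₀ : ℝ), 0 ≤ C₀ → WaveAlmostOrtho a C₀ v →
      ∀ (m j : ℕ) (u : ℝ) (E : Finset (ℕ × (Fin d → ℤ))), 0 ≤ u →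
      u * (invSqrtTwo ^ m) ^ (d - 1) ≤ 1 →
      (∀ e ∈ E, (2:ℝ) ^ j ≤ e.1 ∧ (e.1:ℝ) < 2 ^ (j + 1)) →
      (∀ l ≤ j, ∀ Q, ((E.filter (cell l · = Q)).card : ℝ) ≤ u * 2 ^ l) →
        ‖∑ e ∈ E, v e‖ ^ 2 ≤ C * C₀ * 2 ^ m * E.card := by
  obtain ⟨C₁, hC₁, h₁⟩ := exists_norm_sum_sq_le_same_time (H := H) (d := d) (by omega) ha
  obtain ⟨C₂, hC₂, h₂⟩ := exists_sum_inner_far_le (H := H) hd ha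
  refine ⟨3 * C₁ + C₂, by positivity, fun v C₀ hC₀ hv m j u E hu hum hE hsp => ?_⟩
  have hfar : ∑ e ∈ E, ∑ e' ∈ E with ¬ |(e.1:ℝ) - e'.1| ≤ 2 ^ m, ‖inner ℂ (v e) (v e')‖ ≤
      E.card * (C₂ * C₀ * 2 ^ m) := by
    rw [← nsmul_eq_mul, ← Finset.sum_const]
    exact Finset.sum_le_sum fun e he => h₂ v C₀ hC₀ hv m j u E hu hum hE hsp e he
  have hnear : ∑ n ∈ E.image Prod.fst, ‖∑ e ∈ E with e.1 = n, v e‖ ^ 2 ≤ C₁ * C₀ * E.card := by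
    calc _ ≤ ∑ n ∈ E.image Prod.fst, C₁ * C₀ * ((E.filter (·.1 = n)).card : ℝ) :=
          Finset.sum_le_sum fun n _ => h₁ v C₀ hC₀ hv n _ fun e he => (Finset.mem_filter.1 he).2
      _ = _ := by
        rw [← Finset.mul_sum, ← Nat.cast_sum,
          ← Finset.card_eq_sum_card_fiberwise fun e he => Finset.mem_image_of_mem _ he]
  have h3 := norm_sum_sq_le_near_add_far E Prod.fst v (fun n k => |(n:ℝ) - k| ≤ 2 ^ m)
    (fun i k h => by rwa [abs_sub_comm]) (D := 3 * 2 ^ m) fun n _ => by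
      have h4 := card_le_of_forall_mem_Icc (x := (n:ℝ) - 2 ^ m) (L := 2 * 2 ^ m)
        (T := (E.image Prod.fst).filter fun k => |(n:ℝ) - k| ≤ 2 ^ m) (by positivity) fun t ht => by
          have := abs_le.1 (Finset.mem_filter.1 ht).2
          constructor <;> linarith
      have h5 : (1:ℝ) ≤ 2 ^ m := one_le_pow₀ one_le_two
      linarith
  refine h3.trans ?_
  calc _ ≤ 3 * 2 ^ m * (C₁ * C₀ * E.card) + E.card * (C₂ * C₀ * 2 ^ m) := by gcongr
    _ = _ := by ring

theorem exists_sum_inner_cross_le (hd : 4 ≤ d) (ha : IsDistFn a) :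
    ∃ C : ℝ, 0 < C ∧ ∀ (v : ℕ × (Fin d → ℤ) → H) (C₀ : ℝ), 0 ≤ C₀ → WaveAlmostOrtho a C₀ v →
      ∀ (j k : ℕ) (u : ℝ) (E : Finset (ℕ × (Fin d → ℤ))), 0 ≤ u → k + 2 ≤ j →
      (∀ e ∈ E, (e.1:ℝ) < 2 ^ (k + 1)) →
      (∀ Q, ((E.filter (cell k · = Q)).card : ℝ) ≤ u * 2 ^ k) →
      ∀ e : ℕ × (Fin d → ℤ), (2:ℝ) ^ j ≤ e.1 → (e.1:ℝ) < 2 ^ (j + 1) →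
        ∑ e' ∈ E, ‖inner ℂ (v e) (v e')‖ ≤
          C * C₀ * u * (invSqrtTwo ^ j) ^ (d - 1) * 2 ^ k * (2 ^ j / 2 ^ k) ^ (d - 1) := by
  obtain ⟨C, hC, hcount⟩ := exists_sum_waveWeight_cell_le (d := d) (by omega) ha zero_le_two
  have hσ := invSqrtTwo_pos
  refine ⟨2 ^ (d - 1) * C * 3 ^ (d - 1), by positivity,
    fun v C₀ hC₀ hv j k u E hu hkj hE hsp e he1 he2 => ?_⟩
  set w : ℕ × (Fin d → ℤ) → ℝ := fun e' =>
    waveWeight a (d + 1) (e'.1 - e.1) (latticeVec d e.2 - latticeVec d e'.2)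
  have h2k : (0:ℝ) < 2 ^ k := by positivity
  have hjk : 4 * (2:ℝ) ^ k ≤ 2 ^ j := by
    calc 4 * (2:ℝ) ^ k = 2 ^ (k + 2) := by ring
      _ ≤ 2 ^ j := pow_le_pow_right₀ one_le_two hkj
  have h1 : ∀ e' ∈ E, ‖inner ℂ (v e) (v e')‖ ≤ C₀ * (2 * invSqrtTwo ^ j) ^ (d - 1) * w e' := by
    intro e' he'
    refine hv e e' _ (by positivity) ?_
    have h2 := hE e' he'
    rw [pow_succ] at h2
    rw [mul_pow, invSqrtTwo_pow_pow_sq, abs_sub_comm, abs_of_nonneg (by linarith), mul_comm (2 ^ 2 : ℝ),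
      mul_assoc, ← div_eq_inv_mul, le_div_iff₀ (by positivity)]
    linarith
  have h3 := hcount k (u * 2 ^ k) E (by positivity) hsp e.1 (-e.1) e.2
  rw [Finset.filter_true_of_mem fun e' he' => by
    have := hE e' he'
    rw [pow_succ] at this
    rw [sub_neg_eq_add, sub_add_cancel, abs_of_nonneg (Nat.cast_nonneg _)]
    linarith, abs_neg, abs_of_nonneg (Nat.cast_nonneg _)] at h3
  have h4 : 1 + (e.1:ℝ) / 2 ^ k ≤ 3 * (2 ^ j / 2 ^ k) := by
    rw [← mul_div_assoc, one_add_div h2k.ne']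
    gcongr
    rw [pow_succ] at he2
    linarith
  calc ∑ e' ∈ E, ‖inner ℂ (v e) (v e')‖
      ≤ ∑ e' ∈ E, C₀ * (2 * invSqrtTwo ^ j) ^ (d - 1) * w e' := Finset.sum_le_sum h1
    _ = C₀ * (2 * invSqrtTwo ^ j) ^ (d - 1) * ∑ e' ∈ E, w e' := by rw [Finset.mul_sum]
    _ ≤ C₀ * (2 * invSqrtTwo ^ j) ^ (d - 1) *
        (C * (u * 2 ^ k) * (3 * (2 ^ j / 2 ^ k)) ^ (d - 1)) := by
      gcongr
      refine h3.trans ?_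
      gcongr
    _ = _ := by rw [mul_pow, mul_pow 3]; ring

set_option maxHeartbeats 1000000 in
theorem exists_norm_sum_scales_sq_le (hd : 4 ≤ d) (ha : IsDistFn a) :
    ∃ C : ℝ, 0 < C ∧ ∀ (v : ℕ × (Fin d → ℤ) → H) (C₀ : ℝ), 0 ≤ C₀ → WaveAlmostOrtho a C₀ v →
      ∀ (m : ℕ) (u : ℝ) (J : Finset ℕ) (E : ℕ → Finset (ℕ × (Fin d → ℤ))), 0 ≤ u →
      u * (invSqrtTwo ^ m) ^ (d - 1) ≤ 1 →
      (∀ j, ∀ e ∈ E j, (2:ℝ) ^ j ≤ e.1 ∧ (e.1:ℝ) < 2 ^ (j + 1)) →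
      (∀ j, ∀ l ≤ j, ∀ Q, (((E j).filter (cell l · = Q)).card : ℝ) ≤ u * 2 ^ l) →
        ‖∑ j ∈ J, ((((√2) ^ j) ^ (d - 1) : ℝ) : ℂ) • ∑ e ∈ E j, v e‖ ^ 2 ≤
          C * C₀ * (1 + m) * 2 ^ m * ∑ j ∈ J, (2:ℝ) ^ (j * (d - 1)) * (E j).card := by
  obtain ⟨C₁, hC₁, h₁⟩ := exists_norm_sum_sq_le_sparse (H := H) hd ha
  obtain ⟨C₂, hC₂, h₂⟩ := exists_sum_inner_cross_le (H := H) hd ha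
  set q := invSqrtTwo ^ (d - 3) with hq
  have hq0 : 0 < q := pow_pos invSqrtTwo_pos _
  have hq1 : q < 1 := invSqrtTwo_pow_lt_one hd
  have hq1' : 0 < 1 - q := sub_pos.2 hq1
  have hσ := invSqrtTwo_pos
  refine ⟨8 * C₁ + 4 * C₂ / (1 - q), by positivity, fun v C₀ hC₀ hv m u J E hu hum hE hsp => ?_⟩
  set c : ℕ → ℝ := fun j => ((√2) ^ j) ^ (d - 1) with hc
  have hc0 : ∀ j, 0 < c j := fun j => by positivity
  set V : ℕ → H := fun j => ((c j : ℝ) : ℂ) • ∑ e ∈ E j, v e with hV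
  set w : ℕ → ℝ := fun j => (2:ℝ) ^ (j * (d - 1)) * (E j).card with hw
  have hw0 : ∀ j, 0 ≤ w j := fun j => by positivity
  have hc2 : ∀ j, c j ^ 2 = (2:ℝ) ^ (j * (d - 1)) := fun j => by
    rw [hc]; simp only
    rw [← pow_mul, ← pow_mul, ← mul_assoc, mul_comm (j * (d - 1)) 2, pow_mul √2, Real.sq_sqrt (by norm_num)]
  have hcσ : ∀ j, c j * (invSqrtTwo ^ j) ^ (d - 1) = 1 := fun j => by
    rw [hc]; simp only
    rw [← mul_pow, ← mul_pow, invSqrtTwo, mul_inv_cancel₀ (by positivity), one_pow, one_pow]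
  have hVn : ∀ j, ‖V j‖ ^ 2 ≤ C₁ * C₀ * 2 ^ m * w j := fun j => by
    rw [hV]; simp only
    rw [norm_smul, mul_pow, Complex.norm_real, Real.norm_eq_abs, sq_abs, hc2]
    have := h₁ v C₀ hC₀ hv m j u (E j) hu hum (hE j) (hsp j)
    calc _ ≤ 2 ^ (j * (d - 1)) * (C₁ * C₀ * 2 ^ m * (E j).card) := by gcongr
      _ = _ := by rw [hw]; ring
  have hcross : ∀ j k, k + 2 ≤ j → ‖inner ℂ (V j) (V k)‖ ≤ C₂ * C₀ * u * q ^ k * w j := by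
    intro j k hkj
    have h3 : ‖inner ℂ (V j) (V k)‖ ≤ c j * c k *
        ∑ e ∈ E j, ∑ e' ∈ E k, ‖inner ℂ (v e) (v e')‖ := by
      rw [hV]; simp only
      rw [inner_smul_left, inner_smul_right, norm_mul, norm_mul, RCLike.norm_conj,
        Complex.norm_real, Complex.norm_real, Real.norm_eq_abs, Real.norm_eq_abs,
        abs_of_pos (hc0 j), abs_of_pos (hc0 k), ← mul_assoc]
      gcongr
      rw [sum_inner]
      refine (norm_sum_le _ _).trans (Finset.sum_le_sum fun i _ => ?_)
      rw [inner_sum]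
      exact norm_sum_le _ _
    refine h3.trans ?_
    have h4 : ∑ e ∈ E j, ∑ e' ∈ E k, ‖inner ℂ (v e) (v e')‖ ≤ (E j).card *
        (C₂ * C₀ * u * (invSqrtTwo ^ j) ^ (d - 1) * 2 ^ k * (2 ^ j / 2 ^ k) ^ (d - 1)) := by
      rw [← nsmul_eq_mul, ← Finset.sum_const]
      exact Finset.sum_le_sum fun e he => h₂ v C₀ hC₀ hv j k u (E k) hu hkj
        (fun e' he' => (hE k e' he').2) (hsp k k le_rfl) e (hE j e he).1 (hE j e he).2
    have h5 : c k * (2 ^ k * (2 ^ j / 2 ^ k) ^ (d - 1)) = 2 ^ (j * (d - 1)) * q ^ k := by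
      have h6 : q ^ k = (invSqrtTwo ^ k) ^ (d - 1) * 2 ^ k := by
        rw [hq, ← two_mul_invSqrtTwo_pow hd, mul_pow, ← pow_mul, ← pow_mul, mul_comm k]; ring
      have h7 : ((2:ℝ) ^ k) ^ (d - 1) * (invSqrtTwo ^ k) ^ (d - 1) = c k := by
        have h8 : ((2:ℝ) ^ k) ^ (d - 1) = c k ^ 2 := by rw [hc2, pow_mul]
        rw [h8, pow_two, mul_assoc, hcσ, mul_one]
      rw [div_pow, h6, ← h7, pow_mul]
      field_simp
    calc _ ≤ c j * c k * ((E j).card *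
        (C₂ * C₀ * u * (invSqrtTwo ^ j) ^ (d - 1) * 2 ^ k * (2 ^ j / 2 ^ k) ^ (d - 1))) :=
          mul_le_mul_of_nonneg_left h4 (by have := hc0 j; have := hc0 k; positivity)
      _ = (c j * (invSqrtTwo ^ j) ^ (d - 1)) * (c k * (2 ^ k * (2 ^ j / 2 ^ k) ^ (d - 1))) *
          (C₂ * C₀ * u * (E j).card) := by ring
      _ = _ := by rw [hcσ, h5, hw]; ring
  have huq : u * q ^ m ≤ 2 ^ m := by
    have h8 : q ^ m = (invSqrtTwo ^ m) ^ (d - 1) * 2 ^ m := by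
      rw [hq, ← two_mul_invSqrtTwo_pow hd, mul_pow, ← pow_mul, ← pow_mul, mul_comm m]; ring
    rw [h8, ← mul_assoc]
    exact mul_le_of_le_one_left (by positivity) hum
  clear_value V w
  set W := ∑ j ∈ J, w j with hW
  have hsub : ∀ J' ⊆ J, ∑ j ∈ J', w j ≤ W := fun J' h =>
    Finset.sum_le_sum_of_subset_of_nonneg h fun j _ _ => hw0 j
  have hW0 : 0 ≤ W := Finset.sum_nonneg fun j _ => hw0 j
  have hVsum : ∀ J' ⊆ J, ∑ j ∈ J', ‖V j‖ ^ 2 ≤ C₁ * C₀ * 2 ^ m * W := fun J' h => by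
    refine (Finset.sum_le_sum fun j _ => hVn j).trans ?_
    rw [← Finset.mul_sum]
    gcongr
    exact hsub J' h
  set J₁ := J.filter (· ≤ m)
  set J₂ := J.filter (¬ · ≤ m)
  have hlow : ‖∑ j ∈ J₁, V j‖ ^ 2 ≤ (1 + m) * (C₁ * C₀ * 2 ^ m * W) := by
    have h3 : (J₁.card : ℝ) ≤ 1 + m := by
      have : J₁ ⊆ Finset.range (m + 1) := fun j hj =>
        Finset.mem_range.2 (Nat.lt_succ_of_le (Finset.mem_filter.1 hj).2)
      have := Finset.card_le_card this
      rw [Finset.card_range] at this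
      rw [add_comm]
      exact_mod_cast this
    calc ‖∑ j ∈ J₁, V j‖ ^ 2 ≤ (∑ j ∈ J₁, ‖V j‖) ^ 2 := by gcongr; exact norm_sum_le _ _
      _ ≤ J₁.card * ∑ j ∈ J₁, ‖V j‖ ^ 2 := sq_sum_le_card_mul_sum_sq
      _ ≤ _ := by
        gcongr
        exact hVsum _ (Finset.filter_subset _ _)
  have hgeom : ∑ k ∈ J₂, q ^ k ≤ q ^ m / (1 - q) := by
    refine le_trans ?_ (geom_sum_Ico_le_of_lt_one hq0.le hq1 (m := m) (n := J₂.sup id + 1))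
    refine Finset.sum_le_sum_of_subset_of_nonneg (fun k hk => ?_) fun k _ _ => by positivity
    have h3 : k ≤ J₂.sup id := Finset.le_sup (f := id) hk
    have h4 := (Finset.mem_filter.1 hk).2
    exact Finset.mem_Ico.2 ⟨by omega, by omega⟩
  have hhigh : ‖∑ j ∈ J₂, V j‖ ^ 2 ≤ 3 * (C₁ * C₀ * 2 ^ m * W) +
      2 * (C₂ * C₀ * u * (q ^ m / (1 - q)) * W) := by
    have h3 := norm_sum_sq_le_near_add_far J₂ id V (fun j k => j ≤ k + 1 ∧ k ≤ j + 1)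
      (fun i k h => ⟨h.2, h.1⟩) (D := 3) fun n _ => by
        have h4 := card_le_of_forall_mem_Icc (x := (n:ℝ) - 1) (L := 2)
          (T := (J₂.image id).filter fun k => n ≤ k + 1 ∧ k ≤ n + 1) (by norm_num) fun t ht => by
            obtain ⟨h5, h6⟩ := (Finset.mem_filter.1 ht).2
            have h5' : (n:ℝ) ≤ t + 1 := by exact_mod_cast h5
            have h6' : (t:ℝ) ≤ n + 1 := by exact_mod_cast h6
            constructor <;> linarith
        linarith
    refine h3.trans (add_le_add ?_ ?_)
    · gcongr
      refine le_trans (le_of_eq ?_) (hVsum J₂ (Finset.filter_subset _ _))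
      rw [Finset.image_id]
      refine Finset.sum_congr rfl fun n hn => ?_
      simp only [id, Finset.filter_eq', hn, if_true, Finset.sum_singleton]
    · have h4 : ∀ j ∈ J₂, ∀ k ∈ J₂.filter (fun k => ¬ (id j ≤ id k + 1 ∧ id k ≤ id j + 1)),
          ‖inner ℂ (V j) (V k)‖ ≤ C₂ * C₀ * u * q ^ k * w j + C₂ * C₀ * u * q ^ j * w k := by
        intro j _ k hk
        have h5 := (Finset.mem_filter.1 hk).2
        change ¬ (j ≤ k + 1 ∧ k ≤ j + 1) at h5
        have h6 : 0 ≤ C₂ * C₀ * u * q ^ k * w j := mul_nonneg (by positivity) (hw0 j)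
        have h7 : 0 ≤ C₂ * C₀ * u * q ^ j * w k := mul_nonneg (by positivity) (hw0 k)
        rcases (by omega : k + 2 ≤ j ∨ j + 2 ≤ k) with h | h
        · linarith [hcross j k h]
        · rw [norm_inner_symm]; linarith [hcross k j h]
      have h8 : ∑ j ∈ J₂, ∑ k ∈ J₂, C₂ * C₀ * u * q ^ k * w j ≤
          C₂ * C₀ * u * (q ^ m / (1 - q)) * W := by
        have h9 := hsub J₂ (Finset.filter_subset _ _)
        have h10 : 0 ≤ ∑ j ∈ J₂, w j := Finset.sum_nonneg fun j _ => hw0 j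
        calc _ = C₂ * C₀ * u * (∑ k ∈ J₂, q ^ k) * ∑ j ∈ J₂, w j := by
              simp_rw [← Finset.sum_mul, ← Finset.mul_sum]
          _ ≤ C₂ * C₀ * u * (q ^ m / (1 - q)) * W :=
              mul_le_mul (mul_le_mul_of_nonneg_left hgeom (by positivity)) h9 h10
                (mul_nonneg (by positivity) (div_nonneg (pow_nonneg hq0.le m) hq1'.le))
      calc _ ≤ ∑ j ∈ J₂, ∑ k ∈ J₂, (C₂ * C₀ * u * q ^ k * w j + C₂ * C₀ * u * q ^ j * w k) := by
            refine Finset.sum_le_sum fun j hj => (Finset.sum_le_sum (h4 j hj)).trans ?_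
            refine Finset.sum_le_sum_of_subset_of_nonneg (Finset.filter_subset _ _) fun k _ _ => ?_
            exact add_nonneg (mul_nonneg (by positivity) (hw0 j))
              (mul_nonneg (by positivity) (hw0 k))
        _ = ∑ j ∈ J₂, ∑ k ∈ J₂, C₂ * C₀ * u * q ^ k * w j +
            ∑ j ∈ J₂, ∑ k ∈ J₂, C₂ * C₀ * u * q ^ k * w j := by
          simp_rw [Finset.sum_add_distrib]
          congr 1
          exact Finset.sum_comm
        _ ≤ _ := by linarith
  have hsplit : ∑ j ∈ J, V j = ∑ j ∈ J₁, V j + ∑ j ∈ J₂, V j :=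
    (Finset.sum_filter_add_sum_filter_not J (· ≤ m) V).symm
  rw [hsplit]
  have h9 : ‖∑ j ∈ J₁, V j + ∑ j ∈ J₂, V j‖ ^ 2 ≤
      2 * (‖∑ j ∈ J₁, V j‖ ^ 2 + ‖∑ j ∈ J₂, V j‖ ^ 2) := by
    calc _ ≤ (‖∑ j ∈ J₁, V j‖ + ‖∑ j ∈ J₂, V j‖) ^ 2 := by gcongr; exact norm_add_le _ _
      _ ≤ _ := by nlinarith [sq_nonneg (‖∑ j ∈ J₁, V j‖ - ‖∑ j ∈ J₂, V j‖)]
  have h10 : C₂ * C₀ * u * (q ^ m / (1 - q)) * W ≤ C₂ / (1 - q) * C₀ * 2 ^ m * W := by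
    calc _ = C₂ / (1 - q) * C₀ * (u * q ^ m) * W := by ring
      _ ≤ _ := by gcongr
  have hA : 0 ≤ C₁ * C₀ * 2 ^ m * W := by positivity
  have hB : 0 ≤ C₂ / (1 - q) * C₀ * 2 ^ m * W := by positivity
  have hm0 : (0:ℝ) ≤ m := Nat.cast_nonneg m
  have hAm := mul_nonneg hA hm0
  have hBm := mul_nonneg hB hm0
  calc _ ≤ _ := h9
    _ ≤ 2 * ((1 + m) * (C₁ * C₀ * 2 ^ m * W) + (3 * (C₁ * C₀ * 2 ^ m * W) +
        2 * (C₂ / (1 - q) * C₀ * 2 ^ m * W))) := by linarith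
    _ ≤ 8 * ((1 + m) * (C₁ * C₀ * 2 ^ m * W)) +
        4 * ((1 + m) * (C₂ / (1 - q) * C₀ * 2 ^ m * W)) := by linarith
    _ = _ := by ring

end almostOrthogonal

theorem exists_nat_scale {d : ℕ} (hd : 4 ≤ d) {p : ℝ} (hp1 : 1 < p)
    (hp2 : p < 2 * ((d : ℝ) - 1) / ((d : ℝ) + 1)) :
    ∃ C : ℝ, 0 < C ∧ ∀ lam : ℝ, 1 ≤ lam → ∃ m : ℕ,
      lam ^ p * (invSqrtTwo ^ m) ^ (d - 1) ≤ 1 ∧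
        (1 + m) * 2 ^ m / lam ^ 2 ≤ C * lam ^ (-p) := by
  have hd' : (4:ℝ) ≤ d := by exact_mod_cast hd
  have hd1 : (0:ℝ) < d - 1 := by linarith
  set s := 2 * p / (d - 1) with hs
  have hs0 : 0 < s := by positivity
  have hps : p + s < 2 := by
    rw [lt_div_iff₀ (by linarith)] at hp2
    rw [hs, ← lt_sub_iff_add_lt', div_lt_iff₀ hd1]
    linarith
  set δ := 2 - p - s with hδ
  have hδ0 : 0 < δ := by linarith
  have hl2 : 0 < Real.log 2 := Real.log_pos one_lt_two
  refine ⟨2 * (2 + s / (δ * Real.log 2)), by positivity, fun lam hlam => ?_⟩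
  have hlam0 : 0 < lam := by linarith
  have hls : 1 ≤ lam ^ s := Real.one_le_rpow hlam hs0.le
  set y := Real.logb 2 (lam ^ s) with hy
  have hy0 : 0 ≤ y := Real.logb_nonneg one_lt_two hls
  have h2y : (2:ℝ) ^ y = lam ^ s := Real.rpow_logb two_pos (by norm_num) (by linarith)
  refine ⟨⌈y⌉₊, ?_, ?_⟩
  · have h1 : lam ^ s ≤ 2 ^ ⌈y⌉₊ := by
      rw [← h2y, ← Real.rpow_natCast]
      exact Real.rpow_le_rpow_of_exponent_le one_le_two (Nat.le_ceil y)
    have h2 : lam ^ p * (invSqrtTwo ^ ⌈y⌉₊) ^ (d - 1) =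
        √((lam ^ s) ^ (d - 1) * ((2 ^ ⌈y⌉₊)⁻¹) ^ (d - 1)) := by
      have h3 : (lam ^ p) ^ 2 = (lam ^ s) ^ (d - 1) := by
        rw [← Real.rpow_mul_natCast hlam0.le, ← Real.rpow_mul_natCast hlam0.le,
          Nat.cast_sub (by omega), hs]
        congr 1
        push_cast
        field_simp
      rw [← h3, ← invSqrtTwo_pow_pow_sq, pow_right_comm (invSqrtTwo ^ ⌈y⌉₊) 2,
        ← mul_pow, Real.sqrt_sq]
      have := invSqrtTwo_pos
      positivity
    rw [h2, Real.sqrt_le_iff, one_pow, ← mul_pow]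
    refine ⟨zero_le_one, ?_⟩
    refine pow_le_one₀ (by positivity) ?_
    rw [← div_eq_mul_inv]
    exact div_le_one_of_le₀ h1 (by positivity)
  · have hc : (⌈y⌉₊ : ℝ) ≤ y + 1 := (Nat.ceil_lt_add_one hy0).le
    have h1 : (2:ℝ) ^ ⌈y⌉₊ ≤ 2 * lam ^ s := by
      rw [← h2y, ← Real.rpow_natCast, mul_comm, ← Real.rpow_add_one (by norm_num)]
      exact Real.rpow_le_rpow_of_exponent_le one_le_two hc
    have h3 : Real.log lam ≤ lam ^ δ / δ := Real.log_le_rpow_div hlam0.le hδ0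
    have h4 : y ≤ s / (δ * Real.log 2) * lam ^ δ := by
      rw [hy, Real.logb, Real.log_rpow hlam0]
      calc s * Real.log lam / Real.log 2 ≤ s * (lam ^ δ / δ) / Real.log 2 := by gcongr
        _ = _ := by field_simp
    have h5 : 1 ≤ lam ^ δ := Real.one_le_rpow hlam hδ0.le
    have h6 : 1 + (⌈y⌉₊ : ℝ) ≤ (2 + s / (δ * Real.log 2)) * lam ^ δ := by linarith
    rw [div_le_iff₀ (by positivity)]
    calc (1 + (⌈y⌉₊ : ℝ)) * 2 ^ ⌈y⌉₊
        ≤ ((2 + s / (δ * Real.log 2)) * lam ^ δ) * (2 * lam ^ s) := by gcongr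
      _ = 2 * (2 + s / (δ * Real.log 2)) * (lam ^ (δ + s)) := by
        rw [Real.rpow_add hlam0]; ring
      _ = _ := by
        rw [mul_assoc (2 * _), ← Real.rpow_natCast lam 2, ← Real.rpow_add hlam0]
        congr 2
        rw [hδ]; push_cast; ring

theorem meas_lt_norm_le_norm_Lp_sq {α : Type*} [MeasurableSpace α] {μ : Measure α}
    (g : Lp ℂ 2 μ) {F : α → ℂ} (hF : g =ᵐ[μ] F) {t : ℝ} (ht : 0 < t) :
    μ {x | t < ‖F x‖} ≤ ENNReal.ofReal (‖g‖ ^ 2 / t ^ 2) := by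
  have h1 : μ {x | ENNReal.ofReal t ≤ ‖F x‖ₑ} ≤ _ :=
    meas_ge_le_mul_pow_eLpNorm_enorm (μ := μ) (p := 2) (f := F) (by norm_num) (by norm_num)
      ((Lp.aestronglyMeasurable g).congr hF) (ENNReal.ofReal_pos.2 ht).ne'
      (fun h => (ENNReal.ofReal_ne_top h).elim)
  refine (measure_mono fun x hx => ?_).trans (h1.trans (le_of_eq ?_))
  · change t < ‖F x‖ at hx
    change ENNReal.ofReal t ≤ ‖F x‖ₑ
    rw [← ofReal_norm]
    exact ENNReal.ofReal_le_ofReal hx.le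
  · rw [← eLpNorm_congr_ae hF, ← Lp.enorm_def, ← ofReal_norm, ENNReal.toReal_ofNat,
      div_eq_inv_mul, ENNReal.ofReal_mul (by positivity), ENNReal.ofReal_inv_of_pos (by positivity),
      ENNReal.ofReal_pow ht.le, ENNReal.ofReal_pow (norm_nonneg _)]
    rw [ENNReal.inv_rpow, ENNReal.rpow_ofNat, ENNReal.rpow_ofNat]

section
variable {d : ℕ} {a : Rd d → ℝ} {χ : ℝ → ℝ}

theorem exists_waveAlmostOrtho_toLp (hd : 1 ≤ d) (ha : IsDistFn a) (hcurv : CurvNondeg a)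
    (hχs : ContDiff ℝ (⊤ : ℕ∞) χ) (hχ : ∀ x, x ∉ Icc (1/8 : ℝ) 8 → χ x = 0) :
    ∃ C : ℝ, 0 < C ∧ ∀ (b : ℕ × (Fin d → ℤ) → Rd d → ℂ) (hb : ∀ e, IsNormalized e.2 (b e)),
      WaveAlmostOrtho a C fun e =>
        (memLp_conv hd ha hcurv hχs hχ (e.1 : ℝ) (hb e)).toLp (conv (Kker a χ e.1) (b e)) := by
  obtain ⟨C, hC, h⟩ := exists_integral_conj_conv_le hd ha hcurv hχs hχ (d + 1)
  refine ⟨C, hC, fun b hb e e' ε hε h1 => ?_⟩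
  set ε₀ := √((1 + |(e'.1:ℝ) - e.1|)⁻¹) with hε₀
  have hr : 0 < 1 + |(e'.1:ℝ) - e.1| := by positivity
  have hε₀0 : 0 < ε₀ := Real.sqrt_pos.2 (inv_pos.2 hr)
  have hle : ε₀ ≤ ε := by
    refine Real.sqrt_le_iff.2 ⟨hε.le, ?_⟩
    rwa [inv_eq_one_div, div_le_iff₀ hr]
  have h2 := h e.1 e'.1 ε₀ hε₀0 (by
    rw [hε₀, Real.sq_sqrt (by positivity), inv_mul_cancel₀ hr.ne']) e.2 e'.2 (b e) (b e')
    (hb e) (hb e')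
  rw [L2.inner_def]
  have h3 : ∫ x, inner ℂ ((memLp_conv hd ha hcurv hχs hχ (e.1 : ℝ) (hb e)).toLp
      (conv (Kker a χ e.1) (b e)) x) ((memLp_conv hd ha hcurv hχs hχ (e'.1 : ℝ) (hb e')).toLp
      (conv (Kker a χ e'.1) (b e')) x) =
      ∫ x, starRingEnd ℂ (conv (Kker a χ e.1) (b e) x) * conv (Kker a χ e'.1) (b e') x := by
    refine integral_congr_ae ?_
    filter_upwards [MemLp.coeFn_toLp (memLp_conv hd ha hcurv hχs hχ (e.1 : ℝ) (hb e)),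
      MemLp.coeFn_toLp (memLp_conv hd ha hcurv hχs hχ (e'.1 : ℝ) (hb e'))] with x hx hx'
    rw [hx, hx', RCLike.inner_apply, mul_comm]
  rw [h3]
  refine h2.trans ?_
  have := waveWeight_nonneg (a := a) (d + 1) (e'.1 - e.1) (latticeVec d e.2 - latticeVec d e'.2)
  change C * ε₀ ^ (d - 1) * waveWeight a (d + 1) _ _ ≤ _
  gcongr

theorem exists_volume_sparse_le (hd : 4 ≤ d) (ha : IsDistFn a) (hcurv : CurvNondeg a)
    (hχs : ContDiff ℝ (⊤ : ℕ∞) χ) (hχ : ∀ x, x ∉ Icc (1/8 : ℝ) 8 → χ x = 0)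
    {p : ℝ} (hp1 : 1 < p) (hp2 : p < 2 * ((d : ℝ) - 1) / ((d : ℝ) + 1)) :
    ∃ C : ℝ, 0 < C ∧ ∀ lam : ℝ, 1 ≤ lam →
      ∀ (J : Finset ℕ) (E : ℕ → Finset (ℕ × (Fin d → ℤ))),
      (∀ j, ∀ e ∈ E j, (2:ℝ) ^ j ≤ e.1 ∧ (e.1:ℝ) < 2 ^ (j + 1)) →
      (∀ j, ∀ l ≤ j, ∀ Q, (((E j).filter (cell l · = Q)).card : ℝ) ≤ lam ^ p * 2 ^ l) →
      ∀ b : ℕ × (Fin d → ℤ) → Rd d → ℂ, (∀ e, IsNormalized e.2 (b e)) →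
      volume {x : Rd d | lam / 2 <
          ‖∑ j ∈ J, ((((√2) ^ j) ^ (d - 1) : ℝ) : ℂ) *
            ∑ e ∈ E j, conv (Kker a χ (e.1 : ℝ)) (b e) x‖} ≤
        ENNReal.ofReal (C * lam ^ (-p) * ∑ j ∈ J, (2:ℝ) ^ (j * (d - 1)) * (E j).card) := by
  have hd1 : 1 ≤ d := by omega
  obtain ⟨C₀, hC₀, hortho⟩ := exists_waveAlmostOrtho_toLp hd1 ha hcurv hχs hχ
  obtain ⟨C₁, hC₁, hL2⟩ := exists_norm_sum_scales_sq_le (H := Lp ℂ 2 (volume : Measure (Rd d))) hd ha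
  obtain ⟨C₂, hC₂, hscale⟩ := exists_nat_scale hd hp1 hp2
  refine ⟨4 * C₁ * C₀ * C₂, by positivity, fun lam hlam J E hE hsp b hb => ?_⟩
  obtain ⟨m, hm1, hm2⟩ := hscale lam hlam
  set v : ℕ × (Fin d → ℤ) → Lp ℂ 2 (volume : Measure (Rd d)) := fun e =>
    (memLp_conv hd1 ha hcurv hχs hχ (e.1 : ℝ) (hb e)).toLp (conv (Kker a χ e.1) (b e)) with hv
  have h1 := hL2 v C₀ hC₀.le (hortho b hb) m (lam ^ p) J E (by positivity) hm1 hE hsp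
  have hcoe : ⇑(∑ j ∈ J, ((((√2) ^ j) ^ (d - 1) : ℝ) : ℂ) • ∑ e ∈ E j, v e) =ᵐ[volume]
      fun x => ∑ j ∈ J, ((((√2) ^ j) ^ (d - 1) : ℝ) : ℂ) *
            ∑ e ∈ E j, conv (Kker a χ (e.1 : ℝ)) (b e) x := by
    have h2 : ∀ᵐ x : Rd d, ∀ j, ((((((√2) ^ j) ^ (d - 1) : ℝ) : ℂ) • ∑ e ∈ E j, v e :
        Lp ℂ 2 (volume : Measure (Rd d))) : Rd d → ℂ) x =
        ((((√2) ^ j) ^ (d - 1) : ℝ) : ℂ) * (∑ e ∈ E j, v e : Lp ℂ 2 (volume : Measure (Rd d))) x :=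
      ae_all_iff.2 fun j => Lp.coeFn_smul _ _
    have h3 : ∀ᵐ x : Rd d, ∀ j, (∑ e ∈ E j, v e : Lp ℂ 2 (volume : Measure (Rd d))) x =
        ∑ e ∈ E j, v e x := ae_all_iff.2 fun j => Lp.coeFn_fun_finsetSum _ _
    have h4 : ∀ᵐ x : Rd d, ∀ e, v e x = conv (Kker a χ (e.1 : ℝ)) (b e) x :=
      ae_all_iff.2 fun e => MemLp.coeFn_toLp _
    filter_upwards [Lp.coeFn_fun_finsetSum J fun j =>
      ((((√2) ^ j) ^ (d - 1) : ℝ) : ℂ) • ∑ e ∈ E j, v e, h2, h3, h4] with x hx1 hx2 hx3 hx4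
    rw [hx1]
    refine Finset.sum_congr rfl fun j _ => ?_
    rw [hx2, hx3]
    simp_rw [hx4]
  refine (meas_lt_norm_le_norm_Lp_sq _ hcoe (by linarith : 0 < lam / 2)).trans
    (ENNReal.ofReal_le_ofReal ?_)
  clear hcoe
  set W := ∑ j ∈ J, (2:ℝ) ^ (j * (d - 1)) * (E j).card
  have hW : 0 ≤ W := Finset.sum_nonneg fun j _ => by positivity
  clear_value W
  generalize ‖∑ j ∈ J, ((((√2) ^ j) ^ (d - 1) : ℝ) : ℂ) • ∑ e ∈ E j, v e‖ = X at h1 ⊢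
  calc X ^ 2 / (lam / 2) ^ 2 ≤ C₁ * C₀ * (1 + m) * 2 ^ m * W / (lam / 2) ^ 2 :=
        div_le_div_of_nonneg_right h1 (by positivity)
    _ = 4 * C₁ * C₀ * W * ((1 + m) * 2 ^ m / lam ^ 2) := by ring
    _ ≤ 4 * C₁ * C₀ * W * (C₂ * lam ^ (-p)) :=
        mul_le_mul_of_nonneg_left hm2 (by positivity)
    _ = _ := by ring

end

section
variable {d : ℕ} {a : Rd d → ℝ} {χ : ℝ → ℝ}

theorem exists_norm_conv_le_mul_waveWeight (hd : 1 ≤ d) (ha : IsDistFn a) (hcurv : CurvNondeg a)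
    (hχs : ContDiff ℝ (⊤ : ℕ∞) χ) (hχ : ∀ x, x ∉ Icc (1/8 : ℝ) 8 → χ x = 0) :
    ∃ C : ℝ, 0 < C ∧ ∀ (r : ℝ) (z : Fin d → ℤ) (b : Rd d → ℂ), IsNormalized z b →
      ∀ (θ : ℝ) (x : Rd d), 1 ≤ θ * (1 + Metric.infDist (x - latticeVec d z) (waveSet a r)) ^ d →
        ‖conv (Kker a χ r) b x‖ ≤ C * θ * (√(1 + |r|))⁻¹ ^ (d - 1) *
          waveWeight a (d + 1) r (x - latticeVec d z) := by
  obtain ⟨C, hC, h⟩ := exists_conv_decay hd ha hcurv hχs hχ (d + (d + 1))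
  refine ⟨C, hC, fun r z b hb θ x hθ => ?_⟩
  have hr : 0 < 1 + |r| := by positivity
  refine (h r (√(1 + |r|))⁻¹ (by positivity) (by
    rw [inv_pow, Real.sq_sqrt hr.le, inv_mul_cancel₀ hr.ne']) z b hb x).trans ?_
  set D := 1 + Metric.infDist (x - latticeVec d z) (waveSet a r) with hD
  have hD0 : 0 < D := by
    have : 0 ≤ Metric.infDist (x - latticeVec d z) (waveSet a r) := Metric.infDist_nonneg
    positivity
  have h1 : (D ^ (d + (d + 1)))⁻¹ ≤ θ * (D ^ (d + 1))⁻¹ := by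
    rw [pow_add, mul_inv]
    gcongr
    rw [inv_eq_one_div, div_le_iff₀ (by positivity)]
    exact hθ
  calc _ ≤ C * (√(1 + |r|))⁻¹ ^ (d - 1) * (θ * (D ^ (d + 1))⁻¹) := by gcongr
    _ = C * θ * (√(1 + |r|))⁻¹ ^ (d - 1) * (D ^ (d + 1))⁻¹ := by ring

theorem exists_lintegral_sqrt_waveWeight_le (hd : 1 ≤ d) (ha : IsDistFn a) :
    ∃ C : ℝ, 0 < C ∧ ∀ (j n : ℕ) (z : Fin d → ℤ) (B : ℝ), (n:ℝ) < 2 ^ (j + 1) → 0 ≤ B →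
      ∫⁻ x : Rd d, ENNReal.ofReal (((√2) ^ j) ^ (d - 1) * (B * (√(1 + |(n:ℝ)|))⁻¹ ^ (d - 1) *
        waveWeight a (d + 1) n (x - latticeVec d z))) ≤
          ENNReal.ofReal (C * B * 2 ^ (j * (d - 1))) := by
  obtain ⟨C, hC, h⟩ := exists_lintegral_waveWeight_le hd ha
  refine ⟨2 ^ (d - 1) * C, by positivity, fun j n z B hn hB => ?_⟩
  have hn0 : |(n:ℝ)| = n := abs_of_nonneg (Nat.cast_nonneg _)
  set A := ((√2) ^ j) ^ (d - 1) * (B * (√(1 + |(n:ℝ)|))⁻¹ ^ (d - 1)) with hA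
  have hA0 : 0 ≤ A := by positivity
  calc _ = ∫⁻ x : Rd d, ENNReal.ofReal A *
        ENNReal.ofReal (waveWeight a (d + 1) n (x - latticeVec d z)) := by
        congr 1 with x
        rw [← mul_assoc, ENNReal.ofReal_mul hA0]
    _ = ENNReal.ofReal A * ∫⁻ x : Rd d,
        ENNReal.ofReal (waveWeight a (d + 1) n (x - latticeVec d z)) :=
      lintegral_const_mul' _ _ ENNReal.ofReal_ne_top
    _ = ENNReal.ofReal A * ∫⁻ x : Rd d, ENNReal.ofReal (waveWeight a (d + 1) n x) := by
      rw [lintegral_sub_right_eq_self (fun x => ENNReal.ofReal (waveWeight a (d + 1) n x))]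
    _ ≤ ENNReal.ofReal A * ENNReal.ofReal (C * (1 + |(n:ℝ)|) ^ (d - 1)) := by
      gcongr
      exact h n
    _ = ENNReal.ofReal (A * (C * (1 + |(n:ℝ)|) ^ (d - 1))) := (ENNReal.ofReal_mul hA0).symm
    _ ≤ _ := by
      refine ENNReal.ofReal_le_ofReal ?_
      set s := √(1 + |(n:ℝ)|) with hs
      have hs2 : s ^ 2 = 1 + |(n:ℝ)| := Real.sq_sqrt (by positivity)
      have hs0 : 0 < s := Real.sqrt_pos.2 (by positivity)
      have hsj : s ≤ 2 * √2 ^ j := by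
        rw [hs]
        refine Real.sqrt_le_iff.2 ⟨by positivity, ?_⟩
        rw [mul_pow, ← pow_mul, mul_comm j, pow_mul, Real.sq_sqrt (by norm_num), hn0]
        have : (1:ℝ) ≤ 2 ^ j := one_le_pow₀ one_le_two
        rw [pow_succ] at hn
        linarith
      have h2 : √2 ^ j * √2 ^ j = 2 ^ j := by
        rw [← mul_pow, Real.mul_self_sqrt (by norm_num)]
      calc A * (C * (1 + |(n:ℝ)|) ^ (d - 1))
          = B * C * (√2 ^ j * (s⁻¹ * s ^ 2)) ^ (d - 1) := by
            rw [hA, ← hs2, mul_pow (√2 ^ j), mul_pow s⁻¹]; ring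
        _ = B * C * (√2 ^ j * s) ^ (d - 1) := by
            congr 3; field_simp
        _ ≤ B * C * (√2 ^ j * (2 * √2 ^ j)) ^ (d - 1) := by gcongr
        _ = _ := by
          rw [show √2 ^ j * (2 * √2 ^ j) = 2 * (√2 ^ j * √2 ^ j) by ring, h2, mul_pow, pow_mul]
          ring

theorem exists_volume_off_wave_le (hd : 1 ≤ d) (ha : IsDistFn a) (hcurv : CurvNondeg a)
    (hχs : ContDiff ℝ (⊤ : ℕ∞) χ) (hχ : ∀ x, x ∉ Icc (1/8 : ℝ) 8 → χ x = 0) :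
    ∃ C : ℝ, 0 < C ∧ ∀ (t θ : ℝ) (S : Set (Rd d)), 0 < t → 0 ≤ θ →
      ∀ (J : Finset ℕ) (E : ℕ → Finset (ℕ × (Fin d → ℤ))),
      (∀ j, ∀ e ∈ E j, (e.1:ℝ) < 2 ^ (j + 1)) →
      (∀ j ∈ J, ∀ e ∈ E j, ∀ x ∈ S,
        1 ≤ θ * (1 + Metric.infDist (x - latticeVec d e.2) (waveSet a e.1)) ^ d) →
      ∀ b : ℕ × (Fin d → ℤ) → Rd d → ℂ, (∀ e, IsNormalized e.2 (b e)) →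
      volume {x : Rd d | x ∈ S ∧ t <
          ‖∑ j ∈ J, ((((√2) ^ j) ^ (d - 1) : ℝ) : ℂ) *
            ∑ e ∈ E j, conv (Kker a χ (e.1 : ℝ)) (b e) x‖} ≤
        ENNReal.ofReal (C * θ / t * ∑ j ∈ J, (2:ℝ) ^ (j * (d - 1)) * (E j).card) := by
  obtain ⟨C₁, hC₁, h₁⟩ := exists_norm_conv_le_mul_waveWeight hd ha hcurv hχs hχ
  obtain ⟨C₂, hC₂, h₂⟩ := exists_lintegral_sqrt_waveWeight_le hd ha
  refine ⟨C₂ * C₁, by positivity, fun t θ S ht hθ J E hE hS b hb => ?_⟩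
  set g : ℕ → ℕ × (Fin d → ℤ) → Rd d → ℝ := fun j e x => ((√2) ^ j) ^ (d - 1) *
    (C₁ * θ * (√(1 + |(e.1:ℝ)|))⁻¹ ^ (d - 1) *
      waveWeight a (d + 1) e.1 (x - latticeVec d e.2)) with hg
  have hg0 : ∀ j e x, 0 ≤ g j e x := fun j e x => by
    have := waveWeight_nonneg (a := a) (d + 1) e.1 (x - latticeVec d e.2)
    positivity
  have hgc : ∀ j e, Continuous (g j e) := fun j e => by
    have := (continuous_waveWeight (a := a) (d + 1) (e.1:ℝ)).comp
      (continuous_id.sub (continuous_const (y := latticeVec d e.2)))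
    exact continuous_const.mul (continuous_const.mul this)
  have hle : ∀ x ∈ S, ‖∑ j ∈ J, ((((√2) ^ j) ^ (d - 1) : ℝ) : ℂ) *
      ∑ e ∈ E j, conv (Kker a χ (e.1 : ℝ)) (b e) x‖ ≤ ∑ j ∈ J, ∑ e ∈ E j, g j e x := by
    intro x hx
    refine (norm_sum_le _ _).trans (Finset.sum_le_sum fun j hj => ?_)
    rw [norm_mul, Complex.norm_real, Real.norm_of_nonneg (by positivity), hg]
    simp only
    rw [← Finset.mul_sum]
    refine mul_le_mul_of_nonneg_left ((norm_sum_le _ _).trans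
      (Finset.sum_le_sum fun e he => ?_)) (by positivity)
    exact h₁ e.1 e.2 (b e) (hb e) θ x (hS j hj e he x hx)
  have hmeas : Measurable fun x => ENNReal.ofReal (∑ j ∈ J, ∑ e ∈ E j, g j e x) :=
    (continuous_finsetSum _ fun j _ => continuous_finsetSum _ fun e _ =>
      hgc j e).measurable.ennreal_ofReal
  calc _ ≤ volume {x | ENNReal.ofReal t ≤ ENNReal.ofReal (∑ j ∈ J, ∑ e ∈ E j, g j e x)} :=
        measure_mono fun x hx => ENNReal.ofReal_le_ofReal (hx.2.le.trans (hle x hx.1))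
    _ ≤ (∫⁻ x, ENNReal.ofReal (∑ j ∈ J, ∑ e ∈ E j, g j e x)) / ENNReal.ofReal t :=
      meas_ge_le_lintegral_div hmeas.aemeasurable (ENNReal.ofReal_pos.2 ht).ne'
        ENNReal.ofReal_ne_top
    _ ≤ ENNReal.ofReal (∑ j ∈ J, ∑ e ∈ E j, C₂ * (C₁ * θ) * 2 ^ (j * (d - 1))) /
        ENNReal.ofReal t := by
      gcongr
      rw [ENNReal.ofReal_sum_of_nonneg fun j _ => Finset.sum_nonneg fun e _ => by positivity]
      have h3 : ∀ x, ENNReal.ofReal (∑ j ∈ J, ∑ e ∈ E j, g j e x) =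
          ∑ j ∈ J, ∑ e ∈ E j, ENNReal.ofReal (g j e x) := fun x => by
        rw [ENNReal.ofReal_sum_of_nonneg fun j _ => Finset.sum_nonneg fun e _ => hg0 j e x]
        exact Finset.sum_congr rfl fun j _ => ENNReal.ofReal_sum_of_nonneg fun e _ => hg0 j e x
      simp_rw [h3]
      rw [lintegral_finsetSum _ fun j _ => Finset.measurable_sum _ fun e _ =>
        (hgc j e).measurable.ennreal_ofReal]
      refine Finset.sum_le_sum fun j _ => ?_
      rw [lintegral_finsetSum _ fun e _ => (hgc j e).measurable.ennreal_ofReal,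
        ENNReal.ofReal_sum_of_nonneg fun e _ => by positivity]
      exact Finset.sum_le_sum fun e he => h₂ j e.1 e.2 (C₁ * θ) (hE j e he) (by positivity)
    _ = _ := by
      rw [← ENNReal.ofReal_div_of_pos ht]
      congr 1
      simp_rw [Finset.sum_const, nsmul_eq_mul]
      rw [Finset.mul_sum, Finset.sum_div]
      exact Finset.sum_congr rfl fun j _ => by ring

end

section
variable {d : ℕ} {a : Rd d → ℝ} {χ : ℝ → ℝ}

theorem cell_eq_of_le {l l' : ℕ} (h : l ≤ l') {e e' : ℕ × (Fin d → ℤ)}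
    (he : cell l e = cell l e') : cell l' e = cell l' e' := by
  obtain ⟨k, rfl⟩ := Nat.exists_eq_add_of_le h
  have h1 : ∀ e : ℕ × (Fin d → ℤ), cell (l + k) e = cell k (cell l e) := fun e => by
    unfold cell
    refine Prod.ext ?_ (funext fun i => ?_)
    · simp only [pow_add, Nat.div_div_eq_div_mul]
    · simp only [pow_add]
      rw [Int.ediv_ediv_of_nonneg (by positivity)]
  rw [h1, h1, he]

/-- The cell of `e` of side `2^l` contains more than `u 2^l` points of `E`. -/
def IsDenseAt (E : Finset (ℕ × (Fin d → ℤ))) (u : ℝ) (l : ℕ) (e : ℕ × (Fin d → ℤ)) : Prop :=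
  u * 2 ^ l < ((E.filter (cell l · = cell l e)).card : ℝ)

/-- The points of `E` that lie in some dense cell of side at most `2^j`. -/
def densePart (E : Finset (ℕ × (Fin d → ℤ))) (u : ℝ) (j : ℕ) : Finset (ℕ × (Fin d → ℤ)) :=
  E.filter fun e => ∃ l ≤ j, IsDenseAt E u l e

/-- The points of `E` that lie in no dense cell of side at most `2^j`. -/
def sparsePart (E : Finset (ℕ × (Fin d → ℤ))) (u : ℝ) (j : ℕ) : Finset (ℕ × (Fin d → ℤ)) :=
  E.filter fun e => ¬ ∃ l ≤ j, IsDenseAt E u l e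

/-- The scale of the largest dense cell containing `e`. -/
def denseLevel (E : Finset (ℕ × (Fin d → ℤ))) (u : ℝ) (j : ℕ) (e : ℕ × (Fin d → ℤ)) : ℕ :=
  Nat.findGreatest (fun l => IsDenseAt E u l e) j

theorem card_sparsePart_filter_le {E : Finset (ℕ × (Fin d → ℤ))} {u : ℝ} (hu : 0 ≤ u) {j l : ℕ}
    (hl : l ≤ j) (Q : ℕ × (Fin d → ℤ)) :
    (((sparsePart E u j).filter (cell l · = Q)).card : ℝ) ≤ u * 2 ^ l := by
  rcases ((sparsePart E u j).filter (cell l · = Q)).eq_empty_or_nonempty with h | ⟨e, he⟩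
  · rw [h, Finset.card_empty, Nat.cast_zero]; positivity
  · obtain ⟨he1, he2⟩ := Finset.mem_filter.1 he
    have h1 := (Finset.mem_filter.1 he1).2
    push Not at h1
    have h2 := not_lt.1 (h1 l hl)
    refine le_trans ?_ h2
    rw [he2]
    exact_mod_cast Finset.card_le_card (Finset.filter_subset_filter _ (Finset.filter_subset _ _))

theorem isDenseAt_denseLevel {E : Finset (ℕ × (Fin d → ℤ))} {u : ℝ} {j : ℕ}
    {e : ℕ × (Fin d → ℤ)} (he : e ∈ densePart E u j) :
    denseLevel E u j e ≤ j ∧ IsDenseAt E u (denseLevel E u j e) e := by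
  obtain ⟨l, hl, h⟩ := (Finset.mem_filter.1 he).2
  exact ⟨Nat.findGreatest_le _, Nat.findGreatest_spec (P := fun l => IsDenseAt E u l e) hl h⟩

theorem isDenseAt_congr {E : Finset (ℕ × (Fin d → ℤ))} {u : ℝ} {l : ℕ}
    {e e' : ℕ × (Fin d → ℤ)} (h : cell l e = cell l e') : IsDenseAt E u l e ↔ IsDenseAt E u l e' := by
  unfold IsDenseAt
  rw [h]

theorem denseLevel_eq_of_cell_eq {E : Finset (ℕ × (Fin d → ℤ))} {u : ℝ} {j : ℕ}
    {e e' : ℕ × (Fin d → ℤ)} (he : e ∈ densePart E u j)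
    (h : cell (denseLevel E u j e) e' = cell (denseLevel E u j e) e) :
    denseLevel E u j e' = denseLevel E u j e := by
  obtain ⟨h1, h2⟩ := isDenseAt_denseLevel he
  have h3 : denseLevel E u j e ≤ denseLevel E u j e' :=
    Nat.le_findGreatest h1 ((isDenseAt_congr h).2 h2)
  refine le_antisymm ?_ h3
  have h4 : IsDenseAt E u (denseLevel E u j e') e' :=
    Nat.findGreatest_spec (P := fun l => IsDenseAt E u l e') h1 ((isDenseAt_congr h).2 h2)
  exact Nat.le_findGreatest (Nat.findGreatest_le _) ((isDenseAt_congr (cell_eq_of_le h3 h)).1 h4)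

/-- The scale and position of the largest dense cell containing `e`. -/
def denseCell (E : Finset (ℕ × (Fin d → ℤ))) (u : ℝ) (j : ℕ) (e : ℕ × (Fin d → ℤ)) :
    ℕ × ℕ × (Fin d → ℤ) :=
  (denseLevel E u j e, cell (denseLevel E u j e) e)

theorem mul_sum_image_denseCell_le (E : Finset (ℕ × (Fin d → ℤ))) (u : ℝ) (j : ℕ) :
    u * ∑ Q ∈ (densePart E u j).image (denseCell E u j), (2:ℝ) ^ Q.1 ≤ E.card := by
  have hsub : (densePart E u j).card ≤ E.card := Finset.card_le_card (Finset.filter_subset _ _)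
  refine le_trans ?_ (Nat.cast_le.2 hsub)
  rw [Finset.card_eq_sum_card_fiberwise (s := densePart E u j)
    (t := (densePart E u j).image (denseCell E u j)) (f := denseCell E u j)
    (fun e he => Finset.mem_image_of_mem _ he), Finset.mul_sum, Nat.cast_sum]
  refine Finset.sum_le_sum fun Q hQ => ?_
  obtain ⟨e, he, rfl⟩ := Finset.mem_image.1 hQ
  obtain ⟨h1, h2⟩ := isDenseAt_denseLevel he
  refine h2.le.trans (Nat.cast_le.2 (Finset.card_le_card fun e' he' => ?_))
  obtain ⟨h3, h4⟩ := Finset.mem_filter.1 he'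
  refine Finset.mem_filter.2 ⟨Finset.mem_filter.2 ⟨h3, _, h1, (isDenseAt_congr h4).2 h2⟩, ?_⟩
  unfold denseCell
  rw [denseLevel_eq_of_cell_eq he h4, h4]

theorem card_filter_cell_le (E : Finset (ℕ × (Fin d → ℤ))) (l : ℕ) (Q : ℕ × (Fin d → ℤ)) :
    (E.filter (cell l · = Q)).card ≤ 2 ^ l * (2 ^ l) ^ d := by
  have h1 : (E.filter (cell l · = Q)).card ≤ (Finset.range (2 ^ l) ×ˢ
      Fintype.piFinset fun _ : Fin d => Finset.Ico (0:ℤ) (2 ^ l)).card := by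
    refine Finset.card_le_card_of_injOn (fun e => (e.1 % 2 ^ l, fun i => e.2 i % 2 ^ l)) ?_ ?_
    · intro e _
      simp only [Finset.coe_product, Set.mem_prod, Finset.mem_coe, Finset.mem_range,
        Fintype.mem_piFinset, Finset.mem_Ico]
      exact ⟨Nat.mod_lt _ (by positivity), fun i =>
        ⟨Int.emod_nonneg _ (by positivity), Int.emod_lt_of_pos _ (by positivity)⟩⟩
    · intro e he e' he' h
      have h2 : cell l e = cell l e' :=
        (Finset.mem_filter.1 he).2.trans (Finset.mem_filter.1 he').2.symm
      simp only [Prod.mk.injEq] at h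
      unfold cell at h2
      simp only [Prod.mk.injEq] at h2
      refine Prod.ext ?_ (funext fun i => ?_)
      · rw [← Nat.div_add_mod e.1 (2 ^ l), ← Nat.div_add_mod e'.1 (2 ^ l), h.1, h2.1]
      · rw [← Int.mul_ediv_add_emod (e.2 i) (2 ^ l), ← Int.mul_ediv_add_emod (e'.2 i) (2 ^ l),
          congrFun h.2 i, congrFun h2.2 i]
  refine h1.trans (le_of_eq ?_)
  rw [Finset.card_product, Finset.card_range, Fintype.card_piFinset]
  have h2 : ((2:ℤ) ^ l).toNat = 2 ^ l := by exact_mod_cast Int.toNat_natCast (2 ^ l)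
  simp [h2]

theorem IsDenseAt.lt_pow {E : Finset (ℕ × (Fin d → ℤ))} {u : ℝ} {l : ℕ} {e : ℕ × (Fin d → ℤ)}
    (h : IsDenseAt E u l e) : u < (2 ^ l) ^ d := by
  have h1 : ((E.filter (cell l · = cell l e)).card : ℝ) ≤ 2 ^ l * (2 ^ l) ^ d := by
    exact_mod_cast card_filter_cell_le E l (cell l e)
  have h2 : u * 2 ^ l < (2 ^ l) ^ d * 2 ^ l := by
    rw [mul_comm (((2:ℝ) ^ l) ^ d)]
    exact lt_of_lt_of_le h h1
  exact lt_of_mul_lt_mul_right h2 (by positivity)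

/-- The neighbourhood, of width proportional to the side length, of the wave front emanating
from a dyadic cell. -/
def cellWave (a : Rd d → ℝ) (A : ℝ) (Q : ℕ × ℕ × (Fin d → ℤ)) : Set (Rd d) :=
  {x | Metric.infDist (x - (2:ℝ) ^ Q.1 • latticeVec d Q.2.2) (waveSet a (2 ^ Q.1 * Q.2.1)) ≤
    A * 2 ^ Q.1}

theorem exists_volume_cellWave_le (hd : 1 ≤ d) (ha : IsDistFn a) {A : ℝ} (hA : 0 < A) :
    ∃ C : ℝ, 0 < C ∧ ∀ (u : ℝ), 0 < u → ∀ (j : ℕ) (E : Finset (ℕ × (Fin d → ℤ))),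
      (∀ e ∈ E, (e.1:ℝ) < 2 ^ (j + 1)) →
        volume (⋃ e ∈ densePart E u j, cellWave a A (denseCell E u j e)) ≤
          ENNReal.ofReal (C / u * (2 ^ (j * (d - 1)) * E.card)) := by
  obtain ⟨C, hC, h⟩ := exists_volume_waveSet_near_le hd ha hA
  refine ⟨C * 3 ^ (d - 1), by positivity, fun u hu j E hE => ?_⟩
  set I := (densePart E u j).image (denseCell E u j) with hI
  have h1 : (⋃ e ∈ densePart E u j, cellWave a A (denseCell E u j e)) ⊆
      ⋃ Q ∈ I, cellWave a A Q := by
    refine iUnion₂_subset fun e he => ?_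
    exact subset_biUnion_of_mem (u := cellWave a A)
      (show denseCell E u j e ∈ (I : Set _) from Finset.mem_image_of_mem _ he)
  refine (measure_mono h1).trans ((measure_biUnion_finset_le _ _).trans ?_)
  have h2 : ∀ Q ∈ I, volume (cellWave a A Q) ≤
      ENNReal.ofReal (C * 3 ^ (d - 1) * 2 ^ (j * (d - 1)) * 2 ^ Q.1) := by
    intro Q hQ
    refine (h _ (2 ^ Q.1) _ (by positivity)).trans (ENNReal.ofReal_le_ofReal ?_)
    obtain ⟨e, he, rfl⟩ := Finset.mem_image.1 hQ
    obtain ⟨hk, -⟩ := isDenseAt_denseLevel he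
    change C * (2 ^ denseLevel E u j e) ^ d * (1 + |(2:ℝ) ^ denseLevel E u j e *
      (cell (denseLevel E u j e) e).1| / 2 ^ denseLevel E u j e) ^ (d - 1) ≤
      C * 3 ^ (d - 1) * 2 ^ (j * (d - 1)) * 2 ^ denseLevel E u j e
    set k := denseLevel E u j e
    have h2k : (0:ℝ) < 2 ^ k := by positivity
    have hkj : (2:ℝ) ^ k ≤ 2 ^ j := pow_le_pow_right₀ one_le_two hk
    have hcell := (cell_fst_mem k e).1
    have he2 := hE e (Finset.mem_filter.1 he).1
    rw [pow_succ] at he2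
    have h3 : 1 + |(2:ℝ) ^ k * (cell k e).1| / 2 ^ k ≤ 3 * (2 ^ j / 2 ^ k) := by
      rw [abs_of_nonneg (by positivity), mul_div_cancel_left₀ _ h2k.ne']
      have h4 : (1:ℝ) ≤ 2 ^ j / 2 ^ k := (one_le_div h2k).2 hkj
      have h5 : (e.1:ℝ) / 2 ^ k ≤ 2 * (2 ^ j / 2 ^ k) := by
        rw [← mul_div_assoc]; gcongr; linarith
      linarith
    have h6 : ((2:ℝ) ^ k) ^ d = (2 ^ k) ^ (d - 1) * 2 ^ k := by
      rw [← pow_succ, Nat.sub_add_cancel hd]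
    calc _ ≤ C * (2 ^ k) ^ d * (3 * (2 ^ j / 2 ^ k)) ^ (d - 1) := by gcongr
      _ = C * 3 ^ (d - 1) * (2 ^ k * (2 ^ j / 2 ^ k)) ^ (d - 1) * 2 ^ k := by
        rw [h6, mul_pow, mul_pow (2 ^ k)]; ring
      _ = _ := by rw [mul_div_cancel₀ _ h2k.ne', ← pow_mul]
  refine (Finset.sum_le_sum h2).trans ?_
  rw [← ENNReal.ofReal_sum_of_nonneg fun Q _ => by positivity]
  refine ENNReal.ofReal_le_ofReal ?_
  rw [← Finset.mul_sum]
  have h7 : ∑ Q ∈ I, (2:ℝ) ^ Q.1 ≤ E.card / u := by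
    rw [le_div_iff₀ hu, mul_comm]
    exact mul_sum_image_denseCell_le E u j
  calc _ ≤ C * 3 ^ (d - 1) * 2 ^ (j * (d - 1)) * (E.card / u) := by gcongr
    _ = _ := by ring

theorem exists_one_le_of_notMem_cellWave (hd : 1 ≤ d) (ha : IsDistFn a) :
    ∃ A : ℝ, 0 < A ∧ ∀ (u : ℝ), 0 < u → ∀ (j : ℕ) (E : Finset (ℕ × (Fin d → ℤ))),
      ∀ e ∈ densePart E u j, ∀ x ∉ cellWave a A (denseCell E u j e),
        1 ≤ u⁻¹ * (1 + Metric.infDist (x - latticeVec d e.2) (waveSet a e.1)) ^ d := by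
  obtain ⟨G, hG, h⟩ := exists_infDist_waveSet_le_add hd ha
  refine ⟨G + d + 1, by positivity, fun u hu j E e he x hx => ?_⟩
  have hlt := (isDenseAt_denseLevel he).2.lt_pow
  rw [← div_eq_inv_mul, one_le_div hu]
  refine hlt.le.trans ?_
  gcongr
  change ¬ (Metric.infDist (x - (2:ℝ) ^ denseLevel E u j e • latticeVec d
    (cell (denseLevel E u j e) e).2) (waveSet a (2 ^ denseLevel E u j e *
      (cell (denseLevel E u j e) e).1)) ≤ (G + d + 1) * 2 ^ denseLevel E u j e) at hx
  set k := denseLevel E u j e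
  have h2k : (0:ℝ) < 2 ^ k := by positivity
  push Not at hx
  have h1 : ‖(x - (2:ℝ) ^ k • latticeVec d (cell k e).2) - (x - latticeVec d e.2)‖ ≤ 2 ^ k * d := by
    have h2 : (x - (2:ℝ) ^ k • latticeVec d (cell k e).2) - (x - latticeVec d e.2) =
        (2:ℝ) ^ k • (((2:ℝ) ^ k)⁻¹ • latticeVec d e.2 - latticeVec d (cell k e).2) := by
      rw [smul_sub, smul_inv_smul₀ h2k.ne']; abel
    rw [h2, norm_smul, Real.norm_of_nonneg h2k.le]
    gcongr
    exact norm_smul_latticeVec_sub_le k e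
  have h3 := Metric.infDist_le_infDist_add_dist (s := waveSet a (2 ^ k * (cell k e).1))
    (x := x - (2:ℝ) ^ k • latticeVec d (cell k e).2) (y := x - latticeVec d e.2)
  rw [dist_eq_norm] at h3
  have h4 := h (2 ^ k * (cell k e).1) e.1 (x - latticeVec d e.2)
  have h5 : |2 ^ k * ((cell k e).1:ℝ) - e.1| ≤ 2 ^ k := by
    obtain ⟨h6, h7⟩ := cell_fst_mem k e
    rw [le_div_iff₀ h2k] at h6
    rw [div_le_iff₀ h2k] at h7
    rw [abs_le]
    constructor <;> linarith
  have h8 : G * |2 ^ k * ((cell k e).1:ℝ) - e.1| ≤ G * 2 ^ k := by gcongr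
  linarith

end

section
variable {d : ℕ} {a : Rd d → ℝ} {χ : ℝ → ℝ}

theorem exists_volume_finite_sum_le (hd : 4 ≤ d) (ha : IsDistFn a) (hcurv : CurvNondeg a)
    (hχs : ContDiff ℝ (⊤ : ℕ∞) χ) (hχ : ∀ x, x ∉ Icc (1/8 : ℝ) 8 → χ x = 0)
    {p : ℝ} (hp1 : 1 < p) (hp2 : p < 2 * ((d : ℝ) - 1) / ((d : ℝ) + 1)) :
    ∃ C : ℝ, 0 < C ∧ ∀ lam : ℝ, 0 < lam →
      ∀ (J : Finset ℕ) (E : ℕ → Finset (ℕ × (Fin d → ℤ))),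
      (∀ j, ∀ e ∈ E j, (2:ℝ) ^ j ≤ e.1 ∧ (e.1:ℝ) < 2 ^ (j + 1)) →
      ∀ b : ℕ × (Fin d → ℤ) → Rd d → ℂ, (∀ e, IsNormalized e.2 (b e)) →
      volume {x : Rd d | lam <
          ‖∑ j ∈ J, ((((√2) ^ j) ^ (d - 1) : ℝ) : ℂ) *
            ∑ e ∈ E j, conv (Kker a χ (e.1 : ℝ)) (b e) x‖} ≤
        ENNReal.ofReal (C * lam ^ (-p) * ∑ j ∈ J, (2:ℝ) ^ (j * (d - 1)) * (E j).card) := by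
  have hd1 : 1 ≤ d := by omega
  obtain ⟨A, hA, hoff⟩ := exists_one_le_of_notMem_cellWave hd1 ha
  obtain ⟨C₁, hC₁, hsparse⟩ := exists_volume_sparse_le hd ha hcurv hχs hχ hp1 hp2
  obtain ⟨C₂, hC₂, hexc⟩ := exists_volume_cellWave_le hd1 ha hA
  obtain ⟨C₃, hC₃, hL1⟩ := exists_volume_off_wave_le hd1 ha hcurv hχs hχ
  refine ⟨C₁ + C₂ + 2 * C₃, by positivity, fun lam hlam J E hE b hb => ?_⟩
  set W := ∑ j ∈ J, (2:ℝ) ^ (j * (d - 1)) * (E j).card with hW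
  have hW0 : 0 ≤ W := Finset.sum_nonneg fun j _ => by positivity
  have hu0 : 0 < lam ^ (-p) := by positivity
  rcases lt_or_ge lam 1 with hlam1 | hlam1
  · have h1 := hL1 lam 1 univ hlam zero_le_one J E (fun j e he => (hE j e he).2)
      (fun j _ e _ x _ => by
        rw [one_mul]
        exact one_le_pow₀ (le_add_of_nonneg_right Metric.infDist_nonneg)) b hb
    simp only [mem_univ, true_and] at h1
    refine h1.trans (ENNReal.ofReal_le_ofReal ?_)
    have h2 : lam⁻¹ ≤ lam ^ (-p) := by
      rw [← Real.rpow_neg_one]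
      exact Real.rpow_le_rpow_of_exponent_ge hlam hlam1.le (by linarith)
    rw [mul_one, div_eq_mul_inv]
    rw [← hW]
    refine mul_le_mul_of_nonneg_right ?_ hW0
    exact mul_le_mul (by linarith) h2 (by positivity) (by positivity)
  · set u := lam ^ p with hu
    have hup : 0 < u := by positivity
    have hui : u⁻¹ = lam ^ (-p) := by rw [Real.rpow_neg hlam.le]
    set Es : ℕ → Finset (ℕ × (Fin d → ℤ)) := fun j => sparsePart (E j) u j with hEs
    set Ed : ℕ → Finset (ℕ × (Fin d → ℤ)) := fun j => densePart (E j) u j with hEd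
    have hEsE : ∀ j, Es j ⊆ E j := fun j => Finset.filter_subset _ _
    have hEdE : ∀ j, Ed j ⊆ E j := fun j => Finset.filter_subset _ _
    have hcard : ∀ E' : ℕ → Finset (ℕ × (Fin d → ℤ)), (∀ j, E' j ⊆ E j) →
        ∑ j ∈ J, (2:ℝ) ^ (j * (d - 1)) * (E' j).card ≤ W := fun E' h =>
      Finset.sum_le_sum fun j _ => by
        gcongr
        exact h j
    set X : Set (Rd d) := ⋃ j ∈ J, ⋃ e ∈ Ed j, cellWave a A (denseCell (E j) u j e) with hX
    have hXv : volume X ≤ ENNReal.ofReal (C₂ * lam ^ (-p) * W) := by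
      refine (measure_biUnion_finset_le _ _).trans ((Finset.sum_le_sum fun j _ =>
        hexc u hup j (E j) fun e he => (hE j e he).2).trans ?_)
      rw [← ENNReal.ofReal_sum_of_nonneg fun j _ => by positivity, ← Finset.mul_sum, ← hui,
        div_eq_mul_inv]
    have hs := hsparse lam hlam1 J Es (fun j e he => hE j e (hEsE j he))
      (fun j l hl Q => card_sparsePart_filter_le hup.le hl Q) b hb
    have hdn := hL1 (lam / 2) u⁻¹ Xᶜ (by positivity) (by positivity) J Ed
      (fun j e he => (hE j e (hEdE j he)).2)
      (fun j hj e he x hx => hoff u hup j (E j) e he x fun hx' =>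
        hx (mem_biUnion (x := j) hj (mem_biUnion (x := e) he hx'))) b hb
    set S : (ℕ → Finset (ℕ × (Fin d → ℤ))) → Rd d → ℂ := fun E' x =>
      ∑ j ∈ J, ((((√2) ^ j) ^ (d - 1) : ℝ) : ℂ) *
        ∑ e ∈ E' j, conv (Kker a χ (e.1 : ℝ)) (b e) x with hS
    have hsplit : ∀ x, S E x = S Ed x + S Es x := fun x => by
      rw [hS]
      simp only
      rw [← Finset.sum_add_distrib]
      refine Finset.sum_congr rfl fun j _ => ?_
      rw [← mul_add, hEs, hEd]
      congr 1
      exact (Finset.sum_filter_add_sum_filter_not _ _ _).symm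
    have hcov : {x | lam < ‖S E x‖} ⊆
        X ∪ {x | x ∈ Xᶜ ∧ lam / 2 < ‖S Ed x‖} ∪ {x | lam / 2 < ‖S Es x‖} := by
      intro x hx
      change lam < ‖S E x‖ at hx
      rw [hsplit] at hx
      by_contra hcon
      simp only [mem_union, mem_setOf_eq, mem_compl_iff, not_or, not_and, not_lt] at hcon
      have := norm_add_le (S Ed x) (S Es x)
      linarith [hcon.1.2 hcon.1.1, hcon.2]
    refine (measure_mono hcov).trans ((measure_union_le _ _).trans
      ((add_le_add ((measure_union_le _ _).trans (add_le_add hXv hdn)) hs).trans ?_))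
    have hWs := hcard Es hEsE
    have hWd := hcard Ed hEdE
    have h0s : 0 ≤ ∑ j ∈ J, (2:ℝ) ^ (j * (d - 1)) * (Es j).card :=
      Finset.sum_nonneg fun j _ => by positivity
    have h0d : 0 ≤ ∑ j ∈ J, (2:ℝ) ^ (j * (d - 1)) * (Ed j).card :=
      Finset.sum_nonneg fun j _ => by positivity
    generalize ∑ j ∈ J, (2:ℝ) ^ (j * (d - 1)) * (Es j).card = Ws at hWs h0s ⊢
    generalize ∑ j ∈ J, (2:ℝ) ^ (j * (d - 1)) * (Ed j).card = Wd at hWd h0d ⊢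
    clear_value W u
    clear hs hdn hXv hcov hsplit
    rw [← ENNReal.ofReal_add (by positivity) (by positivity),
      ← ENNReal.ofReal_add (by positivity) (by positivity)]
    refine ENNReal.ofReal_le_ofReal ?_
    have h3 : C₃ * u⁻¹ / (lam / 2) ≤ 2 * C₃ * lam ^ (-p) := by
      rw [hui, div_le_iff₀ (by positivity)]
      have h4 : 0 ≤ C₃ * lam ^ (-p) * (lam - 1) :=
        mul_nonneg (by positivity) (by linarith)
      linarith
    calc _ ≤ C₂ * lam ^ (-p) * W + 2 * C₃ * lam ^ (-p) * W + C₁ * lam ^ (-p) * W :=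
          add_le_add (add_le_add_right (mul_le_mul h3 hWd h0d (by positivity)) _)
            (mul_le_mul_of_nonneg_left hWs (by positivity))
      _ = _ := by ring

theorem two_rpow_eq_sqrt_two_pow (hd : 1 ≤ d) (j : ℕ) :
    (2:ℝ) ^ (((j:ℝ) * ((d:ℝ) - 1)) / 2) = ((√2) ^ j) ^ (d - 1) := by
  rw [← pow_mul, Real.sqrt_eq_rpow, ← Real.rpow_mul_natCast two_pos.le]
  congr 1
  rw [Nat.cast_mul, Nat.cast_sub hd]
  push_cast
  ring

end

/-- the restricted weak type inequality for the discretized operator: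
`meas{x : |∑_{j≥1} 2^{j(d-1)/2} ∑_{(n,z)∈E_j} K_n ∗ b_{n,z}| > λ} ≲ λ^{-p} ∑_{j≥1} 2^{j(d-1)} #E_j`. -/
theorem statement4 (d : ℕ) (hd : 4 ≤ d) (a : Rd d → ℝ) (ha : IsDistFn a)
    (hcurv : CurvNondeg a) (η : ℝ → ℝ) (hη : IsBump η)
    (p : ℝ) (hp1 : 1 < p) (hp2 : p < 2 * ((d : ℝ) - 1) / ((d : ℝ) + 1)) :
    ∃ C : ℝ, 0 < C ∧ ∀ lam : ℝ, 0 < lam →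
      ∀ E : ℕ → Finset (ℕ × (Fin d → ℤ)), E 0 = ∅ →
      (∀ j : ℕ, ∀ e ∈ E j, (2 : ℝ) ^ j ≤ (e.1 : ℝ) ∧ (e.1 : ℝ) < 2 ^ (j + 1)) →
      ∀ b : ℕ × (Fin d → ℤ) → Rd d → ℂ, (∀ e, IsNormalized e.2 (b e)) →
      volume {x : Rd d | lam <
          ‖∑' j : ℕ, (((2 : ℝ) ^ (((j : ℝ) * ((d : ℝ) - 1)) / 2) : ℝ) : ℂ) *
            ∑ e ∈ E j, conv (Kker a η (e.1 : ℝ)) (b e) x‖} ≤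
        ENNReal.ofReal (C * lam ^ (-p)) *
          ∑' j : ℕ, 2 ^ (j * (d - 1)) * ((E j).card : ℝ≥0∞) := by
  obtain ⟨C, hC, h⟩ := exists_volume_finite_sum_le hd ha hcurv hη.smooth hη.supp hp1 hp2
  refine ⟨C, hC, fun lam hlam E _ hE b hb => ?_⟩
  by_cases hfin : {j | E j ≠ ∅}.Finite
  · set J := hfin.toFinset
    have hJ : ∀ j ∉ J, E j = ∅ := fun j hj => by
      simpa [J] using hj
    have h1 : ∀ x : Rd d, ∑' j : ℕ, (((2 : ℝ) ^ (((j : ℝ) * ((d : ℝ) - 1)) / 2) : ℝ) : ℂ) *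
        ∑ e ∈ E j, conv (Kker a η (e.1 : ℝ)) (b e) x =
        ∑ j ∈ J, ((((√2) ^ j) ^ (d - 1) : ℝ) : ℂ) *
          ∑ e ∈ E j, conv (Kker a η (e.1 : ℝ)) (b e) x := fun x => by
      rw [tsum_eq_sum (s := J) fun j hj => by rw [hJ j hj, Finset.sum_empty, mul_zero]]
      exact Finset.sum_congr rfl fun j _ => by rw [two_rpow_eq_sqrt_two_pow (by omega)]
    simp_rw [h1]
    refine (h lam hlam J E hE b hb).trans ?_
    rw [ENNReal.ofReal_mul (by positivity)]
    gcongr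
    refine le_trans (le_of_eq ?_) (ENNReal.sum_le_tsum J)
    rw [ENNReal.ofReal_sum_of_nonneg fun j _ => by positivity]
    refine Finset.sum_congr rfl fun j _ => ?_
    rw [ENNReal.ofReal_mul (by positivity), ENNReal.ofReal_pow two_pos.le, ENNReal.ofReal_natCast,
      ENNReal.ofReal_ofNat]
  · have h1 : ∑' j : ℕ, 2 ^ (j * (d - 1)) * ((E j).card : ℝ≥0∞) = ∞ := by
      have : Infinite {j | E j ≠ ∅} := Set.infinite_coe_iff.2 hfin
      rw [eq_top_iff, ← ENNReal.tsum_const_eq_top_of_ne_zero (α := {j | E j ≠ ∅}) one_ne_zero]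
      refine le_trans ?_ (ENNReal.tsum_comp_le_tsum_of_injective
        (Subtype.val_injective (p := fun j => j ∈ {j | E j ≠ ∅})) _)
      refine ENNReal.tsum_le_tsum fun j => ?_
      have h2 : 1 ≤ (E j).card := Finset.card_pos.2 (Finset.nonempty_iff_ne_empty.2 j.2)
      exact one_le_mul (one_le_pow₀ one_le_two) (by exact_mod_cast h2)
    rw [h1, ENNReal.mul_top (ENNReal.ofReal_pos.2 (by positivity)).ne']
    exact le_top
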